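/- Suppose n = 2. If (2/l)₄ = (−1)^((l−1)/8), then r₂(H) = 2; if (2/l)₄ ≠ (−1)^((l−1)/8), then r₂(H) = 1. -/

import Mathlib

/-- `ε` is the fundamental unit of the real quadratic field `ℚ(√l)` (viewed inside `ℝ`):
it lies in `ℚ(√l)`, it is a unit of the ring of integers (both `ε` and `ε⁻¹` are
algebraic integers), `ε > 1`, and it is the smallest such unit. -/
def IsFundamentalUnit (l : ℕ) (ε : ℝ) : Prop :=
  1 < ε ∧ ε ∈ IntermediateField.adjoin ℚ ({Real.sqrt (l : ℝ)} : Set ℝ) ∧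
    IsIntegral ℤ ε ∧ IsIntegral ℤ ε⁻¹ ∧
    ∀ x : ℝ, 1 < x → x ∈ IntermediateField.adjoin ℚ ({Real.sqrt (l : ℝ)} : Set ℝ) →
      IsIntegral ℤ x → IsIntegral ℤ x⁻¹ → ε ≤ x

/-- The Legendre symbol `(a/p)`, via Euler's criterion (so that no `Fact p.Prime`
instance is needed): for an odd prime `p` it is `1` if `a` is a nonzero square mod `p`,
`0` if `p ∣ a`, and `-1` otherwise. -/
def legSym (p : ℕ) (a : ℤ) : ℤ :=
  if (a : ZMod p) ^ ((p - 1) / 2) = 1 then 1 else if (a : ZMod p) = 0 then 0 else -1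

/-- The rational fourth power residue symbol `(a/p)₄ ∈ {±1}`, meaningful when
`(a/p) = 1`; it is determined by `(a/p)₄ ≡ a ^ ((p-1)/4) (mod p)`. -/
def quartSym (p : ℕ) (a : ℤ) : ℤ :=
  if (a : ZMod p) ^ ((p - 1) / 4) = 1 then 1 else -1

/-- The cardinality of the 2-torsion subgroup of the class group of `K`.
For a number field `K` this equals `2 ^ r₂(H)`, where `r₂(H)` is the rank of the
2-class group `H` of `K` (i.e. `dim_{𝔽₂} Cl(K)/Cl(K)²`); in particular
`r₂(H) = r` iff this cardinality is `2 ^ r`. -/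
noncomputable def twoTorsCard (K : IntermediateField ℚ ℝ) : ℕ :=
  Nat.card {x : ClassGroup (NumberField.RingOfIntegers K) // x ^ 2 = 1}

open NumberField
open scoped nonZeroDivisors

/-- `s` is the nontrivial automorphism of a quadratic extension `S / R` of domains. -/
structure IsQuadraticConj {R S : Type*} [CommRing R] [CommRing S] [Algebra R S]
    (s : S ≃ₐ[R] S) : Prop where
  inj : Function.Injective (algebraMap R S)
  invol : ∀ x, s (s x) = x
  fixed : ∀ x, s x = x → ∃ r, algebraMap R S r = x
  ne : ∃ c, s c ≠ c

namespace IsQuadraticConj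

variable {R S : Type*} [CommRing R] [CommRing S] [Algebra R S] {s : S ≃ₐ[R] S}

theorem exists_norm (hs : IsQuadraticConj s) (x : S) : ∃ r, algebraMap R S r = x * s x :=
  hs.fixed _ (by rw [map_mul, hs.invol, mul_comm])

/-- The relative norm of a quadratic extension. -/
noncomputable def norm (hs : IsQuadraticConj s) : S →* R where
  toFun x := (hs.exists_norm x).choose
  map_one' := hs.inj (by rw [(hs.exists_norm 1).choose_spec]; simp)
  map_mul' x y := hs.inj (by
    rw [map_mul (algebraMap R S), (hs.exists_norm (x * y)).choose_spec,
      (hs.exists_norm x).choose_spec, (hs.exists_norm y).choose_spec, map_mul]; ring)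

theorem algebraMap_norm (hs : IsQuadraticConj s) (x : S) :
    algebraMap R S (hs.norm x) = x * s x :=
  (hs.exists_norm x).choose_spec

theorem norm_algebraMap (hs : IsQuadraticConj s) (r : R) :
    hs.norm (algebraMap R S r) = r ^ 2 :=
  hs.inj (by rw [hs.algebraMap_norm, AlgEquiv.commutes, map_pow, sq])

theorem exists_trace (hs : IsQuadraticConj s) (x : S) : ∃ r, algebraMap R S r = x + s x :=
  hs.fixed _ (by rw [map_add, hs.invol, add_comm])

theorem mem_map (hs : IsQuadraticConj s) {I : Ideal S} {x : S} :
    x ∈ I.map s ↔ s x ∈ I := by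
  have := Ideal.mem_map_of_equiv (I := I) s x
  rw [this]
  constructor
  · rintro ⟨y, hy, rfl⟩
    rwa [hs.invol]
  · intro h
    exact ⟨s x, h, hs.invol x⟩

theorem map_map (hs : IsQuadraticConj s) (I : Ideal S) : (I.map s).map s = I := by
  ext x
  rw [hs.mem_map, hs.mem_map, hs.invol]

theorem map_span (s : S ≃ₐ[R] S) (x : S) :
    (Ideal.span {x}).map s = Ideal.span {s x} := by
  rw [Ideal.map_span, Set.image_singleton]

theorem map_algebraMap (hs : IsQuadraticConj s) (p : Ideal R) :
    (p.map (algebraMap R S)).map s = p.map (algebraMap R S) := by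
  have key : ∀ q : Ideal R, (q.map (algebraMap R S)).map s ≤ q.map (algebraMap R S) := by
    intro q
    rw [Ideal.map_le_iff_le_comap, Ideal.map_le_iff_le_comap]
    intro x hx
    rw [Ideal.mem_comap, Ideal.mem_comap, AlgEquiv.commutes]
    exact Ideal.mem_map_of_mem _ hx
  refine le_antisymm (key p) ?_
  conv_lhs => rw [← hs.map_map (p.map _)]
  exact Ideal.map_mono (key p)

theorem isPrime_map (s : S ≃ₐ[R] S) {P : Ideal S} (hP : P.IsPrime) : (P.map s).IsPrime :=
  Ideal.map_isPrime_of_equiv s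

theorem map_ne_bot (hs : IsQuadraticConj s) {P : Ideal S} (hP : P ≠ ⊥) : P.map s ≠ ⊥ := by
  intro h
  apply hP
  rw [← hs.map_map P, h, Ideal.map_bot]

section Dedekind

variable [IsDedekindDomain S]

theorem eq_or_eq_of_map_le (hs : IsQuadraticConj s) {P Q : Ideal S} (hP : P.IsPrime)
    (hP0 : P ≠ ⊥) (hQ : Q.IsPrime)
    (h : (P.comap (algebraMap R S)).map (algebraMap R S) ≤ Q) : Q = P ∨ Q = P.map s := by
  have hmax : P.IsMaximal := hP.isMaximal hP0
  have hsub : (P : Set S) ⊆ (Q : Set S) ∪ (Q.map s : Ideal S) := by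
    intro x hx
    have h1 : x * s x ∈ Q := by
      rw [← hs.algebraMap_norm]
      apply h
      apply Ideal.mem_map_of_mem
      rw [Ideal.mem_comap, hs.algebraMap_norm]
      exact P.mul_mem_right _ hx
    rcases hQ.mem_or_mem h1 with h2 | h2
    · exact Or.inl h2
    · exact Or.inr (hs.mem_map.2 h2)
  rcases Ideal.subset_union.1 hsub with h1 | h1
  · exact Or.inl (hmax.eq_of_le hQ.ne_top h1).symm
  · right
    rw [hmax.eq_of_le (isPrime_map s hQ).ne_top h1, hs.map_map]

theorem map_comap_ne_bot (hs : IsQuadraticConj s) {P : Ideal S} (hP0 : P ≠ ⊥) :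
    (P.comap (algebraMap R S)).map (algebraMap R S) ≠ ⊥ := by
  obtain ⟨x, hx, hx0⟩ := Submodule.exists_mem_ne_zero_of_ne_bot hP0
  intro h
  have h1 : x * s x ∈ (P.comap (algebraMap R S)).map (algebraMap R S) := by
    rw [← hs.algebraMap_norm]
    apply Ideal.mem_map_of_mem
    rw [Ideal.mem_comap, hs.algebraMap_norm]
    exact P.mul_mem_right _ hx
  rw [h, Ideal.mem_bot, mul_eq_zero] at h1
  rcases h1 with h1 | h1
  · exact hx0 h1
  · exact hx0 ((map_eq_zero_iff s s.injective).1 h1)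

theorem exists_mem_notMem_sq {P : Ideal S} (hP : P.IsPrime) (hP0 : P ≠ ⊥) :
    ∃ x ∈ P, x ∉ P ^ 2 := by
  have h : ¬ P ≤ P ^ 2 := by
    intro h
    have := Ideal.pow_right_strictAnti P hP0 hP.ne_top (show 1 < 2 by norm_num)
    simp only [pow_one] at this
    exact absurd h (not_le_of_gt this)
  exact Set.not_subset.1 h

theorem mul_notMem_cube {P : Ideal S} (hP : P.IsPrime) (hP0 : P ≠ ⊥) {x y : S}
    (hx : x ∈ P) (hx2 : x ∉ P ^ 2) (hy : y ∈ P) (hy2 : y ∉ P ^ 2) : x * y ∉ P ^ 3 := by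
  have hprime : Prime P := Ideal.prime_of_isPrime hP0 hP
  intro h
  rw [← Ideal.dvd_span_singleton] at *
  obtain ⟨J, hJ⟩ := hx
  obtain ⟨J', hJ'⟩ := hy
  rw [← Ideal.span_singleton_mul_span_singleton, hJ, hJ',
    show P * J * (P * J') = P ^ 2 * (J * J') by ring, pow_succ P 2,
    mul_dvd_mul_iff_left (pow_ne_zero 2 hprime.ne_zero)] at h
  rcases hprime.dvd_or_dvd h with h | h
  · apply hx2
    rw [hJ, sq]
    exact mul_dvd_mul_left _ h
  · apply hy2
    rw [hJ', sq]
    exact mul_dvd_mul_left _ h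

theorem exists_mem_notMem_sq_notMem {P Q : Ideal S} (hP : P.IsPrime) (hP0 : P ≠ ⊥)
    (hQ : Q.IsPrime) (hne : Q ≠ P) : ∃ x ∈ P, x ∉ P ^ 2 ∧ x ∉ Q := by
  have hmax : P.IsMaximal := hP.isMaximal hP0
  by_contra! H
  have hsub : (P : Set S) ⊆ (P ^ 2 : Ideal S) ∪ (Q : Set S) := by
    intro x hx
    by_cases h : x ∈ P ^ 2
    · exact Or.inl h
    · exact Or.inr (H x hx h)
  rcases Ideal.subset_union.1 hsub with h1 | h1
  · obtain ⟨x, hx, hx2⟩ := exists_mem_notMem_sq hP hP0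
    exact hx2 (h1 hx)
  · exact hne (hmax.eq_of_le hQ.ne_top h1).symm

theorem prime_map (hs : IsQuadraticConj s) {P : Ideal S} (hP : P.IsPrime) (hP0 : P ≠ ⊥) :
    Prime (P.map s) :=
  Ideal.prime_of_isPrime (hs.map_ne_bot hP0) (isPrime_map s hP)

theorem mul_map_dvd (hs : IsQuadraticConj s) {P A : Ideal S} (hP : P.IsPrime) (hP0 : P ≠ ⊥)
    (hne : P.map s ≠ P) (hA : A ≤ P) (hsA : A ≤ P.map s) : P * P.map s ∣ A := by
  obtain ⟨J, rfl⟩ := Ideal.dvd_iff_le.2 hA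
  apply mul_dvd_mul_left
  rcases (hs.prime_map hP hP0).dvd_or_dvd (Ideal.dvd_iff_le.2 hsA) with h | h
  · exact absurd ((hP.isMaximal hP0).eq_of_le (isPrime_map s hP).ne_top (Ideal.dvd_iff_le.1 h)).symm
      hne
  · exact h

/-- Decomposition of a prime of `S` over `R`. -/
theorem map_comap_eq (hs : IsQuadraticConj s) {P : Ideal S} (hP : P.IsPrime) (hP0 : P ≠ ⊥) :
    (P.comap (algebraMap R S)).map (algebraMap R S) = P ∨
      (P.comap (algebraMap R S)).map (algebraMap R S) = P * P.map s := by
  set q := (P.comap (algebraMap R S)).map (algebraMap R S) with hq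
  have hq0 : q ≠ ⊥ := hs.map_comap_ne_bot hP0
  have hqP : q ≤ P := Ideal.map_comap_le
  have hqs : q.map s = q := hs.map_algebraMap _
  have hqsP : q ≤ P.map s := by rw [← hqs]; exact Ideal.map_mono hqP
  have hN : ∀ x ∈ P, x * s x ∈ q := by
    intro x hx
    rw [← hs.algebraMap_norm]
    apply Ideal.mem_map_of_mem
    rw [Ideal.mem_comap, hs.algebraMap_norm]
    exact P.mul_mem_right _ hx
  have hprime : Prime P := Ideal.prime_of_isPrime hP0 hP
  have htop : ∀ J : Ideal S, q ≤ J → ¬ J ≤ P → ¬ J ≤ P.map s → J = ⊤ := by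
    intro J hJ h1 h2
    by_contra h
    obtain ⟨M, hM, hJM⟩ := Ideal.exists_le_maximal J h
    rcases hs.eq_or_eq_of_map_le hP hP0 hM.isPrime (hJ.trans hJM) with rfl | rfl
    · exact h1 hJM
    · exact h2 hJM
  by_cases hsP : P.map s = P
  · rw [hsP] at htop ⊢
    obtain ⟨J, hqJ, hJ⟩ := (FiniteMultiplicity.of_prime_left hprime
      (show q ≠ 0 from hq0)).exists_eq_pow_mul_and_not_dvd
    rw [htop J (by rw [hqJ]; exact Ideal.mul_le_right) (fun h => hJ (Ideal.dvd_iff_le.2 h))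
      (fun h => hJ (Ideal.dvd_iff_le.2 h)), ← Ideal.one_eq_top, mul_one] at hqJ
    have hk : multiplicity P q < 3 := by
      by_contra! hk
      obtain ⟨x, hx, hx2⟩ := exists_mem_notMem_sq hP hP0
      have h1 : s x ∈ P := by rw [← hs.mem_map, hsP]; exact hx
      have h2 : s x ∉ P ^ 2 := by
        rw [← hs.mem_map, Ideal.map_pow, hsP]; exact hx2
      apply mul_notMem_cube hP hP0 hx hx2 h1 h2
      have := hN x hx
      rw [hqJ] at this
      exact Ideal.pow_le_pow_right hk this
    have hk0 : multiplicity P q ≠ 0 := by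
      intro h
      rw [h, pow_zero, Ideal.one_eq_top] at hqJ
      rw [hqJ] at hqP
      exact hP.ne_top (top_le_iff.1 hqP)
    rcases (show multiplicity P q = 1 ∨ multiplicity P q = 2 by omega) with h | h
    · left; rw [hqJ, h, pow_one]
    · right; rw [hqJ, h, sq]
  · right
    have hnot : ¬ q ≤ P ^ 2 := by
      intro h
      obtain ⟨x, hx, hx2, hxs⟩ := exists_mem_notMem_sq_notMem hP hP0 (isPrime_map s hP) hsP
      have h1 := h (hN x hx)
      rw [mul_comm] at h1
      rcases Ideal.IsPrime.mul_mem_pow P h1 with h2 | h2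
      · exact hxs (hs.mem_map.2 h2)
      · exact hx2 h2
    obtain ⟨J, hJ⟩ := hs.mul_map_dvd hP hP0 hsP hqP hqsP
    rw [hJ, htop J, ← Ideal.one_eq_top, mul_one]
    · rw [hJ]; exact Ideal.mul_le_right
    · intro h
      apply hnot
      rw [hJ, sq, mul_right_comm]
      exact Ideal.mul_le_left.trans (Ideal.mul_mono_right h)
    · intro h
      apply hnot
      rw [← hqs, hJ, ← hs.map_map (P ^ 2)]
      apply Ideal.map_mono
      rw [Ideal.map_pow, sq, mul_assoc]
      exact Ideal.mul_le_right.trans (Ideal.mul_mono_right h)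

/-- Ramified primes. -/
def ramified (R : Type*) {S : Type*} [CommRing R] [CommRing S] [Algebra R S] :
    Set (Ideal S) :=
  {P | P.IsPrime ∧ P ≠ ⊥ ∧ (P.comap (algebraMap R S)).map (algebraMap R S) = P ^ 2}

theorem map_eq_of_mem_ramified (hs : IsQuadraticConj s) {P : Ideal S}
    (hP : P ∈ ramified R) : P.map s = P := by
  obtain ⟨h1, h0, h2⟩ := hP
  have h3 : (P.map s) ∣ P ^ 2 := by
    rw [← h2, ← hs.map_algebraMap, h2, Ideal.map_pow]
    exact dvd_pow_self _ two_ne_zero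
  have h4 := (hs.prime_map h1 h0).dvd_of_dvd_pow h3
  exact ((h1.isMaximal h0).eq_of_le (isPrime_map s h1).ne_top (Ideal.dvd_iff_le.1 h4)).symm

/-- The conjugation acts trivially modulo a ramified prime. -/
theorem sub_mem_of_mem_ramified (hs : IsQuadraticConj s) {P : Ideal S}
    (hP : P ∈ ramified R) (y : S) : s y - y ∈ P := by
  have hsP := hs.map_eq_of_mem_ramified hP
  obtain ⟨h1, h0, h2⟩ := hP
  obtain ⟨x, hx, hx2⟩ := exists_mem_notMem_sq h1 h0
  have hT : ∀ z ∈ P, z + s z ∈ P ^ 2 := by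
    intro z hz
    obtain ⟨r, hr⟩ := hs.exists_trace z
    rw [← hr, ← h2]
    apply Ideal.mem_map_of_mem
    rw [Ideal.mem_comap, hr]
    refine P.add_mem hz ?_
    rwa [← hs.mem_map, hsP]
  have h3 : (s y - y) * x ∈ P ^ 2 := by
    have := (P ^ 2).sub_mem ((P ^ 2).mul_mem_right (s y) (hT x hx))
      (hT (x * y) (P.mul_mem_right y hx))
    rw [map_mul] at this
    convert this using 1
    ring
  rcases Ideal.IsPrime.mul_mem_pow P h3 with h | h
  · exact h
  · exact absurd h hx2

/-- Structure of ideals invariant under conjugation. -/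
theorem exists_eq_map_mul_prod (hs : IsQuadraticConj s) (F : Finset (Ideal S))
    (hF : ∀ P, P ∈ ramified R → P ∈ F) (A : Ideal S) (hA0 : A ≠ ⊥) (hA : A.map s = A) :
    ∃ (b : Ideal R) (x : Ideal S → ℕ), A = b.map (algebraMap R S) * ∏ P ∈ F, P ^ x P := by
  classical
  induction A using WellFounded.induction (wellFounded_dvdNotUnit (α := Ideal S)) with
  | h A ih =>
  by_cases htop : A = ⊤
  · refine ⟨⊤, 0, ?_⟩
    rw [htop, Ideal.map_top, ← Ideal.one_eq_top]
    simp only [Pi.zero_apply, pow_zero, Finset.prod_const_one, mul_one]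
  obtain ⟨P, hM, hAP⟩ := Ideal.exists_le_maximal A htop
  have hP := hM.isPrime
  have hP0 : P ≠ ⊥ := by
    rintro rfl
    exact hA0 (le_bot_iff.1 hAP)
  have step : ∀ Q : Ideal S, Q ≠ ⊤ → Q.map s = Q → Q ∣ A →
      ∃ A', A = Q * A' ∧ ∃ (b : Ideal R) (x : Ideal S → ℕ),
        A' = b.map (algebraMap R S) * ∏ P ∈ F, P ^ x P := by
    rintro Q hQ hQs ⟨A', rfl⟩
    have hQ0 : Q ≠ 0 := left_ne_zero_of_mul hA0
    have hA'0 : A' ≠ 0 := right_ne_zero_of_mul hA0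
    refine ⟨A', rfl, ih A' ⟨hA'0, Q, ?_, mul_comm _ _⟩ hA'0 ?_⟩
    · rwa [Ideal.isUnit_iff]
    · rw [Ideal.map_mul, hQs] at hA
      exact mul_left_cancel₀ hQ0 hA
  have hAsP : A ≤ P.map s := by rw [← hA]; exact Ideal.map_mono hAP
  have stepmap : ∀ p : Ideal R, p.map (algebraMap R S) ≠ ⊤ → p.map (algebraMap R S) ∣ A →
      ∃ (b : Ideal R) (x : Ideal S → ℕ), A = b.map (algebraMap R S) * ∏ P ∈ F, P ^ x P := by
    intro p hp hpA
    obtain ⟨A', hAA, b, x, hb⟩ := step _ hp (hs.map_algebraMap p) hpA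
    refine ⟨p * b, x, ?_⟩
    rw [hAA, hb, Ideal.map_mul, mul_assoc]
  have hneT : (P.comap (algebraMap R S)).map (algebraMap R S) ≠ ⊤ := by
    intro h
    have h2 : (P.comap (algebraMap R S)).map (algebraMap R S) ≤ P := Ideal.map_comap_le
    rw [h] at h2
    exact hP.ne_top (top_le_iff.1 h2)
  rcases hs.map_comap_eq hP hP0 with h | h
  · exact stepmap _ hneT (by rw [h]; exact Ideal.dvd_iff_le.2 hAP)
  · by_cases hsP : P.map s = P
    · rw [hsP, ← sq] at h
      have hPF : P ∈ F := hF P ⟨hP, hP0, h⟩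
      obtain ⟨A', hAA, b, x, hb⟩ := step P hP.ne_top hsP (Ideal.dvd_iff_le.2 hAP)
      refine ⟨b, fun Q => if Q = P then x Q + 1 else x Q, ?_⟩
      have hcongr : ∏ Q ∈ F.erase P, Q ^ (if Q = P then x Q + 1 else x Q) =
          ∏ Q ∈ F.erase P, Q ^ x Q :=
        Finset.prod_congr rfl fun Q hQ => by rw [if_neg (Finset.ne_of_mem_erase hQ)]
      rw [hAA, hb, ← Finset.mul_prod_erase F _ hPF, ← Finset.mul_prod_erase F _ hPF]
      beta_reduce
      rw [hcongr, if_pos rfl, pow_succ]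
      ring
    · exact stepmap _ hneT (by rw [h]; exact hs.mul_map_dvd hP hP0 hsP hAP hAsP)

theorem exists_mul_map_eq (hs : IsQuadraticConj s) (B : Ideal S) (hB : B ≠ ⊥) :
    ∃ c : Ideal R, B * B.map s = c.map (algebraMap R S) := by
  induction B using UniqueFactorizationMonoid.induction_on_prime with
  | h₁ => exact absurd rfl hB
  | h₂ B hu =>
    rw [Ideal.isUnit_iff.1 hu]
    exact ⟨⊤, by rw [Ideal.map_top, Ideal.map_top, Ideal.mul_top]⟩
  | h₃ A P hA hP ih =>
    obtain ⟨c, hc⟩ := ih hA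
    have hP' : P.IsPrime := Ideal.isPrime_of_prime hP
    have hP0 : P ≠ ⊥ := hP.ne_zero
    have : ∃ d : Ideal R, P * P.map s = d.map (algebraMap R S) := by
      rcases hs.map_comap_eq hP' hP0 with h | h
      · refine ⟨P.comap (algebraMap R S) * P.comap (algebraMap R S), ?_⟩
        rw [Ideal.map_mul]
        nth_rw 2 [← h]
        rw [hs.map_algebraMap, h]
      · exact ⟨_, h.symm⟩
    obtain ⟨d, hd⟩ := this
    refine ⟨d * c, ?_⟩
    rw [Ideal.map_mul, Ideal.map_mul, ← hc, ← hd]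
    ring

end Dedekind
end IsQuadraticConj

/-- The ideal class of a nonzero ideal (and `1` for the zero ideal). -/
noncomputable def idealClass {S : Type*} [CommRing S] [IsDedekindDomain S] (A : Ideal S) :
    ClassGroup S :=
  open Classical in
  if h : A = ⊥ then 1 else ClassGroup.mk0 ⟨A, mem_nonZeroDivisors_of_ne_zero h⟩

section idealClass

variable {S : Type*} [CommRing S] [IsDedekindDomain S]

theorem idealClass_of_ne {A : Ideal S} (h : A ≠ ⊥) :
    idealClass A = ClassGroup.mk0 ⟨A, mem_nonZeroDivisors_of_ne_zero h⟩ := by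
  rw [idealClass, dif_neg h]

theorem idealClass_mul {A B : Ideal S} (hA : A ≠ ⊥) (hB : B ≠ ⊥) :
    idealClass (A * B) = idealClass A * idealClass B := by
  rw [idealClass_of_ne hA, idealClass_of_ne hB, idealClass_of_ne (mul_ne_zero hA hB), ← map_mul]
  rfl

theorem idealClass_one : idealClass (1 : Ideal S) = 1 := by
  rw [idealClass_of_ne one_ne_zero]
  exact map_one _

theorem idealClass_pow {A : Ideal S} (hA : A ≠ ⊥) (n : ℕ) :
    idealClass (A ^ n) = idealClass A ^ n := by
  induction n with
  | zero => rw [pow_zero, pow_zero, idealClass_one]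
  | succ n ih => rw [pow_succ, idealClass_mul (pow_ne_zero n hA) hA, ih, pow_succ]

theorem idealClass_eq_iff {A B : Ideal S} (hA : A ≠ ⊥) (hB : B ≠ ⊥) :
    idealClass A = idealClass B ↔
      ∃ x y : S, x ≠ 0 ∧ y ≠ 0 ∧ Ideal.span {x} * A = Ideal.span {y} * B := by
  rw [idealClass_of_ne hA, idealClass_of_ne hB, ClassGroup.mk0_eq_mk0_iff]
  constructor
  · rintro ⟨x, y, hx, hy, h⟩
    exact ⟨x, y, hx, hy, h⟩
  · rintro ⟨x, y, hx, hy, h⟩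
    exact ⟨x, y, hx, hy, h⟩

theorem idealClass_surjective (c : ClassGroup S) : ∃ A : Ideal S, A ≠ ⊥ ∧ idealClass A = c := by
  obtain ⟨⟨A, hA⟩, rfl⟩ := ClassGroup.mk0_surjective c
  exact ⟨A, nonZeroDivisors.ne_zero hA, idealClass_of_ne (nonZeroDivisors.ne_zero hA)⟩

theorem idealClass_eq_one_iff {A : Ideal S} (hA : A ≠ ⊥) :
    idealClass A = 1 ↔ ∃ x : S, x ≠ 0 ∧ A = Ideal.span {x} := by
  rw [idealClass_of_ne hA, ClassGroup.mk0_eq_one_iff]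
  constructor
  · intro h
    obtain ⟨x, hx⟩ := h.principal
    refine ⟨x, ?_, hx⟩
    rintro rfl
    exact hA (by rw [hx]; simp)
  · rintro ⟨x, -, h⟩
    exact ⟨x, h⟩

theorem idealClass_span {x : S} (hx : x ≠ 0) : idealClass (Ideal.span {x}) = 1 :=
  (idealClass_eq_one_iff (by simpa using hx)).2 ⟨x, hx, rfl⟩

theorem idealClass_prod {ι : Type*} (F : Finset ι) (A : ι → Ideal S) (hA : ∀ i ∈ F, A i ≠ ⊥) :
    idealClass (∏ i ∈ F, A i) = ∏ i ∈ F, idealClass (A i) := by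
  classical
  induction F using Finset.induction_on with
  | empty => rw [Finset.prod_empty, Finset.prod_empty, idealClass_one]
  | insert i F hi ih =>
    rw [Finset.prod_insert hi, Finset.prod_insert hi, idealClass_mul, ih]
    · exact fun j hj => hA j (Finset.mem_insert_of_mem hj)
    · exact hA i (Finset.mem_insert_self _ _)
    · exact Finset.prod_ne_zero_iff.2 fun j hj => hA j (Finset.mem_insert_of_mem hj)

theorem exists_pow_eq_span {h : ℕ} (hh : ∀ c : ClassGroup S, c ^ h = 1) {A : Ideal S}
    (hA : A ≠ ⊥) : ∃ x : S, x ≠ 0 ∧ A ^ h = Ideal.span {x} := by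
  rw [← idealClass_eq_one_iff (pow_ne_zero h hA), idealClass_pow hA, hh]

end idealClass

namespace IsQuadraticConj

variable {R S : Type*} [CommRing R] [CommRing S] [Algebra R S] {s : S ≃ₐ[R] S}

theorem exists_unit_of_span_eq [IsDomain S] (hs : IsQuadraticConj s) {a b : R}
    (h : Ideal.span {algebraMap R S a} = Ideal.span {algebraMap R S b}) :
    ∃ η : Rˣ, b = η * a := by
  by_cases ha : a = 0
  · subst ha
    rw [map_zero, Ideal.span_singleton_eq_span_singleton] at h
    refine ⟨1, hs.inj ?_⟩
    rw [mul_zero, map_zero]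
    exact (associated_zero_iff_eq_zero _).1 h.symm
  rw [Ideal.span_singleton_eq_span_singleton] at h
  obtain ⟨e, he⟩ := h
  have ha' : algebraMap R S a ≠ 0 := by
    rw [← map_zero (algebraMap R S)]
    exact fun h => ha (hs.inj h)
  have h1 : s e = (e : S) := by
    apply mul_left_cancel₀ ha'
    rw [he, ← AlgEquiv.commutes s a, ← map_mul, he, AlgEquiv.commutes]
  have h2 : s ((e⁻¹ : Sˣ) : S) = ((e⁻¹ : Sˣ) : S) := by
    apply e.isUnit.mul_left_cancel
    rw [Units.mul_inv]
    nth_rw 1 [← h1]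
    rw [← map_mul, Units.mul_inv, map_one]
  obtain ⟨r, hr⟩ := hs.fixed _ h1
  obtain ⟨r', hr'⟩ := hs.fixed _ h2
  have h3 : r * r' = 1 := hs.inj (by rw [map_mul, hr, hr', Units.mul_inv, map_one])
  refine ⟨⟨r, r', h3, by rw [mul_comm, h3]⟩, hs.inj ?_⟩
  rw [map_mul, ← he, hr, mul_comm]

theorem norm_eq_norm_iff (hs : IsQuadraticConj s) {x y : S} :
    hs.norm x = hs.norm y ↔ x * s x = y * s y := by
  rw [← hs.algebraMap_norm, ← hs.algebraMap_norm]
  exact ⟨fun h => by rw [h], fun h => hs.inj h⟩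

/-- An integral form of Hilbert's theorem 90. -/
theorem exists_hilbert90 [IsDomain S] (hs : IsQuadraticConj s) {x y : S} (hx : x ≠ 0)
    (h : hs.norm x = hs.norm y) : ∃ β : S, β ≠ 0 ∧ y * s β = x * β := by
  rw [hs.norm_eq_norm_iff] at h
  have hsx : s x ≠ 0 := fun h => hx ((map_eq_zero_iff s s.injective).1 h)
  have key : ∀ c, y * s (s x * (x * c + y * s c)) = x * (s x * (x * c + y * s c)) := by
    intro c
    simp only [map_mul, map_add, hs.invol]
    linear_combination (-(x * c)) * h
  by_cases hxy : x + y = 0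
  · obtain ⟨c, hc⟩ := hs.ne
    refine ⟨_, ?_, key c⟩
    have : y = -x := by linear_combination hxy
    rw [this, show x * c + -x * s c = x * (c - s c) by ring]
    exact mul_ne_zero hsx (mul_ne_zero hx (sub_ne_zero.2 hc.symm))
  · refine ⟨_, ?_, key 1⟩
    rw [map_one, mul_one, mul_one]
    exact mul_ne_zero hsx hxy

variable [IsDedekindDomain S]

theorem map_eq_of_hilbert90 (s : S ≃ₐ[R] S) {A : Ideal S} {x y β : S} (hx : x ≠ 0)
    (hA : Ideal.span {x} * A.map s = Ideal.span {y} * A)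
    (hβ : y * s β = x * β) : (A * Ideal.span {β}).map s = A * Ideal.span {β} := by
  have hx' : Ideal.span {x} ≠ ⊥ := by simpa using hx
  apply mul_left_cancel₀ hx'
  rw [Ideal.map_mul, map_span, ← mul_assoc, hA, mul_right_comm,
    Ideal.span_singleton_mul_span_singleton, hβ, ← Ideal.span_singleton_mul_span_singleton]
  ring

theorem idealClass_map_eq [IsDedekindDomain R] (hs : IsQuadraticConj s) {h : ℕ} (hodd : Odd h)
    (hh : ∀ c : ClassGroup R, c ^ h = 1) {A : Ideal S} (hA : A ≠ ⊥)
    (hA2 : idealClass A ^ 2 = 1) : idealClass (A.map s) = idealClass A := by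
  have hsA := hs.map_ne_bot hA
  obtain ⟨b, hb⟩ := hs.exists_mul_map_eq A hA
  have hb0 : b ≠ ⊥ := by
    rintro rfl
    rw [Ideal.map_bot] at hb
    exact mul_ne_zero hA hsA hb
  obtain ⟨a, ha, hba⟩ := exists_pow_eq_span hh hb0
  have h1 : (idealClass A * idealClass (A.map s)) ^ h = 1 := by
    rw [← idealClass_mul hA hsA, hb, ← idealClass_pow (by rw [← hb]; exact mul_ne_zero hA hsA),
      ← Ideal.map_pow, hba, Ideal.map_span, Set.image_singleton]
    exact idealClass_span fun h => ha (hs.inj (by rw [h, map_zero]))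
  have h2 : idealClass (A.map s) ^ 2 = 1 := by
    rw [← idealClass_pow hA, idealClass_eq_one_iff (pow_ne_zero 2 hA)] at hA2
    obtain ⟨x, hx, hAx⟩ := hA2
    rw [← idealClass_pow hsA, ← Ideal.map_pow, hAx, map_span]
    exact idealClass_span fun h => hx ((map_eq_zero_iff s s.injective).1 h)
  have h3 : idealClass A * idealClass (A.map s) = 1 := by
    obtain ⟨k, rfl⟩ := hodd
    rwa [pow_succ, pow_mul, mul_pow, hA2, h2, one_mul, one_pow, one_mul] at h1
  rw [sq] at hA2
  rw [← mul_left_cancel_iff (a := idealClass A), h3, hA2]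

/-- An ideal class of order dividing two together with the associated unit. -/
theorem exists_unit_of_sq_eq_one [IsDedekindDomain R] (hs : IsQuadraticConj s) {h : ℕ}
    (hodd : Odd h) (hh : ∀ c : ClassGroup R, c ^ h = 1) {c : ClassGroup S} (hc : c ^ 2 = 1) :
    ∃ (A : Ideal S) (x y : S) (η : Rˣ), A ≠ ⊥ ∧ idealClass A = c ∧ x ≠ 0 ∧ y ≠ 0 ∧
      Ideal.span {x} * A.map s = Ideal.span {y} * A ∧ hs.norm y = η * hs.norm x := by
  obtain ⟨A, hA, rfl⟩ := idealClass_surjective c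
  have hsA := hs.map_ne_bot hA
  obtain ⟨x, y, hx, hy, hxy⟩ := (idealClass_eq_iff hsA hA).1 (hs.idealClass_map_eq hodd hh hA hc)
  have h1 : Ideal.span {s x} * A = Ideal.span {s y} * A.map s := by
    have := congrArg (Ideal.map s) hxy
    rwa [Ideal.map_mul, Ideal.map_mul, hs.map_map, map_span, map_span] at this
  have h2 : Ideal.span {x * s x} = Ideal.span {y * s y} := by
    apply mul_right_cancel₀ (mul_ne_zero hA hsA)
    rw [← Ideal.span_singleton_mul_span_singleton, ← Ideal.span_singleton_mul_span_singleton]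
    calc _ = (Ideal.span {x} * A.map s) * (Ideal.span {s x} * A) := by ring
      _ = _ := by rw [hxy, h1]; ring
  rw [← hs.algebraMap_norm, ← hs.algebraMap_norm] at h2
  obtain ⟨η, hη⟩ := hs.exists_unit_of_span_eq h2
  exact ⟨A, x, y, η, hA, rfl, hx, hy, hxy, hη⟩

end IsQuadraticConj

theorem pow_val_natCast_two {G : Type*} [CommGroup G] {g : G} (hg : g ^ 2 = 1) (n : ℕ) :
    g ^ (n : ZMod 2).val = g ^ n := by
  rw [ZMod.val_natCast]
  conv_rhs => rw [← Nat.mod_add_div n 2, pow_add, pow_mul, hg, one_pow, mul_one]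

/-- The homomorphism from `ℤ/2` sending the generator to `g`, where `g ^ 2 = 1`. -/
def zmodTwoPow {G : Type*} [CommGroup G] (g : G) (hg : g ^ 2 = 1) :
    Multiplicative (ZMod 2) →* G where
  toFun a := g ^ (Multiplicative.toAdd a).val
  map_one' := by simp
  map_mul' a b := by
    rw [← pow_add, toAdd_mul, ZMod.val_add, ← ZMod.val_natCast, pow_val_natCast_two hg]

theorem Subgroup.relIndex_le_of_forall {G γ : Type*} [Group G] [Finite γ] (H K : Subgroup G)
    (f : K → γ) (hf : ∀ a b : K, f a = f b → (a : G)⁻¹ * b ∈ H) : H.relIndex K ≤ Nat.card γ := by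
  refine Nat.card_le_card_of_injective (fun q : K ⧸ H.subgroupOf K => f q.out) ?_
  intro p q hpq
  have h := hf _ _ hpq
  rw [← QuotientGroup.out_eq' p, ← QuotientGroup.out_eq' q, QuotientGroup.eq,
    Subgroup.mem_subgroupOf]
  simpa using h

theorem Nat.card_le_card_mul_card_of_fiber {α β γ : Type*} [Finite β] [Finite γ] (f : α → β)
    (hf : ∀ c, ∃ g : α → γ, ∀ a b, f a = f c → f b = f c → g a = g b → a = b) :
    Nat.card α ≤ Nat.card β * Nat.card γ := by
  rw [← Nat.card_prod]
  choose g hg using hf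
  have hrep : ∀ a, ∃ c, f c = f a := fun a => ⟨a, rfl⟩
  have hex : ∃ r : β → α → α, ∀ a, f (r (f a) a) = f a ∧
      ∀ a', f a' = f a → r (f a) a = r (f a') a' := by
    classical
    refine ⟨fun v a => if h : ∃ c, f c = v then h.choose else a, fun a => ⟨?_, ?_⟩⟩
    · beta_reduce
      rw [dif_pos (hrep a)]
      exact (hrep a).choose_spec
    · intro a' h
      beta_reduce
      rw [dif_pos (hrep a), dif_pos (hrep a')]
      simp only [h]
  obtain ⟨r, hr⟩ := hex
  refine Nat.card_le_card_of_injective (fun a => (f a, g (r (f a) a) a)) ?_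
  intro a b hab
  simp only [Prod.mk.injEq] at hab
  obtain ⟨h1, h2⟩ := hab
  have h3 := (hr b).2 a h1
  rw [← h3] at h2
  refine hg _ a b ?_ ?_ h2
  · exact h1.trans (hr b).1.symm
  · exact (hr b).1.symm

namespace IsQuadraticConj

variable {R S : Type*} [CommRing R] [CommRing S] [Algebra R S] {s : S ≃ₐ[R] S}
  [IsDedekindDomain S] [IsDedekindDomain R]

theorem idealClass_map_pow (hs : IsQuadraticConj s) {h : ℕ} (hh : ∀ c : ClassGroup R, c ^ h = 1)
    {b : Ideal R} (hb : b.map (algebraMap R S) ≠ ⊥) :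
    idealClass (b.map (algebraMap R S)) ^ h = 1 := by
  have hb0 : b ≠ ⊥ := by
    rintro rfl
    exact hb Ideal.map_bot
  obtain ⟨a, ha, hba⟩ := exists_pow_eq_span hh hb0
  rw [← idealClass_pow hb, ← Ideal.map_pow, hba, Ideal.map_span, Set.image_singleton]
  exact idealClass_span fun h => ha (hs.inj (by rw [h, map_zero]))

theorem idealClass_pow_sq (hs : IsQuadraticConj s) {h : ℕ} (hh : ∀ c : ClassGroup R, c ^ h = 1)
    {P : Ideal S} (hP : P ∈ ramified R) : (idealClass P ^ h) ^ 2 = 1 := by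
  rw [← pow_mul, mul_comm, pow_mul, ← idealClass_pow hP.2.1, ← hP.2.2]
  apply hs.idealClass_map_pow hh
  rw [hP.2.2]
  exact pow_ne_zero 2 hP.2.1

/-- The classes generated by the ramified primes. -/
noncomputable def ramClass (hs : IsQuadraticConj s) {h : ℕ} (hh : ∀ c : ClassGroup R, c ^ h = 1)
    {F : Finset (Ideal S)} (hF : ∀ P, P ∈ F ↔ P ∈ ramified R) :
    (F → Multiplicative (ZMod 2)) →* ClassGroup S :=
  ∏ P : F, (zmodTwoPow (idealClass (P : Ideal S) ^ h)
    (hs.idealClass_pow_sq hh ((hF P).1 P.2))).comp (Pi.evalMonoidHom _ P)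

theorem idealClass_pow_eq_ramClass (hs : IsQuadraticConj s) {h : ℕ}
    (hh : ∀ c : ClassGroup R, c ^ h = 1)
    {F : Finset (Ideal S)} (hF : ∀ P, P ∈ F ↔ P ∈ ramified R) {A : Ideal S} (hA : A ≠ ⊥)
    {b : Ideal R} {x : Ideal S → ℕ}
    (hAb : A = b.map (algebraMap R S) * ∏ P ∈ F, P ^ x P) :
    idealClass A ^ h =
      hs.ramClass hh hF (fun P => Multiplicative.ofAdd (x P : ZMod 2)) := by
  have hb : b.map (algebraMap R S) ≠ ⊥ := by
    intro h
    rw [h, Ideal.bot_mul] at hAb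
    exact hA hAb
  have hP : ∀ P ∈ F, P ^ x P ≠ ⊥ := fun P h => pow_ne_zero _ ((hF P).1 h).2.1
  rw [hAb, idealClass_mul hb (Finset.prod_ne_zero_iff.2 hP), mul_pow, hs.idealClass_map_pow hh hb,
    one_mul, idealClass_prod _ _ hP, ramClass, MonoidHom.finsetProd_apply, ← Finset.prod_pow,
    ← Finset.prod_coe_sort]
  refine Finset.prod_congr rfl fun P _ => ?_
  rw [idealClass_pow ((hF P).1 P.2).2.1, pow_right_comm]
  exact (pow_val_natCast_two (hs.idealClass_pow_sq hh ((hF P).1 P.2)) (x P)).symm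

/-- The norm on units. -/
noncomputable def unitNorm (hs : IsQuadraticConj s) : Sˣ →* Rˣ := Units.map hs.norm

/-- The homomorphism `e ↦ e / s e` on units. -/
noncomputable def unitDiv (s : S ≃ₐ[R] S) : Sˣ →* Sˣ :=
  (MonoidHom.id Sˣ) / Units.map (s : S →* S)

omit [IsDedekindDomain S] [IsDedekindDomain R] in
theorem unitDiv_apply (s : S ≃ₐ[R] S) (e : Sˣ) :
    unitDiv s e = e / Units.map (s : S →* S) e := rfl

omit [IsDedekindDomain S] [IsDedekindDomain R] in
theorem mem_range_unitDiv {e f : Sˣ} (h : (e : S) * s f = f) :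
    e ∈ (unitDiv s).range := by
  refine ⟨f, ?_⟩
  rw [unitDiv_apply, div_eq_iff_eq_mul]
  ext
  simpa using h.symm

omit [IsDedekindDomain S] [IsDedekindDomain R] in
theorem mem_ker_unitNorm (hs : IsQuadraticConj s) {e : Sˣ} :
    e ∈ hs.unitNorm.ker ↔ (e : S) * s e = 1 := by
  rw [MonoidHom.mem_ker, unitNorm, Units.ext_iff, Units.coe_map, Units.val_one,
    ← hs.inj.eq_iff, map_one]
  exact ⟨fun h => by rw [← h]; exact (hs.algebraMap_norm _).symm,
    fun h => by rw [← h]; exact hs.algebraMap_norm _⟩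

omit [IsDedekindDomain S] [IsDedekindDomain R] in
theorem sq_mem_range_unitDiv (hs : IsQuadraticConj s) {e : Sˣ} (he : e ∈ hs.unitNorm.ker) :
    e ^ 2 ∈ (unitDiv s).range := by
  apply mem_range_unitDiv (f := e)
  rw [hs.mem_ker_unitNorm] at he
  rw [Units.val_pow_eq_pow_val]
  linear_combination (e : S) * he

theorem relIndex_range_unitDiv_le (hs : IsQuadraticConj s) {h : ℕ} (hodd : Odd h)
    (hh : ∀ c : ClassGroup R, c ^ h = 1)
    {F : Finset (Ideal S)} (hF : ∀ P, P ∈ F ↔ P ∈ ramified R) :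
    (unitDiv s).range.relIndex hs.unitNorm.ker ≤ Nat.card (hs.ramClass hh hF).ker := by
  have H : ∀ e : hs.unitNorm.ker, ∃ (β : S) (b : Ideal R) (x : Ideal S → ℕ), β ≠ 0 ∧
      (e : Sˣ) * s β = β ∧
      Ideal.span {β} = b.map (algebraMap R S) * ∏ P ∈ F, P ^ x P := by
    intro e
    have he := hs.mem_ker_unitNorm.1 e.2
    obtain ⟨β, hβ, hβe⟩ := hs.exists_hilbert90 (x := 1) (y := ((e : Sˣ) : S)) one_ne_zero
      (by rw [hs.norm_eq_norm_iff, he, map_one, mul_one])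
    rw [one_mul] at hβe
    have hinv : (Ideal.span {β}).map s = Ideal.span {β} := by
      rw [map_span, Ideal.span_singleton_eq_span_singleton]
      exact ⟨e, by rw [mul_comm, hβe]⟩
    obtain ⟨b, x, hbx⟩ := hs.exists_eq_map_mul_prod F (fun P => (hF P).2) (Ideal.span {β})
      (by simpa using hβ) hinv
    exact ⟨β, b, x, hβ, hβe, hbx⟩
  choose β b x hβ0 hβ hx using H
  have hker : ∀ e, (fun P : F => Multiplicative.ofAdd (x e P : ZMod 2)) ∈
      (hs.ramClass hh hF).ker := by
    intro e
    rw [MonoidHom.mem_ker, ← hs.idealClass_pow_eq_ramClass hh hF (by simpa using hβ0 e) (hx e),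
      idealClass_span (hβ0 e), one_pow]
  refine Subgroup.relIndex_le_of_forall _ _ (fun e => (⟨_, hker e⟩ : (hs.ramClass hh hF).ker)) ?_
  intro e e' hee
  have hpar : ∀ P ∈ F, ∃ k, x e P + x e' P = 2 * k := by
    intro P hP
    have h1 := congrFun (Subtype.ext_iff.1 hee) ⟨P, hP⟩
    have h2 : (x e P : ZMod 2) = x e' P := Multiplicative.ofAdd.injective h1
    rw [ZMod.natCast_eq_natCast_iff'] at h2
    exact ⟨(x e P + x e' P) / 2, by omega⟩
  choose! k hk using hpar
  have hprod : Ideal.span {β e * β e'} = (b e * b e' *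
      ∏ P ∈ F, (P.comap (algebraMap R S)) ^ k P).map (algebraMap R S) := by
    rw [← Ideal.span_singleton_mul_span_singleton, hx e, hx e', Ideal.map_mul, Ideal.map_mul,
      mul_mul_mul_comm, ← Finset.prod_mul_distrib,
      ← Ideal.mapHom_apply (algebraMap R S) (∏ P ∈ F, _), map_prod]
    congr 1
    refine Finset.prod_congr rfl fun P hP => ?_
    rw [map_pow, Ideal.mapHom_apply, ((hF P).1 hP).2.2, ← pow_mul, ← pow_add, hk P hP]
  have hb0 : (b e * b e' * ∏ P ∈ F, (P.comap (algebraMap R S)) ^ k P) ≠ ⊥ := by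
    intro h
    rw [h, Ideal.map_bot, Ideal.span_singleton_eq_bot] at hprod
    exact mul_ne_zero (hβ0 e) (hβ0 e') hprod
  obtain ⟨r, hr0, hr⟩ := exists_pow_eq_span hh hb0
  have h1 : Ideal.span {algebraMap R S r} = Ideal.span {(β e * β e') ^ h} := by
    rw [← Ideal.span_singleton_pow, hprod, ← Ideal.map_pow, hr, Ideal.map_span,
      Set.image_singleton]
  rw [Ideal.span_singleton_eq_span_singleton] at h1
  obtain ⟨f, hf⟩ := h1
  have h2 : ((e : Sˣ) * (e' : Sˣ)) ^ h ∈ (unitDiv s).range := by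
    apply mem_range_unitDiv (f := f)
    have hr' : algebraMap R S r ≠ 0 := fun h => hr0 (hs.inj (by rw [h, map_zero]))
    apply mul_left_cancel₀ hr'
    rw [hf, mul_left_comm, ← AlgEquiv.commutes s r, ← map_mul, hf, Units.val_pow_eq_pow_val,
      Units.val_mul, map_pow, map_mul, ← mul_pow, mul_mul_mul_comm, hβ, hβ]
  have h3 := hs.sq_mem_range_unitDiv e.2
  have h4 : ((e : Sˣ) * (e' : Sˣ)) ∈ (unitDiv s).range := by
    obtain ⟨m, rfl⟩ := hodd
    rw [pow_succ, pow_mul] at h2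
    exact (Subgroup.mul_mem_cancel_left _
      (Subgroup.pow_mem _ (hs.sq_mem_range_unitDiv (mul_mem e.2 e'.2)) m)).1 h2
  have : (e : Sˣ)⁻¹ * (e' : Sˣ) = ((e : Sˣ) ^ 2)⁻¹ * ((e : Sˣ) * (e' : Sˣ)) := by
    rw [sq, mul_inv, mul_assoc, inv_mul_cancel_left]
  rw [this]
  exact mul_mem (inv_mem h3) h4

/-- The subgroup of squares. -/
def squares (G : Type*) [CommGroup G] : Subgroup G := (powMonoidHom 2 : G →* G).range

omit [IsDedekindDomain S] [IsDedekindDomain R] in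
theorem squares_le_range_unitNorm (hs : IsQuadraticConj s) :
    squares Rˣ ≤ hs.unitNorm.range := by
  rintro _ ⟨f, rfl⟩
  refine ⟨Units.map (algebraMap R S : R →* S) f, ?_⟩
  ext
  exact hs.norm_algebraMap f

omit [IsDedekindDomain S] [IsDedekindDomain R] in
theorem relIndex_sq_dvd (hs : IsQuadraticConj s) :
    (hs.unitNorm.ker.map (powMonoidHom 2)).relIndex (unitDiv s).range ∣
      (squares Rˣ).relIndex hs.unitNorm.range := by
  rw [← Subgroup.index_comap, ← Subgroup.index_comap]
  apply Subgroup.index_dvd_of_le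
  rintro e ⟨f, hf⟩
  have hf1 : algebraMap R S f ^ 2 = e * s e := by
    rw [← hs.algebraMap_norm, ← map_pow]
    congr 1
    exact Units.ext_iff.1 hf
  set f' : Sˣ := Units.map (algebraMap R S : R →* S) f with hf'
  have hff : (f' : S) = algebraMap R S f := rfl
  have hsf : Units.map (s : S →* S) f' = f' := by
    ext
    exact s.commutes f
  have h2 : Units.map (s : S →* S) e * e = f' ^ 2 := by
    ext
    rw [Units.val_pow_eq_pow_val, hff, hf1, mul_comm]
    rfl
  refine ⟨e / f', ?_, ?_⟩
  · rw [SetLike.mem_coe, hs.mem_ker_unitNorm]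
    have : (e / f') * Units.map (s : S →* S) (e / f') = 1 := by
      rw [map_div, hsf, div_mul_div_comm, mul_comm, h2, sq, div_self']
    exact Units.ext_iff.1 this
  · rw [unitDiv_apply, powMonoidHom_apply, div_pow, ← h2, sq, mul_div_mul_right_eq_div]

theorem card_two_torsion_le_mul (hs : IsQuadraticConj s) {h : ℕ} (hodd : Odd h)
    (hh : ∀ c : ClassGroup R, c ^ h = 1)
    {F : Finset (Ideal S)} (hF : ∀ P, P ∈ F ↔ P ∈ ramified R) (U : Subgroup Rˣ)
    (hU : ∀ (η : Rˣ) (x y : S), x ≠ 0 → y ≠ 0 → hs.norm y = η * hs.norm x → η ∈ U)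
    (hfin : (squares Rˣ).index ≠ 0) :
    Nat.card {c : ClassGroup S // c ^ 2 = 1} ≤
      hs.unitNorm.range.relIndex U * Nat.card (hs.ramClass hh hF).range := by
  have H := fun c : {c : ClassGroup S // c ^ 2 = 1} => hs.exists_unit_of_sq_eq_one hodd hh c.2
  choose A x y η hA hAc hx hy hxy hη using H
  have hηU : ∀ c, η c ∈ U := fun c => hU _ _ _ (hx c) (hy c) (hη c)
  have hne : hs.unitNorm.range.relIndex U ≠ 0 := by
    intro h0
    apply hfin
    apply Subgroup.index_eq_zero_of_relIndex_eq_zero (K := U)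
    exact Subgroup.relIndex_eq_zero_of_le_left hs.squares_le_range_unitNorm h0
  have : Finite (hs.ramClass hh hF).range :=
    Finite.of_surjective _ (hs.ramClass hh hF).rangeRestrict_surjective
  have : Finite (U ⧸ hs.unitNorm.range.subgroupOf U) := Nat.finite_of_card_ne_zero hne
  refine Nat.card_le_card_mul_card_of_fiber (β := U ⧸ hs.unitNorm.range.subgroupOf U)
    (fun c => QuotientGroup.mk ⟨η c, hηU c⟩) ?_
  intro c
  have key : ∀ a, (QuotientGroup.mk ⟨η a, hηU a⟩ : U ⧸ hs.unitNorm.range.subgroupOf U) =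
      QuotientGroup.mk ⟨η c, hηU c⟩ → (a * c : ClassGroup S) ∈ (hs.ramClass hh hF).range := by
    intro a hac
    rw [QuotientGroup.eq, Subgroup.mem_subgroupOf] at hac
    obtain ⟨e, he⟩ := hac
    have he' : η c = η a * hs.unitNorm e := by
      rw [he]
      simp
    have heS : algebraMap R S (η c) = algebraMap R S (η a) * (e * s e) := by
      rw [he', Units.val_mul, map_mul, ← hs.algebraMap_norm]
      rfl
    have ha := hη a
    have hc := hη c
    have hae : hs.norm (x a * x c * algebraMap R S (η a) * e) = hs.norm (y a * y c) := by
      rw [map_mul, map_mul, map_mul, map_mul, ha, hc, hs.norm_algebraMap, he', Units.val_mul]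
      have : ((hs.unitNorm e : Rˣ) : R) = hs.norm e := rfl
      rw [this]
      ring
    have hu : IsUnit (algebraMap R S (η a) * (e : S)) :=
      ((η a).isUnit.map (algebraMap R S)).mul e.isUnit
    have hx0 : x a * x c * algebraMap R S (η a) * e ≠ 0 := by
      rw [mul_assoc]
      exact mul_ne_zero (mul_ne_zero (hx a) (hx c)) hu.ne_zero
    obtain ⟨β, hβ0, hβ⟩ := hs.exists_hilbert90 hx0 hae
    have hinv := map_eq_of_hilbert90 s (A := A a * A c) hx0 (by
      rw [mul_assoc (x a * x c), ← Ideal.span_singleton_mul_span_singleton,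
        Ideal.span_singleton_eq_top.2 hu, Ideal.mul_top, Ideal.map_mul,
        ← Ideal.span_singleton_mul_span_singleton, ← Ideal.span_singleton_mul_span_singleton,
        mul_mul_mul_comm, hxy, hxy, mul_mul_mul_comm]) hβ
    have hβ0' : Ideal.span {β} ≠ ⊥ := by simpa using hβ0
    have hne : A a * A c * Ideal.span {β} ≠ ⊥ := mul_ne_zero (mul_ne_zero (hA a) (hA c)) hβ0'
    obtain ⟨b, z, hz⟩ := hs.exists_eq_map_mul_prod F (fun P => (hF P).2) _ hne hinv
    have h1 := hs.idealClass_pow_eq_ramClass hh hF hne hz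
    rw [idealClass_mul (mul_ne_zero (hA a) (hA c)) hβ0', idealClass_mul (hA a) (hA c), hAc, hAc,
      idealClass_span hβ0, mul_one] at h1
    have h2 : (a * c : ClassGroup S) ^ 2 = 1 := by rw [mul_pow, a.2, c.2, one_mul]
    obtain ⟨m, rfl⟩ := hodd
    rw [pow_succ, pow_mul, h2, one_pow, one_mul] at h1
    exact ⟨_, h1.symm⟩
  classical
  refine ⟨fun a => if h : (a * c : ClassGroup S) ∈ (hs.ramClass hh hF).range then ⟨_, h⟩ else 1, ?_⟩
  intro a b ha hb hab
  beta_reduce at hab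
  rw [dif_pos (key a ha), dif_pos (key b hb), Subtype.mk.injEq] at hab
  exact Subtype.ext (mul_right_cancel hab)

/-- Ambiguous class number bound. -/
theorem card_two_torsion_mul_le (hs : IsQuadraticConj s) {h : ℕ} (hodd : Odd h)
    (hh : ∀ c : ClassGroup R, c ^ h = 1)
    {F : Finset (Ideal S)} (hF : ∀ P, P ∈ F ↔ P ∈ ramified R) (U : Subgroup Rˣ)
    (hU : ∀ (η : Rˣ) (x y : S), x ≠ 0 → y ≠ 0 → hs.norm y = η * hs.norm x → η ∈ U)
    (hfin : (squares Rˣ).index ≠ 0) :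
    Nat.card {c : ClassGroup S // c ^ 2 = 1} *
      (hs.unitNorm.ker.map (powMonoidHom 2)).relIndex hs.unitNorm.ker * U.index ≤
      2 ^ F.card * (squares Rˣ).index := by
  have h1 := hs.card_two_torsion_le_mul hodd hh hF U hU hfin
  have h2 := hs.relIndex_range_unitDiv_le hodd hh hF
  have h3 : Nat.card (hs.ramClass hh hF).range * Nat.card (hs.ramClass hh hF).ker = 2 ^ F.card := by
    rw [← Subgroup.index_ker, mul_comm, Subgroup.card_mul_index, Nat.card_pi]
    simp
  have hNU : hs.unitNorm.range ≤ U := by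
    rintro _ ⟨e, rfl⟩
    refine hU _ 1 e one_ne_zero e.ne_zero ?_
    rw [map_one, mul_one]
    rfl
  have h4 : (squares Rˣ).relIndex hs.unitNorm.range * hs.unitNorm.range.relIndex U * U.index =
      (squares Rˣ).index := by
    rw [mul_assoc, Subgroup.relIndex_mul_index hNU,
      Subgroup.relIndex_mul_index hs.squares_le_range_unitNorm]
  have h5 : (hs.unitNorm.ker.map (powMonoidHom 2)).relIndex (unitDiv s).range ≤
      (squares Rˣ).relIndex hs.unitNorm.range := by
    refine Nat.le_of_dvd (Nat.pos_of_ne_zero fun h => hfin ?_) hs.relIndex_sq_dvd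
    rw [← h4, h, zero_mul, zero_mul]
  have hVW : hs.unitNorm.ker.map (powMonoidHom 2) ≤ (unitDiv s).range := by
    rintro _ ⟨e, he, rfl⟩
    exact hs.sq_mem_range_unitDiv he
  have hWV : (unitDiv s).range ≤ hs.unitNorm.ker := by
    rintro _ ⟨e, rfl⟩
    rw [hs.mem_ker_unitNorm]
    have : unitDiv s e * Units.map (s : S →* S) (unitDiv s e) = 1 := by
      have hss : Units.map (s : S →* S) (Units.map (s : S →* S) e) = e := by
        ext
        exact hs.invol e
      rw [unitDiv_apply, map_div, hss]
      simp
    exact Units.ext_iff.1 this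
  rw [← Subgroup.relIndex_mul_relIndex _ _ _ hVW hWV]
  calc _ ≤ (hs.unitNorm.range.relIndex U * Nat.card (hs.ramClass hh hF).range) *
        ((squares Rˣ).relIndex hs.unitNorm.range * Nat.card (hs.ramClass hh hF).ker) * U.index := by
        gcongr
    _ = (Nat.card (hs.ramClass hh hF).range * Nat.card (hs.ramClass hh hF).ker) *
        ((squares Rˣ).relIndex hs.unitNorm.range * hs.unitNorm.range.relIndex U * U.index) := by
      ring
    _ = _ := by rw [h3, h4]

end IsQuadraticConj

theorem Subgroup.two_le_index_of_notMem {G : Type*} [Group G] [Finite G] {H : Subgroup G} {x : G}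
    (hx : x ∉ H) : 2 ≤ H.index := by
  by_contra! h
  have h0 : H.index ≠ 0 := Subgroup.index_ne_zero_of_finite
  have h1 : H.index = 1 := by omega
  rw [Subgroup.index_eq_one] at h1
  exact hx (h1 ▸ Subgroup.mem_top x)

theorem Subgroup.four_le_index_of_notMem {G : Type*} [CommGroup G] [Finite G] {H : Subgroup G}
    {x y : G} (hx : x ∉ H) (hy : y ∉ H) (hxy : x * y ∉ H) (hy2 : y ^ 2 ∈ H) : 4 ≤ H.index := by
  have h1 : 2 ≤ H.relIndex (H ⊔ Subgroup.zpowers y) := by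
    have : (⟨y, Subgroup.mem_sup_right (Subgroup.mem_zpowers y)⟩ : ↥(H ⊔ Subgroup.zpowers y)) ∉
      H.subgroupOf (H ⊔ Subgroup.zpowers y) := fun h => hy (Subgroup.mem_subgroupOf.1 h)
    exact Subgroup.two_le_index_of_notMem this
  have h2 : 2 ≤ (H ⊔ Subgroup.zpowers y).index := by
    apply Subgroup.two_le_index_of_notMem (x := x)
    intro h
    obtain ⟨a, ha, b, ⟨n, rfl⟩, rfl⟩ := Subgroup.mem_sup.1 h
    beta_reduce at *
    rcases Int.even_or_odd' n with ⟨k, rfl | rfl⟩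
    · apply hx
      refine mul_mem ha ?_
      rw [zpow_mul]
      exact zpow_mem (by exact_mod_cast hy2) _
    · apply hxy
      rw [mul_assoc, ← zpow_add_one, show 2 * k + 1 + 1 = 2 * (k + 1) by ring, zpow_mul]
      exact mul_mem ha (zpow_mem (by exact_mod_cast hy2) _)
  rw [← Subgroup.relIndex_mul_index (le_sup_left : H ≤ H ⊔ Subgroup.zpowers y)]
  nlinarith

theorem card_two_torsion_eq_index {G : Type*} [CommGroup G] [Finite G] :
    Nat.card {c : G // c ^ 2 = 1} = (IsQuadraticConj.squares G).index := by
  have h1 := Subgroup.card_mul_index (powMonoidHom 2 : G →* G).ker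
  have h2 := Subgroup.card_mul_index (powMonoidHom 2 : G →* G).range
  rw [Subgroup.index_ker] at h1
  have h3 : Nat.card {c : G // c ^ 2 = 1} = Nat.card (powMonoidHom 2 : G →* G).ker := rfl
  rw [h3, IsQuadraticConj.squares]
  have : 0 < Nat.card (powMonoidHom 2 : G →* G).range := Nat.card_pos
  nlinarith

theorem AddCommGroup.two_pow_finrank_le_index (M : Type*) [AddCommGroup M] [Module.Finite ℤ M]
    {t : M} (ht : t ≠ 0) (ht2 : 2 • t = 0) :
    2 ^ (Module.finrank ℤ M + 1) ≤ (nsmulAddMonoidHom 2 : M →+ M).range.index := by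
  classical
  have : AddGroup.FG M := Module.Finite.iff_addGroup_fg.1 inferInstance
  obtain ⟨n, ι, _, p, hp, e, ⟨φ⟩⟩ := AddCommGroup.equiv_free_prod_directSum_zmod M
  set T := DirectSum ι fun i => ZMod (p i ^ e i) with hT
  have hfin : Finite T := by
    have : ∀ i, NeZero (p i ^ e i) := fun i => ⟨pow_ne_zero _ (hp i).ne_zero⟩
    exact Finite.of_equiv _ (DirectSum.addEquivProd fun i => ZMod (p i ^ e i)).symm.toEquiv
  have hrank : Module.finrank ℤ M = n := by
    have h1 : Module.IsTorsion ℤ (LinearMap.fst ℤ (Fin n →₀ ℤ) T).ker := by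
      rintro ⟨⟨a, x⟩, ha⟩
      have ha' : a = 0 := ha
      subst ha'
      refine ⟨⟨(Nat.card T : ℤ), mem_nonZeroDivisors_of_ne_zero
        (by exact_mod_cast Nat.card_pos.ne')⟩, ?_⟩
      rw [Submonoid.mk_smul]
      ext1
      rw [Submodule.coe_smul, Prod.smul_mk, smul_zero, natCast_zsmul, card_nsmul_eq_zero']
      rfl
    have : Module.Finite ℤ ((Fin n →₀ ℤ) × T) := Module.Finite.equiv φ.toIntLinearEquiv
    have h2 : Module.finrank ℤ (LinearMap.fst ℤ (Fin n →₀ ℤ) T).ker = 0 :=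
      (Module.finrank_eq_zero_iff_isTorsion (R := ℤ)
        (M := ↥(LinearMap.fst ℤ (Fin n →₀ ℤ) T).ker)).2 h1
    rw [LinearEquiv.finrank_eq φ.toIntLinearEquiv,
      ← Submodule.finrank_quotient_add_finrank (LinearMap.fst ℤ (Fin n →₀ ℤ) T).ker,
      h2, LinearEquiv.finrank_eq
        (LinearMap.quotKerEquivOfSurjective _ LinearMap.fst_surjective)]
    simp
  set Q := T ⧸ (nsmulAddMonoidHom 2 : T →+ T).range with hQ
  have hcardQ : 2 ≤ Nat.card Q := by
    have h0 : (φ t).1 = 0 := by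
      have h2 : 2 • (φ t).1 = 0 := by
        rw [← Prod.smul_fst, ← map_nsmul, ht2, map_zero, Prod.fst_zero]
      exact (smul_eq_zero.1 h2).resolve_left two_ne_zero
    have h1 : (φ t).2 ≠ 0 := fun h => ht (φ.map_eq_zero_iff.1 (Prod.ext h0 h))
    have h2 : 2 • (φ t).2 = 0 := by
      rw [← Prod.smul_snd, ← map_nsmul, ht2, map_zero, Prod.snd_zero]
    have h3 : ¬ Function.Injective (nsmulAddMonoidHom 2 : T →+ T) := by
      intro h
      apply h1
      apply h
      rw [map_zero]
      exact h2
    have h4 : ¬ Function.Surjective (nsmulAddMonoidHom 2 : T →+ T) := fun h =>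
      h3 (Finite.injective_iff_surjective.2 h)
    have h5 : (nsmulAddMonoidHom 2 : T →+ T).range.index ≠ 1 := fun h =>
      h4 (AddMonoidHom.range_eq_top.1 (AddSubgroup.index_eq_one.1 h))
    have h6 : (nsmulAddMonoidHom 2 : T →+ T).range.index ≠ 0 :=
      AddSubgroup.index_ne_zero_of_finite
    have h7 : (nsmulAddMonoidHom 2 : T →+ T).range.index = Nat.card Q := rfl
    omega
  let g : (Fin n →₀ ℤ) × T →+ (Fin n → ZMod 2) × Q :=
    { toFun := fun x => (fun i => (x.1 i : ZMod 2), QuotientAddGroup.mk x.2)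
      map_zero' := by
        ext <;> simp
      map_add' := fun x y => by
        ext <;> simp }
  have hg : Function.Surjective g := by
    rintro ⟨a, q⟩
    obtain ⟨x, rfl⟩ := QuotientAddGroup.mk_surjective q
    refine ⟨(Finsupp.equivFunOnFinite.symm fun i => ((a i).val : ℤ), x), ?_⟩
    refine Prod.ext ?_ rfl
    funext i
    simp [g]
  have hker : (g.comp φ.toAddMonoidHom).ker = (nsmulAddMonoidHom 2 : M →+ M).range := by
    ext m
    rw [AddMonoidHom.mem_ker, AddMonoidHom.mem_range]
    constructor
    · intro h
      have h1 : ∀ i, (((φ m).1 i : ℤ) : ZMod 2) = 0 := fun i =>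
        congrFun (congrArg Prod.fst h) i
      have h2 : (QuotientAddGroup.mk (φ m).2 : Q) = 0 := congrArg Prod.snd h
      rw [QuotientAddGroup.eq_zero_iff] at h2
      obtain ⟨y, hy⟩ := h2
      have h3 : ∀ i, ∃ c : ℤ, (φ m).1 i = 2 * c := fun i =>
        (ZMod.intCast_zmod_eq_zero_iff_dvd _ 2).1 (h1 i)
      choose c hc using h3
      refine ⟨φ.symm (Finsupp.equivFunOnFinite.symm c, y), ?_⟩
      apply φ.injective
      rw [nsmulAddMonoidHom_apply, map_nsmul, AddEquiv.apply_symm_apply]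
      refine Prod.ext ?_ hy
      ext i
      simp [hc]
    · rintro ⟨y, rfl⟩
      rw [nsmulAddMonoidHom_apply, map_nsmul]
      refine Prod.ext ?_ ?_
      · funext i
        rw [Prod.smul_fst, Pi.smul_apply, nsmul_eq_mul]
        have : ((2 : ℕ) : ZMod 2) = 0 := rfl
        rw [this, zero_mul]
        rfl
      · rw [Prod.smul_snd]
        change 2 • (QuotientAddGroup.mk (φ y).2 : Q) = 0
        rw [← QuotientAddGroup.mk_nsmul, QuotientAddGroup.eq_zero_iff]
        exact ⟨_, rfl⟩
  have hsurj : Function.Surjective (g.comp φ.toAddMonoidHom) := hg.comp φ.surjective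
  rw [← hker, AddSubgroup.index_ker, AddMonoidHom.range_eq_top.2 hsurj, hrank,
    Nat.card_congr (AddSubgroup.topEquiv).toEquiv, Nat.card_prod, Nat.card_pi]
  simp only [Nat.card_zmod, Finset.prod_const, Finset.card_univ, Fintype.card_fin]
  rw [pow_succ]
  gcongr

namespace IsQuadraticConj

variable {R S : Type*} [CommRing R] [CommRing S] [Algebra R S] {s : S ≃ₐ[R] S}
  [IsDedekindDomain S] [IsDedekindDomain R]

omit [IsDedekindDomain S] [IsDedekindDomain R] in
theorem two_pow_le_relIndex_sq (hs : IsQuadraticConj s) (h1 : (-1 : S) ≠ 1)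
    [Module.Finite ℤ (Additive Sˣ)] {m n : ℕ} (hn : n ≤ Module.finrank ℤ (Additive Sˣ))
    [Module.Finite ℤ (Additive Rˣ)] (hm : Module.finrank ℤ (Additive Rˣ) ≤ m) :
    2 ^ (n - m + 1) ≤ (hs.unitNorm.ker.map (powMonoidHom 2)).relIndex hs.unitNorm.ker := by
  set f : Additive Sˣ →ₗ[ℤ] Additive Rˣ := (MonoidHom.toAdditive hs.unitNorm).toIntLinearMap with hf
  have h2 := Submodule.finrank_quotient_add_finrank f.ker
  have h3 : Module.finrank ℤ (Additive Sˣ ⧸ f.ker) ≤ Module.finrank ℤ (Additive Rˣ) := by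
    rw [LinearEquiv.finrank_eq f.quotKerEquivRange]
    exact Submodule.finrank_le _
  have h4 : (-1 : Sˣ) ∈ hs.unitNorm.ker := by
    rw [hs.mem_ker_unitNorm]
    simp
  have h5 := AddCommGroup.two_pow_finrank_le_index f.ker
    (t := ⟨Additive.ofMul (-1 : Sˣ), (by
      exact h4)⟩) (by
      intro h
      apply h1
      have := congrArg (fun z : f.ker => ((Additive.toMul (z : Additive Sˣ) : Sˣ) : S)) h
      simpa using this) (by
      ext
      simp [← ofMul_pow])
  have h6 : (nsmulAddMonoidHom 2 : f.ker →+ f.ker).range.index =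
      (hs.unitNorm.ker.map (powMonoidHom 2)).relIndex hs.unitNorm.ker := by
    have : (hs.unitNorm.ker.map (powMonoidHom 2)).subgroupOf hs.unitNorm.ker =
        (powMonoidHom 2 : hs.unitNorm.ker →* hs.unitNorm.ker).range := by
      ext x
      rw [Subgroup.mem_subgroupOf]
      constructor
      · rintro ⟨y, hy, h⟩
        exact ⟨⟨y, hy⟩, Subtype.ext h⟩
      · rintro ⟨y, rfl⟩
        exact ⟨y, y.2, rfl⟩
    rw [Subgroup.relIndex, this]
    rfl
  rw [← h6]
  refine le_trans (Nat.pow_le_pow_right two_pos ?_) h5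
  omega

/-- If an ideal class is a square, a generator of (an odd power of) the norm of the ideal
is a norm up to units. -/
theorem exists_norm_of_idealClass_mem_squares (hs : IsQuadraticConj s) {h : ℕ}
    (hh : ∀ c : ClassGroup R, c ^ h = 1) {A : Ideal S} (hA0 : A ≠ ⊥)
    (hA : idealClass A ∈ squares (ClassGroup S)) {b : Ideal R} {a : R}
    (hb : A * A.map s = b.map (algebraMap R S)) (ha : b ^ h = Ideal.span {a}) :
    ∃ (η : Rˣ) (x y : S), x ≠ 0 ∧ y ≠ 0 ∧ η * a * hs.norm x = hs.norm y := by
  obtain ⟨c, hc⟩ := hA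
  obtain ⟨B, hB0, rfl⟩ := idealClass_surjective c
  rw [powMonoidHom_apply, ← idealClass_pow hB0, eq_comm,
    idealClass_eq_iff hA0 (pow_ne_zero 2 hB0)] at hc
  obtain ⟨x, y, hx, hy, hxy⟩ := hc
  obtain ⟨d, hd⟩ := hs.exists_mul_map_eq B hB0
  have hd0 : d ≠ ⊥ := by
    rintro rfl
    rw [Ideal.map_bot] at hd
    exact mul_ne_zero hB0 (hs.map_ne_bot hB0) hd
  obtain ⟨e, he0, he⟩ := exists_pow_eq_span hh hd0
  have h1 : Ideal.span {x * s x} * (A * A.map s) = Ideal.span {y * s y} * (B * B.map s) ^ 2 := by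
    have := congrArg (Ideal.map s) hxy
    rw [Ideal.map_mul, Ideal.map_mul, map_span, map_span, Ideal.map_pow] at this
    rw [← Ideal.span_singleton_mul_span_singleton, ← Ideal.span_singleton_mul_span_singleton,
      mul_mul_mul_comm, hxy, this]
    ring
  have h2 : Ideal.span {algebraMap R S (hs.norm (x ^ h) * a)} =
      Ideal.span {algebraMap R S (hs.norm (y ^ h) * e ^ 2)} := by
    have h3 : ∀ r : R, Ideal.span {algebraMap R S r} = (Ideal.span {r}).map (algebraMap R S) := by
      intro r
      rw [Ideal.map_span, Set.image_singleton]
    rw [map_mul, map_mul, ← Ideal.span_singleton_mul_span_singleton,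
      ← Ideal.span_singleton_mul_span_singleton, h3 a, h3 (e ^ 2), ← Ideal.span_singleton_pow,
      ← ha, ← he, Ideal.map_pow, ← hb, Ideal.map_pow, Ideal.map_pow, ← hd, map_pow, map_pow,
      map_pow, map_pow, ← Ideal.span_singleton_pow, ← Ideal.span_singleton_pow,
      hs.algebraMap_norm, hs.algebraMap_norm, ← mul_pow, h1]
    ring
  obtain ⟨η, hη⟩ := hs.exists_unit_of_span_eq h2
  refine ⟨η, x ^ h, y ^ h * algebraMap R S e, pow_ne_zero h hx, mul_ne_zero (pow_ne_zero h hy)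
    fun h => he0 (hs.inj (by rw [h, map_zero])), ?_⟩
  rw [map_mul hs.norm (y ^ h), hs.norm_algebraMap, hη]
  ring

omit [IsDedekindDomain R] in
theorem mul_map_eq_map_comap (hs : IsQuadraticConj s) {P : Ideal S} (hP : P.IsPrime) (hP0 : P ≠ ⊥)
    {x : S} {t : R} (hx : s x = -x) (hxt : x - algebraMap R S t ∈ P)
    (ht : algebraMap R S (2 * t) ∉ P) :
    P * P.map s = (P.comap (algebraMap R S)).map (algebraMap R S) := by
  have hne : P.map s ≠ P := by
    intro h
    apply ht
    have h1 : s (x - algebraMap R S t) ∈ P := by rwa [← hs.mem_map, h]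
    have h2 := P.add_mem hxt h1
    rw [map_sub, hx, AlgEquiv.commutes] at h2
    have h3 := P.neg_mem h2
    convert h3 using 1
    rw [map_mul, map_ofNat]
    ring
  rcases hs.map_comap_eq hP hP0 with h | h
  · refine absurd ?_ hne
    rw [← h, hs.map_algebraMap]
  · exact h.symm

end IsQuadraticConj

/-- `E = F(s)` where `s` is a square root of the nonsquare `a : F`. -/
structure IsSqrtExt {F E : Type*} [Field F] [Field E] [Algebra F E] (a : F) (s : E) : Prop where
  sq : s ^ 2 = algebraMap F E a
  not_isSquare : ¬ IsSquare a
  exists_eq : ∀ x : E, ∃ c d : F, x = algebraMap F E c + algebraMap F E d * s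

namespace IsSqrtExt

variable {F E : Type*} [Field F] [Field E] [Algebra F E] {a : F} {s : E}

theorem eq_zero (h : IsSqrtExt a s) {c d : F} (hcd : algebraMap F E c + algebraMap F E d * s = 0) :
    c = 0 ∧ d = 0 := by
  by_cases hd : d = 0
  · subst hd
    rw [map_zero, zero_mul, add_zero, map_eq_zero] at hcd
    exact ⟨hcd, rfl⟩
  · refine absurd ⟨c / d, ?_⟩ h.not_isSquare
    have h1 : c ^ 2 = d ^ 2 * a := by
      apply (algebraMap F E).injective
      rw [map_mul, map_pow, map_pow, ← h.sq]
      linear_combination (algebraMap F E c - algebraMap F E d * s) * hcd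
    field_simp
    linear_combination -h1

theorem eq_and_eq (h : IsSqrtExt a s) {c d c' d' : F} (hcd : algebraMap F E c + algebraMap F E d * s
    = algebraMap F E c' + algebraMap F E d' * s) : c = c' ∧ d = d' := by
  have := h.eq_zero (c := c - c') (d := d - d') (by
    rw [map_sub, map_sub]
    linear_combination hcd)
  exact ⟨sub_eq_zero.1 this.1, sub_eq_zero.1 this.2⟩

/-- Homomorphisms from a quadratic extension are given by the choice of a square root. -/
theorem exists_algHom (h : IsSqrtExt a s) {L : Type*} [CommRing L] [Algebra F L] {t : L}
    (ht : t ^ 2 = algebraMap F L a) : ∃ f : E →ₐ[F] L, f s = t := by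
  choose c d hcd using h.exists_eq
  have key : ∀ (x : E) (p q : F), x = algebraMap F E p + algebraMap F E q * s →
      c x = p ∧ d x = q := fun x p q hx => h.eq_and_eq (by rw [← hcd x, ← hx])
  have hs := key s 0 1 (by simp)
  have hmap : ∀ p : F, c (algebraMap F E p) = p ∧ d (algebraMap F E p) = 0 :=
    fun p => key _ p 0 (by simp)
  refine ⟨{ toFun := fun x => algebraMap F L (c x) + algebraMap F L (d x) * t
            map_one' := ?_
            map_mul' := fun x y => ?_
            map_zero' := ?_
            map_add' := fun x y => ?_
            commutes' := fun p => ?_ }, ?_⟩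
  · have := hmap 1
    rw [map_one] at this
    simp [this.1, this.2]
  · have := key (x * y) (c x * c y + d x * d y * a) (c x * d y + d x * c y) (by
      conv_lhs => rw [hcd x, hcd y]
      simp only [map_mul, map_add, ← h.sq]
      ring)
    rw [this.1, this.2]
    simp only [map_mul, map_add, ← ht]
    ring
  · have := hmap 0
    rw [map_zero] at this
    simp [this.1, this.2]
  · have := key (x + y) (c x + c y) (d x + d y) (by
      conv_lhs => rw [hcd x, hcd y]
      simp only [map_add]
      ring)
    rw [this.1, this.2]
    simp only [map_add]
    ring
  · simp [(hmap p).1, (hmap p).2]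
  · change algebraMap F L (c s) + algebraMap F L (d s) * t = t
    simp [hs.1, hs.2]

theorem exists_conj (h : IsSqrtExt a s) : ∃ σ : E ≃ₐ[F] E, σ s = -s := by
  obtain ⟨f, hf⟩ := h.exists_algHom (L := E) (t := -s) (by rw [neg_sq, h.sq])
  have hff : f.comp f = AlgHom.id F E := by
    ext x
    obtain ⟨c, d, rfl⟩ := h.exists_eq x
    simp [hf]
  exact ⟨AlgEquiv.ofAlgHom f f hff hff, hf⟩

theorem finrank_eq_two (h : IsSqrtExt a s) : Module.finrank F E = 2 := by
  have hli : LinearIndependent F ![1, s] := by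
    rw [LinearIndependent.pair_iff]
    intro c d hcd
    apply h.eq_zero
    rwa [Algebra.smul_def, Algebra.smul_def, mul_one] at hcd
  have hsp : ⊤ ≤ Submodule.span F (Set.range ![1, s]) := by
    rintro x -
    obtain ⟨c, d, rfl⟩ := h.exists_eq x
    rw [Matrix.range_cons, Matrix.range_cons, Matrix.range_empty, Set.union_empty,
      Set.singleton_union, Submodule.mem_span_pair]
    exact ⟨c, d, by rw [Algebra.smul_def, Algebra.smul_def, mul_one]⟩
  rw [Module.finrank_eq_card_basis (Module.Basis.mk hli hsp), Fintype.card_fin]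

theorem mul_conj (h : IsSqrtExt a s) {σ : E ≃ₐ[F] E} (hσ : σ s = -s) (c d : F) :
    (algebraMap F E c + algebraMap F E d * s) * σ (algebraMap F E c + algebraMap F E d * s) =
      algebraMap F E (c ^ 2 - a * d ^ 2) := by
  rw [map_add, map_mul, AlgEquiv.commutes, AlgEquiv.commutes, hσ, map_sub, map_mul, ← h.sq, map_pow,
    map_pow]
  ring

section Integers

variable (A : Type*) [CommRing A] [Algebra A F]
  [IsFractionRing A F] (S : Type*) [CommRing S] [Algebra A S] [Algebra S E] [Algebra A E]
  [IsScalarTower A S E] [IsScalarTower A F E] [IsIntegralClosure S A E] [Algebra.IsAlgebraic F E]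

theorem isQuadraticConj [IsIntegrallyClosed A] (h : IsSqrtExt a s) (h2 : (2 : F) ≠ 0)
    {σ : E ≃ₐ[F] E} (hσ : σ s = -s) :
    IsQuadraticConj (galRestrict A F E S σ) := by
  have hinj : Function.Injective (algebraMap S E) := IsIntegralClosure.algebraMap_injective S A E
  have hAE : Function.Injective (algebraMap A E) := by
    rw [IsScalarTower.algebraMap_eq A F E]
    exact (algebraMap F E).injective.comp (IsFractionRing.injective A F)
  have hAS : Function.Injective (algebraMap A S) := by
    intro x y hxy
    apply hAE
    rw [IsScalarTower.algebraMap_apply A S E, hxy, ← IsScalarTower.algebraMap_apply A S E]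
  have h2E : (2 : E) ≠ 0 := by
    rw [← map_ofNat (algebraMap F E)]
    exact (map_ne_zero _).2 h2
  have hs0 : s ≠ 0 := by
    rintro rfl
    have := h.sq
    rw [zero_pow two_ne_zero, eq_comm, map_eq_zero] at this
    exact h.not_isSquare (this ▸ IsSquare.zero)
  refine ⟨hAS, fun x => ?_, fun x hx => ?_, ?_⟩
  · apply hinj
    rw [algebraMap_galRestrict_apply, algebraMap_galRestrict_apply]
    obtain ⟨c, d, hcd⟩ := h.exists_eq (algebraMap S E x)
    rw [hcd]
    simp [hσ]
  · obtain ⟨c, d, hcd⟩ := h.exists_eq (algebraMap S E x)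
    have h1 := congrArg (algebraMap S E) hx
    rw [algebraMap_galRestrict_apply, hcd, map_add, map_mul, AlgEquiv.commutes, AlgEquiv.commutes,
      hσ] at h1
    have h3 : algebraMap F E d = 0 := by
      have : 2 * (algebraMap F E d * s) = 0 := by linear_combination -h1
      simpa [h2E, hs0] using this
    rw [h3, zero_mul, add_zero] at hcd
    have hint : IsIntegral A (algebraMap F E c) := by
      rw [← hcd]
      exact (IsIntegralClosure.isIntegral A E x).map (IsScalarTower.toAlgHom A S E)
    obtain ⟨r, rfl⟩ := IsIntegrallyClosed.isIntegral_iff.1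
      ((isIntegral_algebraMap_iff (algebraMap F E).injective).1 hint)
    refine ⟨r, hinj ?_⟩
    rw [hcd, ← IsScalarTower.algebraMap_apply, ← IsScalarTower.algebraMap_apply]
  · by_contra! hfix
    have h1 : σ = 1 := (galRestrict A F E S).injective (by
      rw [map_one]
      ext x
      exact hfix x)
    rw [h1, AlgEquiv.one_apply] at hσ
    have : 2 * s = 0 := by linear_combination hσ
    simp [h2E, hs0] at this

end Integers

end IsSqrtExt

theorem even_and_odd_of_sq_add_one {l u v : ℤ} (hl : l % 8 = 1) (h : u ^ 2 + 1 = l * v ^ 2) :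
    4 ∣ u ∧ Odd v := by
  have h1 : ((u : ZMod 8)) ^ 2 + 1 = v ^ 2 := by
    have h2 : (l : ZMod 8) = 1 := by
      rw [← Int.cast_one, ZMod.intCast_eq_intCast_iff]
      exact hl
    have := congrArg (Int.cast : ℤ → ZMod 8) h
    push_cast at this
    rw [this, h2, one_mul]
  have key : ∀ x y : ZMod 8, x ^ 2 + 1 = y ^ 2 → (x = 0 ∨ x = 4) ∧
      (y = 1 ∨ y = 3 ∨ y = 5 ∨ y = 7) := by decide
  have hc : ∀ (x : ℤ) (c : ℤ), (x : ZMod 8) = (c : ZMod 8) → x % 8 = c % 8 := fun x c h =>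
    (ZMod.intCast_eq_intCast_iff x c 8).1 h
  obtain ⟨hu, hv⟩ := key _ _ h1
  constructor
  · rcases hu with h | h
    · have := hc u 0 (by simpa using h)
      omega
    · have := hc u 4 (by simpa using h)
      omega
  · rw [Int.odd_iff]
    rcases hv with h | h | h | h
    · have := hc v 1 (by simpa using h)
      omega
    · have := hc v 3 (by simpa using h)
      omega
    · have := hc v 5 (by simpa using h)
      omega
    · have := hc v 7 (by simpa using h)
      omega

/-- For `u² + 1 = l v²`, the quartic symbol of `2` modulo `l` is governed by `u mod 8`. -/
theorem two_pow_eq_iff {l : ℕ} [Fact l.Prime] (hl : l % 8 = 1) {u v : ℤ} (hu0 : 0 < u)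
    (huv : u ^ 2 + 1 = l * v ^ 2) :
    (2 : ZMod l) ^ ((l - 1) / 4) = (-1) ^ ((l - 1) / 8) ↔ 8 ∣ u := by
  obtain ⟨hu4, hv⟩ := even_and_odd_of_sq_add_one (l := l) (by omega) huv
  have hU : (u : ZMod l) ^ 2 = -1 := by
    have := congrArg (Int.cast : ℤ → ZMod l) huv
    push_cast at this
    rw [ZMod.natCast_self, zero_mul] at this
    linear_combination this
  have h1 : ((u + 1 : ℤ) : ZMod l) ^ (l / 2) = 2 ^ ((l - 1) / 4) * (-1) ^ ((l - 1) / 8) := by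
    have h3 : (u : ZMod l) ^ ((l - 1) / 4) = (-1) ^ ((l - 1) / 8) := by
      rw [← hU, ← pow_mul, show 2 * ((l - 1) / 8) = (l - 1) / 4 by omega]
    rw [show l / 2 = 2 * ((l - 1) / 4) by omega, pow_mul, ← h3, ← mul_pow]
    congr 1
    push_cast
    linear_combination hU
  have h2 : legendreSym l (u + 1) = ZMod.χ₈ ((u + 1 : ℤ) : ZMod 8) := by
    obtain ⟨w, hw⟩ : ∃ w : ℕ, u + 1 = w := ⟨(u + 1).toNat, by omega⟩
    have hodd : Odd w := by
      rw [Nat.odd_iff]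
      omega
    have hcop : v.gcd (w : ℤ) = 1 := by
      rw [← hw, ← Int.isCoprime_iff_gcd_eq_one]
      obtain ⟨m, rfl⟩ := hv
      exact ⟨1 - m * (l * (2 * m + 1)), m * (u - 1), by linear_combination m * huv⟩
    have hmod : ((l : ℤ) * v ^ 2) % w = 2 % w := by
      rw [← huv, ← hw]
      exact Int.ModEq.symm ((Int.modEq_iff_dvd).2 ⟨u - 1, by ring⟩)
    rw [hw, jacobiSym.legendreSym.to_jacobiSym,
      jacobiSym.quadratic_reciprocity_one_mod_four' hodd (by omega), Int.cast_natCast,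
      ← jacobiSym.at_two hodd, ← jacobiSym.mod_left' hmod, jacobiSym.mul_left,
      jacobiSym.sq_one' hcop, mul_one]
  have h3 : ((legendreSym l (u + 1) : ℤ) : ZMod l) = 2 ^ ((l - 1) / 4) * (-1) ^ ((l - 1) / 8) := by
    rw [legendreSym.eq_pow, h1]
  have hl2 : (2 : ZMod l) ≠ 0 := by
    intro h
    have := (ZMod.natCast_eq_zero_iff 2 l).1 (by exact_mod_cast h)
    have := Nat.le_of_dvd two_pos this
    have := (Fact.out : l.Prime).two_le
    omega
  have hne : (-1 : ZMod l) ≠ 1 := fun h => hl2 (by linear_combination -h)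
  have hpm : ((-1 : ZMod l) ^ ((l - 1) / 8)) ^ 2 = 1 := by
    rw [← pow_mul, mul_comm, pow_mul, neg_one_sq, one_pow]
  have h4 : (2 : ZMod l) ^ ((l - 1) / 4) = (-1) ^ ((l - 1) / 8) ↔
      ((legendreSym l (u + 1) : ℤ) : ZMod l) = 1 := by
    rw [h3]
    constructor
    · intro h
      rw [h, ← sq, hpm]
    · intro h
      linear_combination (-1) ^ ((l - 1) / 8) * h - 2 ^ ((l - 1) / 4) * hpm
  rw [h4, h2]
  have h5 : u % 8 = 0 ∨ u % 8 = 4 := by omega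
  rcases h5 with h5 | h5
  · have h6 : ((u + 1 : ℤ) : ZMod 8) = ((1 : ℤ) : ZMod 8) :=
      (ZMod.intCast_eq_intCast_iff _ _ 8).2 (by change (u + 1) % 8 = 1 % 8; omega)
    rw [h6]
    simp [show (8 : ℤ) ∣ u by omega]
  · have h6 : ((u + 1 : ℤ) : ZMod 8) = ((5 : ℤ) : ZMod 8) :=
      (ZMod.intCast_eq_intCast_iff _ _ 8).2 (by change (u + 1) % 8 = 5 % 8; omega)
    rw [h6, show ZMod.χ₈ ((5 : ℤ) : ZMod 8) = -1 by decide]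
    simp [hne, show ¬ (8 : ℤ) ∣ u by omega]

namespace PadicInt

theorem toZModPow_three_eq_of_eq {z d : ℤ_[2]} (hz : IsUnit z)
    (hd : toZModPow 3 d = 1 ∨ toZModPow 3 d = 5) {x y : ℚ_[2]}
    (h : (z : ℚ_[2]) = x ^ 2 - 2 * d * y ^ 2) : toZModPow 3 z = 1 ∨ toZModPow 3 z = -1 := by
  have hd1 : ‖(d : ℚ_[2])‖ = 1 := by
    have h1 : IsUnit d := by
      by_contra hd2
      have h2 : d ∈ IsLocalRing.maximalIdeal ℤ_[2] := hd2
      rw [PadicInt.maximalIdeal_eq_span_p, Nat.cast_ofNat] at h2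
      obtain ⟨e, rfl⟩ := Ideal.mem_span_singleton.1 h2
      have h3 : ∀ w : ZMod (2 ^ 3), ¬ (2 * w = 1 ∨ 2 * w = 5) := by decide
      rw [map_mul, map_ofNat] at hd
      exact h3 _ hd
    exact PadicInt.isUnit_iff.1 h1
  have h2n : ‖(2 : ℚ_[2])‖ = 2⁻¹ := by simpa using Padic.norm_p (p := 2)
  have hz1 : ‖(z : ℚ_[2])‖ = 1 := PadicInt.isUnit_iff.1 hz
  have hne : x ≠ 0 → y ≠ 0 → ‖x ^ 2‖ ≠ ‖2 * d * y ^ 2‖ := by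
    intro hx hy hxy
    rw [norm_mul, norm_mul, h2n, hd1, norm_pow, norm_pow, Padic.norm_eq_zpow_neg_valuation hx,
      Padic.norm_eq_zpow_neg_valuation hy, mul_one, ← zpow_natCast, ← zpow_natCast, ← zpow_mul,
      ← zpow_mul, Nat.cast_ofNat, ← zpow_neg_one, ← zpow_add₀ two_ne_zero] at hxy
    have := zpow_right_injective₀ (by norm_num) (by norm_num) hxy
    omega
  have hle : ‖x ^ 2‖ ≤ 1 ∧ ‖2 * d * y ^ 2‖ ≤ 1 := by
    by_cases hx : x = 0
    · subst hx
      have : (z : ℚ_[2]) = -(2 * d * y ^ 2) := by rw [h]; ring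
      rw [← norm_neg (2 * _ * _), ← this, hz1]
      simp
    by_cases hy : y = 0
    · subst hy
      have : (z : ℚ_[2]) = x ^ 2 := by rw [h]; ring
      rw [← this, hz1]
      simp
    have h3 := hne hx hy
    rw [← norm_neg (2 * _ * _)] at h3 ⊢
    have h4 := Padic.add_eq_max_of_ne h3
    rw [← sub_eq_add_neg, ← h, hz1] at h4
    exact max_le_iff.1 h4.ge
  have hx1 : ‖x‖ ≤ 1 := by
    rw [norm_pow] at hle
    exact (sq_le_one_iff₀ (norm_nonneg _)).1 hle.1
  have hy1 : ‖y‖ ≤ 1 := by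
    by_contra! hy
    have hy0 : y ≠ 0 := by
      rintro rfl
      simp at hy
      linarith
    rw [norm_mul, norm_mul, h2n, hd1, norm_pow y, mul_one] at hle
    rw [Padic.norm_eq_zpow_neg_valuation hy0] at hy
    have h5 : (0 : ℤ) < -y.valuation := by
      rw [← zpow_lt_zpow_iff_right₀ (a := (2 : ℝ)) (by norm_num)]
      simpa using hy
    clear hy
    have h6 : (2 : ℝ) ≤ ‖y‖ := by
      rw [Padic.norm_eq_zpow_neg_valuation hy0]
      calc (2 : ℝ) = 2 ^ (1 : ℤ) := by norm_num
        _ ≤ _ := by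
          rw [Nat.cast_ofNat]
          exact zpow_le_zpow_right₀ (by norm_num) (by omega)
    nlinarith [hle.2]
  obtain ⟨x', rfl⟩ : ∃ x' : ℤ_[2], (x' : ℚ_[2]) = x := ⟨⟨x, hx1⟩, rfl⟩
  obtain ⟨y', rfl⟩ : ∃ y' : ℤ_[2], (y' : ℚ_[2]) = y := ⟨⟨y, hy1⟩, rfl⟩
  have hZ : z = x' ^ 2 - 2 * d * y' ^ 2 := by
    apply PadicInt.ext
    push_cast
    exact h
  have h7 := congrArg (toZModPow 3) hZ
  simp only [map_sub, map_mul, map_pow, map_ofNat] at h7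
  have key : ∀ w e a b : ZMod (2 ^ 3), IsUnit w → (e = 1 ∨ e = 5) → w = a ^ 2 - 2 * e * b ^ 2 →
      w = 1 ∨ w = -1 := by decide
  exact key _ _ _ _ (hz.map _) hd h7

theorem exists_sq_eq_natCast {l : ℕ} (hl : l % 8 = 1) : ∃ t : ℤ_[2], t ^ 2 = l := by
  have h := hensels_lemma (p := 2) (R := ℤ_[2])
    (F := Polynomial.X ^ 2 - Polynomial.C (l : ℤ_[2])) (a := 1) (by
    simp only [map_sub, map_pow, Polynomial.aeval_X, Polynomial.aeval_C, one_pow,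
      Polynomial.derivative_C, sub_zero, Polynomial.derivative_X_pow]
    obtain ⟨m, hm⟩ : ∃ m : ℕ, l = 1 + 8 * m := ⟨l / 8, by omega⟩
    subst hm
    have h1 : ‖(2 : ℤ_[2])‖ = 2⁻¹ := by simpa using PadicInt.norm_p (p := 2)
    have h2 : (1 : ℤ_[2]) - algebraMap ℤ_[2] ℤ_[2] ((1 + 8 * m : ℕ) : ℤ_[2]) = -(2 ^ 3 * m) := by
      simp
      norm_num
    rw [h2]
    simp [h1]
    have := PadicInt.norm_le_one (m : ℤ_[2])
    nlinarith)
  obtain ⟨t, ht, -⟩ := h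
  refine ⟨t, ?_⟩
  simp at ht
  linear_combination ht

end PadicInt

namespace IsSqrtExt

theorem exists_ringHom_padicInt {k : Type*} [Field k] [NumberField k] {a : ℚ} {s : k}
    (h : IsSqrtExt a s) {t : ℤ_[2]} (ht : (t : ℚ_[2]) ^ 2 = a) :
    ∃ (f : k →ₐ[ℚ] ℚ_[2]) (j : 𝓞 k →+* ℤ_[2]), f s = t ∧ ∀ x : 𝓞 k, (j x : ℚ_[2]) = f x := by
  obtain ⟨f, hf⟩ := h.exists_algHom (L := ℚ_[2]) (t := t) (by simpa using ht)
  have hmem : ∀ x : 𝓞 k, ‖f x‖ ≤ 1 := by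
    intro x
    have h1 : IsIntegral ℤ_[2] (f x) :=
      ((RingOfIntegers.isIntegral_coe x).map (f.restrictScalars ℤ)).tower_top
    obtain ⟨y, hy⟩ := IsIntegrallyClosed.isIntegral_iff.1 h1
    rw [← hy]
    exact y.2
  refine ⟨f, ((f : k →+* ℚ_[2]).comp (algebraMap (𝓞 k) k)).codRestrict (PadicInt.subring 2) hmem,
    hf, fun x => rfl⟩

/-- Norms from `k(√(2 * d))` that are units at a degree one prime over `2` where `d ≡ 1 (mod 4)` are
`±1` modulo `8` there. -/
theorem toZModPow_three_eq {k K : Type*} [Field k] [NumberField k] [Field K] [NumberField K]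
    [Algebra k K] {d : k} {δ : K} (h : IsSqrtExt (2 * d) δ) {σ : K ≃ₐ[k] K} (hσ : σ δ = -δ)
    (hs : IsQuadraticConj (galRestrict (𝓞 k) k K (𝓞 K) σ)) {f : k →ₐ[ℚ] ℚ_[2]} {j : 𝓞 k →+* ℤ_[2]}
    (hj : ∀ x : 𝓞 k, (j x : ℚ_[2]) = f x) {e : ℤ_[2]} (he : f d = e)
    (he4 : PadicInt.toZModPow 3 e = 1 ∨ PadicInt.toZModPow 3 e = 5) {c : 𝓞 k} {x y : 𝓞 K}
    (hx : x ≠ 0) (hxy : hs.norm y = c * hs.norm x) (hc : IsUnit (j c)) :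
    PadicInt.toZModPow 3 (j c) = 1 ∨ PadicInt.toZModPow 3 (j c) = -1 := by
  obtain ⟨p, q, hpq⟩ := h.exists_eq ((y : K) / x)
  refine PadicInt.toZModPow_three_eq_of_eq hc he4 (x := f p) (y := f q) ?_
  rw [hj, ← he, ← map_ofNat f 2, ← map_pow, ← map_pow, ← map_mul, ← map_mul, ← map_sub]
  congr 1
  have hx0 : (x : K) ≠ 0 := by simpa using hx
  have hσx : σ (x : K) ≠ 0 := (map_ne_zero σ).2 hx0
  apply (algebraMap k K).injective
  rw [← h.mul_conj hσ, ← hpq, map_div₀, div_mul_div_comm, eq_div_iff (mul_ne_zero hx0 hσx)]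
  have h1 : ∀ z : 𝓞 K, algebraMap (𝓞 K) K (algebraMap (𝓞 k) (𝓞 K) (hs.norm z)) = (z : K) * σ z := by
    intro z
    rw [hs.algebraMap_norm, map_mul, algebraMap_galRestrict_apply]
  rw [← h1, ← h1, hxy, map_mul, map_mul, ← IsScalarTower.algebraMap_apply (𝓞 k) k K,
    ← IsScalarTower.algebraMap_apply (𝓞 k) (𝓞 K) K, IsScalarTower.algebraMap_apply (𝓞 k) (𝓞 K) K c]

end IsSqrtExt

namespace GaussianInt

theorem isPrimitiveRoot_I : IsPrimitiveRoot (⟨0, 1⟩ : GaussianInt) 4 := by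
  have : (⟨0, 1⟩ : GaussianInt) ^ 2 ≠ 1 := by decide
  refine IsPrimitiveRoot.of_map_of_injective (f := toComplex) ?_ toComplex_injective
  have : toComplex ⟨0, 1⟩ = Complex.I := by simp [toComplex_def]
  rw [this]
  exact Complex.isPrimitiveRoot_I

theorem inv_eq_ringHomComp_star {F : Type*} [Field F] [Finite F] (χ : MulChar F GaussianInt) :
    χ⁻¹ = χ.ringHomComp (starRingEnd GaussianInt) := by
  rw [eq_comm, ← mul_eq_one_iff_eq_inv]
  ext1 x
  obtain ⟨u, hu⟩ := (x.isUnit.map χ : IsUnit (χ x))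
  have h1 : χ x * star (χ x) = 1 := by
    rw [← hu]
    have h2 := (Zsqrtd.norm_eq_one_iff' (by norm_num) (u : GaussianInt)).2 u.isUnit
    have h3 := Zsqrtd.norm_eq_mul_conj (u : GaussianInt)
    rw [h2] at h3
    exact_mod_cast h3.symm
  rw [MulChar.mul_apply, MulChar.ringHomComp_apply, MulChar.one_apply_coe, mul_comm]
  exact h1

theorem prime_of_norm_prime {x : GaussianInt} (h : Prime x.norm) : Prime x := by
  rw [← irreducible_iff_prime]
  refine ⟨fun hx => ?_, fun a b hab => ?_⟩
  · rw [← Zsqrtd.norm_eq_one_iff' (by norm_num)] at hx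
    rw [hx] at h
    exact not_prime_one h
  · rw [hab, Zsqrtd.norm_mul] at h
    have := (h.irreducible.isUnit_or_isUnit rfl)
    simpa only [Int.isUnit_iff_natAbs_eq, Zsqrtd.norm_eq_one_iff] using this

theorem jacobiSum_mul_star {F : Type*} [Field F] [Fintype F] {χ : MulChar F GaussianInt}
    (hF : ringChar F ≠ 0) (hχ : χ ^ 2 ≠ 1) :
    jacobiSum χ χ * star (jacobiSum χ χ) = Fintype.card F := by
  apply toComplex_injective
  have hχ1 : χ ≠ 1 := by
    rintro rfl
    exact hχ (one_pow 2)
  have h1 := jacobiSum_mul_jacobiSum_inv (F := F) (F' := ℂ) (χ := χ.ringHomComp toComplex)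
    (φ := χ.ringHomComp toComplex) (by rw [ringChar.eq_zero]; exact hF.symm)
    ((MulChar.ringHomComp_ne_one_iff toComplex_injective).2 hχ1)
    ((MulChar.ringHomComp_ne_one_iff toComplex_injective).2 hχ1)
    (by
      rw [← pow_two, MulChar.ringHomComp_pow]
      exact (MulChar.ringHomComp_ne_one_iff toComplex_injective).2 hχ)
  rw [MulChar.ringHomComp_inv, jacobiSum_ringHomComp, jacobiSum_ringHomComp,
    inv_eq_ringHomComp_star, jacobiSum_ringHomComp] at h1
  rw [map_mul, map_natCast, ← h1]
  rfl

/-- If `u² + 1 = l v²` and `J` is a Gaussian prime of norm `l`, then up to conjugating `J`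
the cofactor of `J` in `1 + u i` is a square. -/
theorem exists_eq_mul_sq {l u v : ℤ} (hv : Odd v) (hv0 : 0 < v)
    (huv : u ^ 2 + 1 = l * v ^ 2) {a b : ℤ} (hb : Even b) (hl : Prime l)
    (hab : a ^ 2 + b ^ 2 = l) (hdvd : (⟨a, b⟩ : GaussianInt) ∣ ⟨1, u⟩) :
    ∃ p q : ℤ, u = b * (p ^ 2 - q ^ 2) + 2 * a * p * q ∧ v = p ^ 2 + q ^ 2 := by
  obtain ⟨κ, hκ⟩ := hdvd
  have hN : κ.norm = v ^ 2 := by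
    have h1 := congrArg Zsqrtd.norm hκ
    rw [Zsqrtd.norm_mul, Zsqrtd.norm_def, Zsqrtd.norm_def ⟨a, b⟩] at h1
    apply mul_left_cancel₀ hl.ne_zero
    rw [← huv, ← hab]
    linear_combination -h1
  have hmul : κ * star κ = ((v : ℤ) : GaussianInt) ^ 2 := by
    rw [← Zsqrtd.norm_eq_mul_conj, hN]
    push_cast
    rfl
  have hcop : IsCoprime κ (star κ) := by
    obtain ⟨m, rfl⟩ := hv
    have h2 : (⟨1, u⟩ : GaussianInt) + star ⟨1, u⟩ = 2 := by
      rw [Zsqrtd.star_mk]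
      ext <;> simp
    have h3 : star (⟨1, u⟩ : GaussianInt) = star ⟨a, b⟩ * star κ := by
      rw [hκ, star_mul, mul_comm]
    refine ⟨star κ - 2 * (m ^ 2 + m) * ⟨a, b⟩, - 2 * (m ^ 2 + m) * star ⟨a, b⟩, ?_⟩
    push_cast at hmul
    linear_combination hmul + 2 * (m ^ 2 + m) * (hκ + h3 - h2)
  obtain ⟨ρ, ε, hε⟩ := exists_associated_pow_of_mul_eq_pow' hcop hmul
  have hε1 := (Zsqrtd.norm_eq_one_iff' (by norm_num) (ε : GaussianInt)).2 ε.isUnit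
  have hρN : (ρ.re ^ 2 + ρ.im ^ 2) ^ 2 = v ^ 2 := by
    rw [← hN, ← hε, Zsqrtd.norm_mul, hε1, pow_two ρ, Zsqrtd.norm_mul, Zsqrtd.norm_def]
    ring
  have hρv : v = ρ.re ^ 2 + ρ.im ^ 2 := by
    rcases sq_eq_sq_iff_eq_or_eq_neg.1 hρN with h | h
    · exact h.symm
    · nlinarith [sq_nonneg ρ.re, sq_nonneg ρ.im]
  rw [Zsqrtd.norm_def] at hε1
  rw [← hε, pow_two] at hκ
  have hre := congrArg Zsqrtd.re hκ
  have him := congrArg Zsqrtd.im hκ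
  simp only [Zsqrtd.re_mul, Zsqrtd.im_mul] at hre him
  generalize (ε : GaussianInt).re = x at *
  generalize (ε : GaussianInt).im = y at *
  generalize ρ.re = p at *
  generalize ρ.im = q at *
  have hxy : (x = 1 ∨ x = -1) ∧ y = 0 ∨ (y = 1 ∨ y = -1) ∧ x = 0 := by
    have h1 : x ^ 2 ≤ 1 := by nlinarith [sq_nonneg y]
    have h2 : y ^ 2 ≤ 1 := by nlinarith [sq_nonneg x]
    have h3 : -1 ≤ x := by nlinarith
    have h4 : x ≤ 1 := by nlinarith
    have h5 : -1 ≤ y := by nlinarith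
    have h6 : y ≤ 1 := by nlinarith
    clear hκ hre him
    interval_cases x <;> interval_cases y <;> omega
  rcases hxy with ⟨rfl | rfl, rfl⟩ | ⟨h, rfl⟩
  · exact ⟨p, q, by linear_combination him, hρv⟩
  · exact ⟨-q, p, by linear_combination him, by
      linear_combination hρv⟩
  · exfalso
    have hy : y ^ 2 = 1 := by rcases h with rfl | rfl <;> norm_num
    obtain ⟨c, rfl⟩ := hb
    have : (1 : ℤ) = 2 * (-(c + c) * p * q * 0 - a * p * q * y - c * y * (p ^ 2 - q ^ 2)) := by
      linear_combination hre
    omega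

theorem exists_quarticChar {l : ℕ} [Fact l.Prime] (hl : l % 4 = 1) {u v : ℤ}
    (hv : Odd v) (hv0 : 0 < v) (huv : u ^ 2 + 1 = l * v ^ 2) :
    ∃ (χ : MulChar (ZMod l) GaussianInt) (a b p q : ℤ), orderOf χ = 4 ∧
      jacobiSum χ χ = ⟨a, b⟩ ∧ a ^ 2 + b ^ 2 = l ∧ Odd a ∧
      u = b * (p ^ 2 - q ^ 2) + 2 * a * p * q ∧ v = p ^ 2 + q ^ 2 := by
  have hlp : Prime (l : ℤ) := Nat.prime_iff_prime_int.1 (Fact.out : l.Prime)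
  have h4 : 4 ∣ Fintype.card (ZMod l) - 1 := by
    rw [ZMod.card]
    omega
  obtain ⟨χ, hχ⟩ := MulChar.exists_mulChar_orderOf (ZMod l) h4 isPrimitiveRoot_I
  have hχ4 : χ ^ 4 = 1 := by rw [← hχ, pow_orderOf_eq_one]
  have hχ2 : χ ^ 2 ≠ 1 := pow_ne_one_of_lt_orderOf two_ne_zero (by rw [hχ]; norm_num)
  obtain ⟨z, -, hz⟩ := exists_jacobiSum_eq_neg_one_add (n := 4) (by norm_num) hχ4 hχ4 h4
    isPrimitiveRoot_I
  have hJ := jacobiSum_mul_star (F := ZMod l)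
    (by rw [ZMod.ringChar_zmod_n]; exact (Fact.out : l.Prime).ne_zero) hχ2
  rw [ZMod.card] at hJ
  have hre := congrArg Zsqrtd.re hz
  have him := congrArg Zsqrtd.im hz
  simp only [pow_two, Zsqrtd.re_add, Zsqrtd.im_add, Zsqrtd.re_mul, Zsqrtd.im_mul, Zsqrtd.re_sub,
    Zsqrtd.im_sub, Zsqrtd.re_neg, Zsqrtd.im_neg, Zsqrtd.re_one, Zsqrtd.im_one] at hre him
  have ha : Odd (jacobiSum χ χ).re := ⟨z.im - 1, by rw [hre]; ring⟩
  have hb : Even (jacobiSum χ χ).im := ⟨-z.re, by rw [him]; ring⟩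
  have hN : (jacobiSum χ χ).re ^ 2 + (jacobiSum χ χ).im ^ 2 = l := by
    rw [← Zsqrtd.norm_eq_mul_conj] at hJ
    have := congrArg Zsqrtd.re hJ
    rw [Zsqrtd.re_intCast, Zsqrtd.re_natCast, Zsqrtd.norm_def] at this
    rw [← this]
    ring
  generalize hJd : jacobiSum χ χ = J at *
  have hprime : Prime J := by
    apply prime_of_norm_prime
    rw [Zsqrtd.norm_def]
    convert hlp using 1
    rw [← hN]
    ring
  have hdvd : J ∣ (⟨1, u⟩ : GaussianInt) * ⟨1, -u⟩ := by
    refine ⟨star J * v ^ 2, ?_⟩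
    rw [← mul_assoc, hJ]
    have h1 : (⟨1, u⟩ : GaussianInt) * ⟨1, -u⟩ = ((u ^ 2 + 1 : ℤ) : GaussianInt) := by
      ext
      · rw [Zsqrtd.re_mul, Zsqrtd.re_intCast]
        ring
      · rw [Zsqrtd.im_mul, Zsqrtd.im_intCast]
        ring
    rw [h1, huv]
    push_cast
    rfl
  rcases hprime.dvd_or_dvd hdvd with h | h
  · obtain ⟨p, q, h⟩ := exists_eq_mul_sq hv hv0 huv hb hlp hN h
    exact ⟨χ, J.re, J.im, p, q, hχ, hJd, hN, ha, h⟩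
  · have h' : (⟨J.re, -J.im⟩ : GaussianInt) ∣ ⟨1, u⟩ := by
      have : star J ∣ star ⟨1, -u⟩ := (starRingEnd GaussianInt).toMonoidHom.map_dvd h
      rwa [Zsqrtd.star_mk 1, neg_neg] at this
    obtain ⟨p, q, h⟩ := exists_eq_mul_sq hv hv0 huv hb.neg hlp (by rw [neg_sq, hN]) h'
    refine ⟨χ.ringHomComp (starRingEnd GaussianInt), J.re, -J.im, p, q, ?_, ?_, ?_, ha, h⟩
    · rw [← inv_eq_ringHomComp_star, orderOf_inv, hχ]
    · rw [jacobiSum_ringHomComp, hJd]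
      rfl
    · rw [neg_sq, hN]

end GaussianInt

/-- The Gauss sum computation of `√(2 r (r + a))` in characteristic `q`, where `r = ±√l` and
`a` is the real part of a quartic Jacobi sum: this square root is not fixed by Frobenius when the
quartic character takes the value `-1` at `q`. -/
theorem exists_sq_eq_and_pow_eq_neg {l q : ℕ} [Fact l.Prime] [Fact q.Prime] (hl : l % 8 = 1)
    (hq : q % 4 = 1) (hlq : l ≠ q) {χ : MulChar (ZMod l) GaussianInt} (hχ : orderOf χ = 4)
    (hχq : χ q = -1) {a b : ℤ} (hJ : jacobiSum χ χ = ⟨a, b⟩) {i : ZMod q} (hi : i ^ 2 = -1)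
    {F : Type*} [Field F] [Algebra (ZMod q) F] {ζ : F} (hζ : IsPrimitiveRoot ζ l)
    {r : ZMod q} (hr : r ^ 2 = l) :
    ∃ ξ : F, ξ ^ 2 = algebraMap (ZMod q) F (2 * r * (r + a)) ∧ ξ ^ q = -ξ := by
  have : CharP F q := charP_of_injective_algebraMap (algebraMap (ZMod q) F).injective q
  have hF2 : (-1 : F) ≠ 1 := Ring.neg_one_ne_one_of_char_ne_two (by
    rw [ringChar.eq F q]
    rintro rfl
    omega)
  set ι := algebraMap (ZMod q) F i with hι
  have hι2 : ι * ι = ((-1 : ℤ) : F) := by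
    rw [← pow_two, hι, ← map_pow, hi]
    simp
  have hιq : ι ^ q = ι := by
    rw [hι, ← map_pow, ZMod.pow_card]
  set f : GaussianInt →+* F := Zsqrtd.lift ⟨ι, hι2⟩ with hf
  have hfJ : ∀ x y : ℤ, f ⟨x, y⟩ = x + y * ι := fun x y => rfl
  set X := χ.ringHomComp f with hX
  have hXq : X q = -1 := by
    rw [hX, MulChar.ringHomComp_apply, hχq, map_neg, map_one]
  have hX4 : X ^ 4 = 1 := by
    rw [hX, MulChar.ringHomComp_pow, ← hχ, pow_orderOf_eq_one, MulChar.ringHomComp_one]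
  have hql : IsUnit (q : ZMod l) :=
    (ZMod.isUnit_iff_coprime q l).2
      ((Nat.coprime_primes (Fact.out : q.Prime) Fact.out).2 hlq.symm)
  obtain ⟨z, hz⟩ : ∃ z : ZMod l, z ^ 4 = -1 := by
    obtain ⟨y, hy⟩ := (ZMod.exists_sq_eq_neg_one_iff (p := l)).2 (by omega)
    have hy0 : y ≠ 0 := by
      rintro rfl
      norm_num at hy
    obtain ⟨z, rfl⟩ := (ZMod.euler_criterion l hy0).2 (by
      rw [show l / 2 = 4 * (l / 8) by omega, pow_mul,
        show y ^ 4 = (y * y) * (y * y) by ring, ← hy]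
      norm_num)
    exact ⟨z, by rw [hy]; ring⟩
  have hX2 : X ^ 2 ≠ 1 := by
    intro h
    have hχ2 : χ ^ 2 ≠ 1 := pow_ne_one_of_lt_orderOf two_ne_zero (by rw [hχ]; norm_num)
    have hχ4 : χ ^ (2 * 2) = 1 := by rw [show 2 * 2 = orderOf χ from hχ.symm, pow_orderOf_eq_one]
    obtain ⟨x, hx⟩ := MulChar.ne_one_iff.1 hχ2
    have h1 : ((χ ^ 2) x) ^ 2 = 1 := by
      rw [← MulChar.pow_apply_coe, ← pow_mul, hχ4, MulChar.one_apply_coe]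
    have h2 : (χ ^ 2) x = -1 := (sq_eq_one_iff.1 h1).resolve_left hx
    have h3 := congrArg (fun Y : MulChar (ZMod l) F => Y x) h
    simp only [hX, MulChar.ringHomComp_pow, MulChar.ringHomComp_apply, h2,
      MulChar.one_apply_coe, map_neg, map_one] at h3
    exact hF2 h3
  set ψ := AddChar.zmodChar l ((IsPrimitiveRoot.iff_def ζ l).mp hζ).left with hψd
  have hψ : ψ.IsPrimitive := AddChar.zmodChar_primitive_of_primitive_root l hζ
  have hfrob : ∀ Y : MulChar (ZMod l) F, Y ^ 4 = 1 → Y q = -1 →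
      gaussSum Y ψ ^ q = -gaussSum Y ψ := by
    intro Y hY hYq
    have h1 : Y ^ q = Y := by
      conv_lhs => rw [← Nat.mod_add_div q 4, pow_add, pow_mul, hY, hq, one_pow, pow_one, mul_one]
    have h2 := gaussSum_mulShift_eq Y ψ hql.unit
    rw [hql.unit_spec, MulChar.inv_apply_eq_inv', hYq] at h2
    rw [gaussSum_frob, h1, AddChar.pow_mulShift, h2]
    simp
  have hcard : ∀ Y : MulChar (ZMod l) F, Y ≠ 1 → Y ^ 4 = 1 →
      gaussSum Y ψ * gaussSum Y⁻¹ ψ = l := by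
    intro Y hY hY4
    have h1 : Y⁻¹ (-1) = 1 := by
      rw [MulChar.inv_apply', inv_neg_one, ← hz, map_pow, ← MulChar.pow_apply' _ four_ne_zero, hY4,
        MulChar.one_apply]
      refine isUnit_iff_ne_zero.2 ?_
      rintro rfl
      norm_num at hz
    rw [← mul_gaussSum_inv_eq_gaussSum Y⁻¹ ψ, h1, one_mul,
      gaussSum_mul_gaussSum_eq_card hY hψ, ZMod.card]
  have hX1 : X ≠ 1 := by
    intro h
    exact hX2 (by rw [h, one_pow])
  have hXi2 : X⁻¹ * X⁻¹ = X ^ 2 := by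
    rw [← mul_inv, inv_eq_iff_mul_eq_one, ← hX4, ← pow_two, ← pow_add]
  have hXi : X⁻¹ = (χ.ringHomComp (starRingEnd GaussianInt)).ringHomComp f := by
    rw [hX, MulChar.ringHomComp_inv, GaussianInt.inv_eq_ringHomComp_star]
  set G := gaussSum X ψ with hG
  set G' := gaussSum X⁻¹ ψ with hG'
  set r₁ := gaussSum (X ^ 2) ψ with hr₁
  have hGG' : G * G' = l := hcard X hX1 hX4
  have hr₁2 : r₁ ^ 2 = l := by
    have h := hcard (X ^ 2) hX2 (by rw [← pow_mul, mul_comm, pow_mul, hX4, one_pow])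
    have h1 : (X ^ 2)⁻¹ = X ^ 2 := by
      rw [inv_eq_iff_mul_eq_one, ← hX4, ← pow_add]
    rwa [h1, ← pow_two] at h
  have hG2 : G ^ 2 = r₁ * (a + b * ι) := by
    have h := jacobiSum_mul_nontrivial (χ := X) (φ := X) (by rwa [← pow_two]) ψ
    rw [← pow_two, hX, jacobiSum_ringHomComp, hJ, hfJ, ← pow_two] at h
    exact h.symm
  have hG2' : G' ^ 2 = r₁ * (a - b * ι) := by
    have h := jacobiSum_mul_nontrivial (χ := X⁻¹) (φ := X⁻¹) (by rwa [hXi2]) ψ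
    rw [hXi2, ← pow_two, hXi, jacobiSum_ringHomComp, jacobiSum_ringHomComp, hJ, ← hXi] at h
    rw [hG', ← h, starRingEnd_apply, Zsqrtd.star_mk, hfJ]
    push_cast
    ring
  have hGq : G ^ q = -G := hfrob X hX4 hXq
  have hGq' : G' ^ q = -G' := by
    refine hfrob X⁻¹ (by rw [inv_pow, hX4, inv_one]) ?_
    rw [MulChar.inv_apply_eq_inv', hXq, inv_neg, inv_one]
  have hrr₁ : (algebraMap (ZMod q) F r) ^ 2 = r₁ ^ 2 := by
    rw [hr₁2, ← map_pow, hr, map_natCast]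
  rcases sq_eq_sq_iff_eq_or_eq_neg.1 hrr₁ with h | h
  · refine ⟨G + G', ?_, ?_⟩
    · rw [map_mul, map_mul, map_add, h, map_ofNat, map_intCast]
      linear_combination hG2 + hG2' + 2 * hGG' - 2 * hr₁2
    · rw [add_pow_char, hGq, hGq']
      ring
  · refine ⟨ι * (G - G'), ?_, ?_⟩
    · rw [map_mul, map_mul, map_add, h, map_ofNat, map_intCast]
      push_cast at hι2
      linear_combination ι * ι * (hG2 + hG2' - 2 * hGG') + (2 * r₁ * a - 2 * l) * hι2 - 2 * hr₁2
    · rw [mul_pow, sub_pow_char, hGq, hGq', hιq]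
      ring

theorem isSquare_mul_of_not_isSquare {F : Type*} [Field F] [Fintype F] [DecidableEq F] {x y : F}
    (hx : ¬ IsSquare x) (hy : ¬ IsSquare y) : IsSquare (x * y) := by
  have hF : ringChar F ≠ 2 := fun h => hx (FiniteField.isSquare_of_char_two h x)
  have hx0 : x ≠ 0 := by
    rintro rfl
    exact hx IsSquare.zero
  have hy0 : y ≠ 0 := by
    rintro rfl
    exact hy IsSquare.zero
  rw [← quadraticChar_one_iff_isSquare (mul_ne_zero hx0 hy0), map_mul,
    quadraticChar_neg_one_iff_not_isSquare.2 hx, quadraticChar_neg_one_iff_not_isSquare.2 hy]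
  norm_num

/-- If `q ≡ 5 (mod 8)` is a square but not a fourth power modulo `l`, then `2 ε r` is a square
modulo `q`, where `r = ±√l` and `ε = u + v r` has norm `-1`. -/
theorem isSquare_two_mul_unit_mul {l q : ℕ} [Fact l.Prime] [Fact q.Prime] (hl : l % 8 = 1)
    (hq : q % 8 = 5) (hlq : l < q) {u v : ℤ} (hv : Odd v) (hv0 : 0 < v)
    (huv : u ^ 2 + 1 = l * v ^ 2) {g : (ZMod l)ˣ} (hg : ∀ x, x ∈ Subgroup.zpowers g)
    (hgq : (q : ZMod l) = (g : ZMod l) ^ 2) {r : ZMod q} (hr : r ^ 2 = l) :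
    IsSquare (2 * (u + v * r) * r) := by
  obtain ⟨χ, a, b, p, p', hχ, hJ, hab, ha, hu, hvp⟩ :=
    GaussianInt.exists_quarticChar (l := l) (by omega) hv hv0 huv
  have hχ4 : χ ^ 4 = 1 := by rw [← hχ, pow_orderOf_eq_one]
  have hχ2 : χ ^ 2 ≠ 1 := pow_ne_one_of_lt_orderOf two_ne_zero (by rw [hχ]; norm_num)
  have hχq : χ q = -1 := by
    rw [hgq, map_pow, ← MulChar.pow_apply_coe]
    have h2 : ((χ ^ 2) g) ^ 2 = 1 := by
      rw [← MulChar.pow_apply_coe, ← pow_mul, hχ4, MulChar.one_apply_coe]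
    refine (sq_eq_one_iff.1 h2).resolve_left fun h => hχ2 ?_
    ext1 x
    obtain ⟨n, rfl⟩ := Subgroup.mem_zpowers_iff.1 (hg x)
    have h3 : Units.map ((χ ^ 2 : MulChar (ZMod l) GaussianInt) : ZMod l →* GaussianInt) g = 1 :=
      Units.ext h
    have h4 : Units.map ((χ ^ 2 : MulChar (ZMod l) GaussianInt) : ZMod l →* GaussianInt) (g ^ n)
        = 1 := by rw [map_zpow, h3, one_zpow]
    rw [MulChar.one_apply_coe]
    exact congrArg Units.val h4
  obtain ⟨i, hi⟩ := (ZMod.exists_sq_eq_neg_one_iff (p := q)).2 (by omega)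
  have hq2 : q ≠ 2 := by omega
  have hlq0 : (l : ZMod q) ≠ 0 := by
    intro h
    rw [ZMod.natCast_eq_zero_iff] at h
    exact absurd (Nat.le_of_dvd (Fact.out : l.Prime).pos h) (by omega)
  have : NeZero (l : ZMod q) := ⟨hlq0⟩
  obtain ⟨ξ, hξ, hξq⟩ := exists_sq_eq_and_pow_eq_neg hl (by omega) hlq.ne hχ hχq hJ
    (i := i) (by rw [hi, pow_two])
    (IsCyclotomicExtension.zeta_spec l (ZMod q) (CyclotomicField l (ZMod q))) hr
  have hr0 : r ≠ 0 := by
    rintro rfl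
    rw [zero_pow two_ne_zero] at hr
    exact hlq0 hr.symm
  have hmod : ∀ x : ℤ, x ≠ 0 → x ^ 2 ≤ l → (x : ZMod q) ≠ 0 := by
    intro x hx hxl h
    rw [ZMod.intCast_zmod_eq_zero_iff_dvd, ← Int.natAbs_dvd_natAbs, Int.natAbs_natCast] at h
    have h2 := Nat.le_of_dvd (Int.natAbs_pos.2 hx) h
    have h3 : (x.natAbs : ℤ) ^ 2 = x ^ 2 := Int.natAbs_sq x
    have h4 : (q : ℤ) ≤ x.natAbs := by exact_mod_cast h2
    have h5 : (l : ℤ) < q := by exact_mod_cast hlq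
    nlinarith
  have habq : (a : ZMod q) ^ 2 + (b : ZMod q) ^ 2 = r ^ 2 := by
    rw [hr]
    exact_mod_cast congrArg (Int.cast : ℤ → ZMod q) hab
  have hra : r + a ≠ 0 := by
    intro h
    have hb : b ≠ 0 := by
      rintro rfl
      have h2 := Nat.prime_iff_prime_int.1 (Fact.out : l.Prime)
      rw [← hab, zero_pow two_ne_zero, add_zero] at h2
      exact not_prime_pow one_lt_two.ne' h2
    apply hmod b hb (by nlinarith)
    rw [← sq_eq_zero_iff]
    linear_combination habq + (r - a) * h
  have hrb : b + r ≠ 0 := by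
    intro h
    have ha0 : a ≠ 0 := by
      rintro rfl
      simp at ha
    apply hmod a ha0 (by nlinarith)
    rw [← sq_eq_zero_iff]
    linear_combination habq + (r - b) * h
  have hns : ¬ IsSquare (2 * r * (r + a)) := by
    rintro ⟨c, hc⟩
    have h2 : (2 : ZMod q) ≠ 0 := Ring.two_ne_zero (by rwa [ZMod.ringChar_zmod_n])
    have hc0 : c ≠ 0 := by
      rintro rfl
      rw [mul_zero] at hc
      exact mul_ne_zero (mul_ne_zero h2 hr0) hra hc
    rw [hc, ← pow_two, map_pow] at hξ
    have h3 : ξ ^ q = ξ := by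
      rcases sq_eq_sq_iff_eq_or_eq_neg.1 hξ with h | h
      · rw [h, ← map_pow, ZMod.pow_card]
      · rw [h, ← map_neg, ← map_pow, ZMod.pow_card]
    rw [h3] at hξq
    have h4 : algebraMap (ZMod q) (CyclotomicField l (ZMod q)) 2 * ξ = 0 := by
      rw [map_ofNat]
      linear_combination hξq
    have h5 : ξ ≠ 0 := by
      rintro rfl
      rw [zero_pow two_ne_zero, eq_comm, ← map_pow, map_eq_zero] at hξ
      exact pow_ne_zero 2 hc0 hξ
    exact mul_ne_zero ((map_ne_zero _).2 h2) h5 h4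
  have hns2 : ¬ IsSquare (2 : ZMod q) := by
    rw [ZMod.exists_sq_eq_two_iff hq2]
    omega
  obtain ⟨c, hc⟩ := isSquare_mul_of_not_isSquare hns2 hns
  have h2 : (2 : ZMod q) ≠ 0 := Ring.two_ne_zero (by rwa [ZMod.ringChar_zmod_n])
  have h3 : (u + v * r) * (b + r) = (p * (b + r) + p' * a) ^ 2 := by
    rw [hu, hvp]
    push_cast
    linear_combination -p' ^ 2 * habq
  have h4 : 2 * (r + a) * (b + r) = (r + a + b) ^ 2 := by
    linear_combination -habq
  refine ⟨(r + a + b) * (p * (b + r) + p' * a) * c / ((b + r) * (2 * (r + a))), ?_⟩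
  have h5 : (b + r) * (2 * (r + a)) ≠ 0 := mul_ne_zero hrb (mul_ne_zero h2 hra)
  rw [← pow_two, div_pow, eq_div_iff (pow_ne_zero 2 h5), mul_pow _ c, mul_pow (r + a + b) (_ + _),
    ← h3, ← h4, pow_two c, ← hc]
  ring

namespace IsQuadraticConj

theorem index_squares_le {G : Type*} [CommGroup G] (T : Finset G)
    (hT : ∀ g : G, ∃ c ∈ T, ∃ b : G, g = c * b ^ 2) :
    (squares G).index ≤ T.card ∧ (squares G).index ≠ 0 := by
  have hsurj : Function.Surjective (fun c : T => (QuotientGroup.mk (c : G) : G ⧸ squares G)) := by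
    intro x
    obtain ⟨g, rfl⟩ := QuotientGroup.mk_surjective x
    obtain ⟨c, hc, b, rfl⟩ := hT g
    refine ⟨⟨c, hc⟩, QuotientGroup.eq.2 ⟨b, ?_⟩⟩
    rw [powMonoidHom_apply, inv_mul_cancel_left]
  have : Finite (G ⧸ squares G) := Finite.of_surjective _ hsurj
  refine ⟨?_, Subgroup.index_ne_zero_of_finite⟩
  calc (squares G).index = Nat.card (G ⧸ squares G) := rfl
    _ ≤ Nat.card T := Nat.card_le_card_of_surjective _ hsurj
    _ = T.card := by simp

section Dedekind

variable {R S : Type*} [CommRing R] [CommRing S] [Algebra R S] {s : S ≃ₐ[R] S}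
  [IsDedekindDomain S]

theorem eq_of_comap_eq (hs : IsQuadraticConj s) {P Q : Ideal S} (hP : P ∈ ramified R)
    (hQ : Q ∈ ramified R) (h : P.comap (algebraMap R S) = Q.comap (algebraMap R S)) : P = Q := by
  have h1 := hs.eq_or_eq_of_map_le hP.1 hP.2.1 hQ.1 (h ▸ Ideal.map_comap_le)
  rw [hs.map_eq_of_mem_ramified hP, or_self] at h1
  exact h1.symm

/-- The number of ramified primes is bounded by the number of primes below. -/
theorem exists_finset_ramified (hs : IsQuadraticConj s) (T : Finset (Ideal R))
    (hT : ∀ P ∈ ramified (S := S) R, P.comap (algebraMap R S) ∈ T) :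
    ∃ F : Finset (Ideal S), (∀ P, P ∈ F ↔ P ∈ ramified R) ∧ F.card ≤ T.card := by
  have hinj : Set.InjOn (Ideal.comap (algebraMap R S)) (ramified R) :=
    fun P hP Q hQ h => hs.eq_of_comap_eq hP hQ h
  have hfin : (ramified (S := S) R).Finite :=
    Set.Finite.of_injOn hT hinj T.finite_toSet
  refine ⟨hfin.toFinset, fun P => hfin.mem_toFinset, Finset.card_le_card_of_injOn _ ?_
    (by simpa using hinj)⟩
  intro P hP
  exact hT P (by simpa using hP)

/-- The primes containing a given prime number. -/
theorem exists_forall_eq_or_eq {s : S ≃ₐ[ℤ] S} (hs : IsQuadraticConj s) {p : ℕ} (hp : p.Prime) :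
    ∃ P : Ideal S, ∀ Q : Ideal S, Q.IsPrime → (p : S) ∈ Q → Q = P ∨ Q = P.map s := by
  by_cases h : ∃ P : Ideal S, P.IsPrime ∧ (p : S) ∈ P
  · obtain ⟨P, hP, hpP⟩ := h
    have hp0 : (p : S) ≠ 0 := fun h => hp.ne_zero (by
      have := hs.inj (a₁ := (p : ℤ)) (a₂ := 0) (by simpa using h)
      exact_mod_cast this)
    refine ⟨P, fun Q hQ hpQ => hs.eq_or_eq_of_map_le hP
      (fun h0 => hp0 (by simpa [h0] using hpP)) hQ ?_⟩
    have hmax : (Ideal.span {(p : ℤ)}).IsMaximal :=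
      PrincipalIdealRing.isMaximal_of_irreducible (Nat.prime_iff_prime_int.1 hp).irreducible
    have h1 : P.comap (algebraMap ℤ S) = Ideal.span {(p : ℤ)} := by
      refine (hmax.eq_of_le (hP.comap _).ne_top ?_).symm
      rw [Ideal.span_singleton_le_iff_mem, Ideal.mem_comap]
      simpa using hpP
    rw [h1, Ideal.map_span, Set.image_singleton, Ideal.span_singleton_le_iff_mem]
    simpa using hpQ
  · push Not at h
    exact ⟨⊥, fun Q hQ hpQ => absurd hpQ (h Q hQ)⟩

theorem map_eq_of_mem {s : S ≃ₐ[ℤ] S} (hs : IsQuadraticConj s) {p : ℕ} (hp : p.Prime) {r : S}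
    (hr : r ^ 2 = p) (hsr : s r = -r) {P : Ideal S} (hP : P.IsPrime) (hrP : r ∈ P) :
    P.map s = P := by
  have hr0 : r ≠ 0 := by
    rintro rfl
    have := hs.inj (a₁ := (p : ℤ)) (a₂ := 0) (by simpa using hr.symm)
    exact hp.ne_zero (by exact_mod_cast this)
  have hmax : (Ideal.span {(p : ℤ)}).IsMaximal :=
    PrincipalIdealRing.isMaximal_of_irreducible (Nat.prime_iff_prime_int.1 hp).irreducible
  have h1 : P.comap (algebraMap ℤ S) = Ideal.span {(p : ℤ)} := by
    refine (hmax.eq_of_le (hP.comap _).ne_top ?_).symm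
    rw [Ideal.span_singleton_le_iff_mem, Ideal.mem_comap]
    have := P.mul_mem_left r hrP
    rw [← sq, hr] at this
    simpa using this
  have key : ∀ x, ∃ y, s x = x - r * y := by
    intro x
    obtain ⟨m, hm⟩ := hs.exists_trace (r * x)
    have h2 : m ∈ P.comap (algebraMap ℤ S) := by
      rw [Ideal.mem_comap, hm, map_mul, hsr]
      exact P.add_mem (P.mul_mem_right _ hrP) (P.mul_mem_right _ (P.neg_mem hrP))
    rw [h1, Ideal.mem_span_singleton] at h2
    obtain ⟨y, rfl⟩ := h2
    refine ⟨algebraMap ℤ S y, mul_left_cancel₀ hr0 ?_⟩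
    rw [map_mul, map_mul, hsr] at hm
    simp only [eq_intCast, Int.cast_natCast, ← hr] at hm ⊢
    linear_combination hm
  have hle : ∀ x ∈ P, s x ∈ P := by
    intro x hx
    obtain ⟨y, hy⟩ := key x
    rw [hy]
    exact P.sub_mem hx (P.mul_mem_right _ hrP)
  ext x
  rw [hs.mem_map]
  exact ⟨fun h => by simpa [hs.invol] using hle _ h, hle x⟩

end Dedekind

end IsQuadraticConj

namespace IsSqrtExt

theorem isTotallyReal {F E : Type*} [Field F] [Field E] [Algebra F E] {a : F} {s : E}
    [IsTotallyReal F] (h : IsSqrtExt a s) (hpos : ∀ ψ : F →+* ℂ, ∃ r : ℝ, 0 ≤ r ∧ ψ a = r) :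
    IsTotallyReal E := by
  refine ⟨fun w => InfinitePlace.isReal_iff.2 (ComplexEmbedding.isReal_iff.2 ?_)⟩
  set φ := w.embedding
  set ψ : F →+* ℂ := φ.comp (algebraMap F E) with hψ
  have hψr : ComplexEmbedding.conjugate ψ = ψ :=
    ComplexEmbedding.isReal_iff.1
      (InfinitePlace.isReal_of_mk_isReal (IsTotallyReal.isReal (InfinitePlace.mk ψ)))
  have hψr' : ∀ c, starRingEnd ℂ (φ (algebraMap F E c)) = φ (algebraMap F E c) :=
    fun c => congrArg (fun f : F →+* ℂ => f c) hψr
  obtain ⟨r, hr0, hr⟩ := hpos ψ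
  have h1 : φ s = (√r : ℝ) ∨ φ s = -(√r : ℝ) := by
    rw [← sq_eq_sq_iff_eq_or_eq_neg, ← Complex.ofReal_pow, Real.sq_sqrt hr0, ← hr, ← map_pow, h.sq]
    rfl
  have h2 : starRingEnd ℂ (φ s) = φ s := by
    rcases h1 with h1 | h1 <;> rw [h1] <;> simp
  ext x
  obtain ⟨c, d, rfl⟩ := h.exists_eq x
  rw [ComplexEmbedding.conjugate_coe_eq]
  simp only [map_add, map_mul, h2, hψr']

end IsSqrtExt

theorem NumberField.Units.finrank_additive_eq (K : Type*) [Field K] [NumberField K]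
    [IsTotallyReal K] :
    Module.finrank ℤ (Additive (𝓞 K)ˣ) = Module.finrank ℚ K - 1 := by
  rw [Units.finrank_eq, IsTotallyReal.finrank, Units.rank,
    InfinitePlace.card_eq_nrRealPlaces_add_nrComplexPlaces,
    IsTotallyReal.nrComplexPlaces_eq_zero, add_zero]

namespace IsSqrtExt

variable {k : Type*} [Field k] [NumberField k] {l : ℕ} {r : 𝓞 k}

theorem sq_eq_natCast (hk : IsSqrtExt (l : ℚ) (r : k)) : r ^ 2 = l := by
  apply RingOfIntegers.ext
  have := hk.sq
  simpa using this

theorem isTotallyReal_of_nat (hk : IsSqrtExt (l : ℚ) (r : k)) : IsTotallyReal k :=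
  hk.isTotallyReal fun ψ => ⟨l, Nat.cast_nonneg l, by simp⟩

open IsQuadraticConj in
/-- The class number of `ℚ(√l)` is odd. -/
theorem odd_card_classGroup (hk : IsSqrtExt (l : ℚ) (r : k)) (hlp : l.Prime) (hl : l % 8 = 1)
    {s : 𝓞 k ≃ₐ[ℤ] 𝓞 k} (hs : IsQuadraticConj s) (hsr : s r = -r) :
    Odd (Nat.card (ClassGroup (𝓞 k))) := by
  have hr := hk.sq_eq_natCast
  have := hk.isTotallyReal_of_nat
  obtain ⟨ω, hω⟩ : ∃ ω : 𝓞 k, 2 * ω = 1 + r := by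
    have hint : IsIntegral ℤ ((1 + (r : k)) / 2) := by
      obtain ⟨m, hm⟩ : ∃ m : ℕ, l = 1 + 4 * m := ⟨l / 4, by omega⟩
      refine ⟨Polynomial.X ^ 2 - Polynomial.X - Polynomial.C (m : ℤ), ?_, ?_⟩
      · rw [sub_sub, show (Polynomial.X + Polynomial.C (m : ℤ)) = Polynomial.C 1 * Polynomial.X +
          Polynomial.C (m : ℤ) by simp]
        monicity!
      · have h1 : (r : k) ^ 2 = 1 + 4 * m := by
          rw [hk.sq, hm]
          simp
        simp only [Polynomial.eval₂_sub, Polynomial.eval₂_pow, Polynomial.eval₂_X,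
          Polynomial.eval₂_C]
        simp
        linear_combination (1 / 4 : k) * h1
    obtain ⟨ω, hω⟩ : ∃ ω : 𝓞 k, algebraMap (𝓞 k) k ω = (1 + algebraMap (𝓞 k) k r) / 2 :=
      ⟨⟨_, hint⟩, rfl⟩
    refine ⟨ω, FaithfulSMul.algebraMap_injective (𝓞 k) k ?_⟩
    rw [map_mul, map_add, map_one, map_ofNat, hω]
    ring
  have hram : ∀ P ∈ ramified (S := 𝓞 k) ℤ, r ∈ P := by
    intro P hP
    have h1 := hs.sub_mem_of_mem_ramified hP ω
    have h2 : s ω - ω = -r := by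
      have h3 := congrArg s hω
      rw [map_mul, map_add, map_one, hsr, map_ofNat] at h3
      refine mul_left_cancel₀ (two_ne_zero (α := 𝓞 k)) ?_
      linear_combination h3 - hω
    rw [h2, neg_mem_iff] at h1
    exact h1
  obtain ⟨F, hF, hFc⟩ := hs.exists_finset_ramified {Ideal.span {(l : ℤ)}} (by
    intro P hP
    have hmax : (Ideal.span {(l : ℤ)}).IsMaximal :=
      PrincipalIdealRing.isMaximal_of_irreducible (Nat.prime_iff_prime_int.1 hlp).irreducible
    rw [Finset.mem_singleton]
    refine (hmax.eq_of_le (hP.1.comap _).ne_top ?_).symm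
    rw [Ideal.span_singleton_le_iff_mem, Ideal.mem_comap]
    have := P.mul_mem_left r (hram P hP)
    rw [← pow_two, hr] at this
    simpa using this)
  rw [Finset.card_singleton] at hFc
  obtain ⟨hi, hi0⟩ := index_squares_le (G := ℤˣ) {1, -1} (by
    intro g
    refine ⟨g, ?_, 1, by simp⟩
    simpa using Int.units_eq_one_or g)
  have h4 := hs.card_two_torsion_mul_le (h := 1) odd_one (fun c => by
    rw [pow_one]
    exact Subsingleton.elim _ _) hF ⊤ (fun _ _ _ _ _ _ => Subgroup.mem_top _) hi0
  have h5 := hs.two_pow_le_relIndex_sq (n := 1) (m := 0) (by norm_num) (by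
    rw [Units.finrank_additive_eq, hk.finrank_eq_two]) (by
    have : Module.Finite ℤ (Additive ℤˣ) := inferInstance
    rw [Nat.le_zero]
    exact Module.finrank_eq_zero_of_rank_eq_zero (by
      rw [rank_eq_zero_iff]
      intro x
      refine ⟨2, two_ne_zero, ?_⟩
      rcases Int.units_eq_one_or x.toMul with h | h
      · rw [show x = 0 from h, smul_zero]
      · rw [show x = Additive.ofMul (-1) from h, ← ofMul_zpow]
        rfl))
  rw [Subgroup.index_top, mul_one] at h4
  have hc2 : ({1, -1} : Finset ℤˣ).card = 2 := by decide
  have h6 : 2 ^ F.card ≤ 2 ^ 1 := Nat.pow_le_pow_right two_pos hFc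
  have h7 : Nat.card {c : ClassGroup (𝓞 k) // c ^ 2 = 1} ≤ 1 := by
    have h8 : 2 ^ F.card * (squares ℤˣ).index ≤ 2 * 2 :=
      Nat.mul_le_mul (by simpa using h6) (by omega)
    have h9 := (Nat.mul_le_mul_left _ h5).trans (h4.trans h8)
    omega
  rw [Nat.odd_iff, ← Nat.not_even_iff, even_iff_two_dvd]
  intro h2
  have : Fact (Nat.Prime 2) := ⟨Nat.prime_two⟩
  obtain ⟨c, hc⟩ := exists_prime_orderOf_dvd_card' 2 h2
  have h9 : c ≠ 1 := by
    rintro rfl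
    simp at hc
  have h10 := Finite.card_le_one_iff_subsingleton.1 h7
  have h11 := h10.elim ⟨c, by rw [← hc, pow_orderOf_eq_one]⟩ ⟨1, one_pow 2⟩
  exact h9 (congrArg Subtype.val h11)

end IsSqrtExt

namespace IsSqrtExt

variable {k : Type*} [Field k] [NumberField k] {l : ℕ} {r : 𝓞 k}

open IsQuadraticConj in
theorem card_two_torsion_mul_index_le (hk : IsSqrtExt (l : ℚ) (r : k)) (hlp : l.Prime)
    (hl : l % 8 = 1) {s : 𝓞 k ≃ₐ[ℤ] 𝓞 k} (hs : IsQuadraticConj s) (hsr : s r = -r)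
    {ε : (𝓞 k)ˣ} {u v : ℤ} (hv0 : 0 < v) (huv : u ^ 2 + 1 = l * v ^ 2) (hε : (ε : 𝓞 k) = u + v * r)
    (hunits : ∀ η : (𝓞 k)ˣ, ∃ j : ℤ, η = ε ^ j ∨ η = -ε ^ j)
    {K : Type*} [Field K] [NumberField K] [Algebra k K] {δ : 𝓞 K}
    (hK : IsSqrtExt (2 * algebraMap (𝓞 k) k (r * ε)) (algebraMap (𝓞 K) K δ))
    {s' : 𝓞 K ≃ₐ[𝓞 k] 𝓞 K} (hs' : IsQuadraticConj s') (hδ : s' δ = -δ) (U : Subgroup (𝓞 k)ˣ)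
    (hU : ∀ (η : (𝓞 k)ˣ) (x y : 𝓞 K), x ≠ 0 → y ≠ 0 → hs'.norm y = η * hs'.norm x → η ∈ U) :
    Nat.card {c : ClassGroup (𝓞 K) // c ^ 2 = 1} * U.index ≤ 4 := by
  have hr := hk.sq_eq_natCast
  have hkr := hk.isTotallyReal_of_nat
  have hKr : IsTotallyReal K := hK.isTotallyReal fun ψ => by
    have h1 : ψ (algebraMap (𝓞 k) k r) ^ 2 = l := by
      rw [← map_pow, ← map_pow, hr, map_natCast, map_natCast]
    have h2 : ψ (algebraMap (𝓞 k) k r) = (√(l : ℝ) : ℝ) ∨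
        ψ (algebraMap (𝓞 k) k r) = (-√(l : ℝ) : ℝ) := by
      rw [Complex.ofReal_neg, ← sq_eq_sq_iff_eq_or_eq_neg, h1, ← Complex.ofReal_pow,
        Real.sq_sqrt (Nat.cast_nonneg l), Complex.ofReal_natCast]
    obtain ⟨ρ, hρ, hρ2⟩ : ∃ ρ : ℝ, ψ (algebraMap (𝓞 k) k r) = ρ ∧ ρ ^ 2 = l := by
      rcases h2 with h | h
      · exact ⟨_, h, Real.sq_sqrt (Nat.cast_nonneg l)⟩
      · exact ⟨_, h, by rw [neg_sq, Real.sq_sqrt (Nat.cast_nonneg l)]⟩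
    refine ⟨2 * (ρ * (u + v * ρ)), ?_, ?_⟩
    · have h3 : |u * ρ| ≤ l * v := by
        apply abs_le_of_sq_le_sq
        · have : (u : ℝ) ^ 2 + 1 = l * v ^ 2 := by exact_mod_cast huv
          have hl0 : (0 : ℝ) ≤ l := Nat.cast_nonneg l
          nlinarith
        · have : (0 : ℝ) < v := by exact_mod_cast hv0
          positivity
      have h4 := (abs_le.1 h3).1
      have : ρ * (u + v * ρ) = u * ρ + l * v := by rw [← hρ2]; ring
      rw [this]
      linarith
    · rw [map_mul, map_ofNat, map_mul, map_mul, hε, map_add, map_mul, map_add, map_mul, hρ,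
        map_intCast, map_intCast, map_intCast, map_intCast]
      push_cast
      ring
  obtain ⟨p₂, hp₂⟩ := hs.exists_forall_eq_or_eq Nat.prime_two
  obtain ⟨pr, hpr⟩ := hs.exists_forall_eq_or_eq hlp
  have hδ2 : δ ^ 2 = algebraMap (𝓞 k) (𝓞 K) (2 * (r * ε)) := by
    apply FaithfulSMul.algebraMap_injective (𝓞 K) K
    rw [map_pow, hK.sq, ← IsScalarTower.algebraMap_apply (𝓞 k) (𝓞 K) K,
      IsScalarTower.algebraMap_apply (𝓞 k) k K, map_mul (algebraMap (𝓞 k) k) 2,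
      map_ofNat]
  classical
  obtain ⟨F, hF, hFc⟩ := hs'.exists_finset_ramified {p₂, p₂.map s, pr} (by
    intro P hP
    have h1 := hs'.sub_mem_of_mem_ramified hP δ
    rw [hδ, show -δ - δ = -(2 * δ) by ring, neg_mem_iff] at h1
    have hp := hP.1.comap (algebraMap (𝓞 k) (𝓞 K))
    have h2 : 2 ^ 2 * (2 * (r * ε)) ∈ P.comap (algebraMap (𝓞 k) (𝓞 K)) := by
      rw [Ideal.mem_comap, map_mul, ← hδ2, map_pow, map_ofNat, ← mul_pow]
      exact P.pow_mem_of_mem h1 2 two_pos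
    have h3 : ((2 : ℕ) : 𝓞 k) ∈ P.comap (algebraMap (𝓞 k) (𝓞 K)) ∨
        r ∈ P.comap (algebraMap (𝓞 k) (𝓞 K)) := by
      rw [Nat.cast_ofNat]
      rcases hp.mem_or_mem h2 with h | h
      · exact Or.inl (hp.mem_of_pow_mem 2 h)
      rcases hp.mem_or_mem h with h | h
      · exact Or.inl h
      rcases hp.mem_or_mem h with h | h
      · exact Or.inr h
      · exact absurd (Ideal.eq_top_of_isUnit_mem _ h ε.isUnit) hp.ne_top
    rw [Finset.mem_insert, Finset.mem_insert, Finset.mem_singleton]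
    rcases h3 with h | h
    · rcases hp₂ _ hp h with h | h
      · exact Or.inl h
      · exact Or.inr (Or.inl h)
    · have h4 : (l : 𝓞 k) ∈ P.comap (algebraMap (𝓞 k) (𝓞 K)) := by
        rw [← hr]
        exact Ideal.pow_mem_of_mem _ h 2 two_pos
      have h5 := hs.map_eq_of_mem hlp hr hsr hp h
      rcases hpr _ hp h4 with h | h
      · exact Or.inr (Or.inr h)
      · rw [h, hs.map_map] at h5
        exact Or.inr (Or.inr (h.trans h5.symm)))
  obtain ⟨hi, hi0⟩ := index_squares_le (G := (𝓞 k)ˣ) {1, -1, ε, -ε} (by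
    intro g
    obtain ⟨j, hj⟩ := hunits g
    obtain ⟨m, hm | hm⟩ := Int.even_or_odd' j
    · rcases hj with rfl | rfl
      · exact ⟨1, by simp, ε ^ m, by rw [hm, one_mul, mul_comm, zpow_mul]; norm_cast⟩
      · exact ⟨-1, by simp, ε ^ m, by rw [hm, neg_one_mul, mul_comm, zpow_mul]; norm_cast⟩
    · have h1 : ε ^ j = ε * (ε ^ m) ^ 2 := by
        rw [hm, zpow_add_one, mul_comm, mul_comm 2 m, zpow_mul]
        norm_cast
      rcases hj with rfl | rfl
      · exact ⟨ε, by simp, ε ^ m, h1⟩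
      · exact ⟨-ε, by simp, ε ^ m, by rw [h1, neg_mul]⟩)
  have hodd := hk.odd_card_classGroup hlp hl hs hsr
  have h4 := hs'.card_two_torsion_mul_le hodd (fun c => pow_card_eq_one') hF U hU hi0
  have h5 := hs'.two_pow_le_relIndex_sq (n := 3) (m := 1) (by norm_num) (by
    have := Module.finrank_mul_finrank ℚ k K
    rw [Units.finrank_additive_eq, ← this, hk.finrank_eq_two, hK.finrank_eq_two]) (by
    rw [Units.finrank_additive_eq, hk.finrank_eq_two])
  have h6 : 2 ^ F.card ≤ 2 ^ 3 := Nat.pow_le_pow_right two_pos (hFc.trans Finset.card_le_three)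
  have h7 := hi.trans Finset.card_le_four
  have h8 : 2 ^ F.card * (squares (𝓞 k)ˣ).index ≤ 2 ^ 3 * 4 := Nat.mul_le_mul h6 h7
  have h9 := h4.trans h8
  rw [mul_right_comm] at h9
  have h10 := (Nat.mul_le_mul_left _ h5).trans h9
  omega

end IsSqrtExt

theorem PadicInt.zmod_cast_isUnit {z : ℤ_[2]} (h : IsUnit (toZModPow 3 z)) : IsUnit z := by
  by_contra hz
  have h2 : z ∈ IsLocalRing.maximalIdeal ℤ_[2] := hz
  rw [PadicInt.maximalIdeal_eq_span_p, Nat.cast_ofNat] at h2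
  obtain ⟨e, rfl⟩ := Ideal.mem_span_singleton.1 h2
  have h3 : ∀ w : ZMod (2 ^ 3), ¬ IsUnit (2 * w) := by decide
  rw [map_mul, map_ofNat] at h
  exact h3 _ h

theorem PadicInt.toZModPow_three_of_sq_eq {z : ℤ_[2]} (h : toZModPow 4 (z ^ 2) = 1) :
    toZModPow 3 z = 1 ∨ toZModPow 3 z = -1 := by
  have h1 : toZModPow 3 z = ZMod.castHom (pow_dvd_pow 2 (by norm_num : 3 ≤ 4)) (ZMod (2 ^ 3))
      (toZModPow 4 z) :=
    (congrArg (fun f : ℤ_[2] →+* ZMod (2 ^ 3) => f z)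
      (zmod_cast_comp_toZModPow 3 4 (by norm_num))).symm
  have key : ∀ w : ZMod (2 ^ 4), w ^ 2 = 1 →
      ZMod.castHom (pow_dvd_pow 2 (by norm_num : 3 ≤ 4)) (ZMod (2 ^ 3)) w = 1 ∨
      ZMod.castHom (pow_dvd_pow 2 (by norm_num : 3 ≤ 4)) (ZMod (2 ^ 3)) w = -1 := by decide
  rw [h1]
  exact key _ (by rw [← map_pow, h])

/-- A residue map modulo `8` sees norms when unit values of norms are `±1`. -/
def IsQuadraticConj.NormsPlusMinusOne {R S : Type*} [CommRing R] [CommRing S] [Algebra R S]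
    {s : S ≃ₐ[R] S} (hs : IsQuadraticConj s) (j : R →+* ZMod (2 ^ 3)) : Prop :=
  ∀ (c : R) (x y : S), x ≠ 0 → hs.norm y = c * hs.norm x → IsUnit (j c) → j c = 1 ∨ j c = -1

/-- The residue map detects a proper subgroup of units. -/
theorem IsQuadraticConj.exists_subgroup_two_le_index {k : Type*} [Field k] {K : Type*} [Field K]
    [Algebra k K] {s' : 𝓞 K ≃ₐ[𝓞 k] 𝓞 K} (hs' : IsQuadraticConj s') {j : 𝓞 k →+* ZMod (2 ^ 3)}
    (hj : hs'.NormsPlusMinusOne j) {ε : (𝓞 k)ˣ} (hε : ¬ (j ε = 1 ∨ j ε = -1)) :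
    ∃ U : Subgroup (𝓞 k)ˣ, 2 ≤ U.index ∧ ∀ (η : (𝓞 k)ˣ) (x y : 𝓞 K), x ≠ 0 → y ≠ 0 →
      hs'.norm y = η * hs'.norm x → η ∈ U := by
  have hmem : ∀ η : (𝓞 k)ˣ, η ∈ (Subgroup.zpowers (-1 : (ZMod (2 ^ 3))ˣ)).comap
      (Units.map (j : 𝓞 k →* ZMod (2 ^ 3))) ↔ (j η = 1 ∨ j η = -1) := by
    intro η
    rw [Subgroup.mem_comap]
    constructor
    · rintro ⟨m, hm⟩
      have h1 := congrArg Units.val hm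
      change ((-1 : (ZMod (2 ^ 3))ˣ) ^ m : (ZMod (2 ^ 3))ˣ).1 = j η at h1
      rw [← h1]
      rcases Int.even_or_odd m with h | h
      · left
        rw [h.neg_one_zpow, Units.val_one]
      · right
        rw [h.neg_one_zpow, Units.val_neg, Units.val_one]
    · rintro (h | h)
      · convert Subgroup.one_mem _
        exact Units.ext h
      · convert Subgroup.mem_zpowers (-1 : (ZMod (2 ^ 3))ˣ)
        exact Units.ext h
  refine ⟨_, ?_, fun η x y hx _ hxy => (hmem η).2 (hj η x y hx hxy (η.isUnit.map j))⟩
  have h0 : ((Subgroup.zpowers (-1 : (ZMod (2 ^ 3))ˣ)).comap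
      (Units.map (j : 𝓞 k →* ZMod (2 ^ 3)))).index ≠ 0 := by
    rw [Subgroup.index_comap]
    exact Subgroup.index_ne_zero_of_finite
  have h1 : ((Subgroup.zpowers (-1 : (ZMod (2 ^ 3))ˣ)).comap
      (Units.map (j : 𝓞 k →* ZMod (2 ^ 3)))).index ≠ 1 := by
    intro h
    rw [Subgroup.index_eq_one] at h
    exact hε ((hmem ε).1 (h ▸ Subgroup.mem_top ε))
  omega

namespace IsSqrtExt

variable {k : Type*} [Field k] [NumberField k] {l : ℕ} {r : 𝓞 k}

theorem exists_ringHom_zmod (hk : IsSqrtExt (l : ℚ) (r : k)) (hl : l % 8 = 1)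
    {τ : k ≃ₐ[ℚ] k} {s : 𝓞 k ≃ₐ[ℤ] 𝓞 k}
    (hτ : ∀ x : 𝓞 k, algebraMap (𝓞 k) k (s x) = τ (algebraMap (𝓞 k) k x))
    {ε : (𝓞 k)ˣ} {u v : ℤ} (hv4 : v % 4 = 1) (huv : u ^ 2 + 1 = l * v ^ 2) (hu4 : 4 ∣ u)
    (hε : (ε : 𝓞 k) = u + v * r)
    {K : Type*} [Field K] [NumberField K] [Algebra k K] {δ : 𝓞 K}
    (hK : IsSqrtExt (2 * algebraMap (𝓞 k) k (r * ε)) (algebraMap (𝓞 K) K δ))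
    {σ : K ≃ₐ[k] K} (hσ : σ (algebraMap (𝓞 K) K δ) = -algebraMap (𝓞 K) K δ)
    (hs' : IsQuadraticConj (galRestrict (𝓞 k) k K (𝓞 K) σ)) :
    ∃ j : 𝓞 k →+* ZMod (2 ^ 3), hs'.NormsPlusMinusOne j ∧ hs'.NormsPlusMinusOne (j.comp s) ∧
      ((j ε = 1 ∨ j ε = -1) ↔ 8 ∣ u) := by
  have hr := hk.sq_eq_natCast
  have hu8 : u % 8 = 0 ∨ u % 8 = 4 := by omega
  have huz : ((u : ZMod (2 ^ 3)) = 0 ∧ 8 ∣ u) ∨ ((u : ZMod (2 ^ 3)) = 4 ∧ ¬ 8 ∣ u) := by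
    rcases hu8 with h | h
    · left
      refine ⟨?_, by omega⟩
      rw [show (0 : ZMod (2 ^ 3)) = ((0 : ℤ) : ZMod (2 ^ 3)) by simp]
      exact (ZMod.intCast_eq_intCast_iff u 0 (2 ^ 3)).2 (by change u % 8 = 0 % 8; omega)
    · right
      refine ⟨?_, by omega⟩
      rw [show (4 : ZMod (2 ^ 3)) = ((4 : ℤ) : ZMod (2 ^ 3)) by simp]
      exact (ZMod.intCast_eq_intCast_iff u 4 (2 ^ 3)).2 (by change u % 8 = 4 % 8; omega)
  have hvz : (v : ZMod (2 ^ 3)) = 1 ∨ (v : ZMod (2 ^ 3)) = 5 := by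
    have hv8 : v % 8 = 1 ∨ v % 8 = 5 := by omega
    rcases hv8 with h | h
    · left
      rw [show (1 : ZMod (2 ^ 3)) = ((1 : ℤ) : ZMod (2 ^ 3)) by simp]
      exact (ZMod.intCast_eq_intCast_iff v 1 (2 ^ 3)).2 (by change v % 8 = 1 % 8; omega)
    · right
      rw [show (5 : ZMod (2 ^ 3)) = ((5 : ℤ) : ZMod (2 ^ 3)) by simp]
      exact (ZMod.intCast_eq_intCast_iff v 5 (2 ^ 3)).2 (by change v % 8 = 5 % 8; omega)
  have hlz : (l : ZMod (2 ^ 3)) = 1 := by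
    rw [show (1 : ZMod (2 ^ 3)) = ((1 : ℕ) : ZMod (2 ^ 3)) by simp]
    exact (ZMod.natCast_eq_natCast_iff l 1 (2 ^ 3)).2 (by change l % 8 = 1 % 8; omega)
  have hgood : ∀ (f : k →ₐ[ℚ] ℚ_[2]) (j : 𝓞 k →+* ℤ_[2]),
      (∀ x : 𝓞 k, (j x : ℚ_[2]) = f (algebraMap (𝓞 k) k x)) →
      hs'.NormsPlusMinusOne ((PadicInt.toZModPow 3).comp j) := by
    intro f j hj c x y hx hxy hc
    refine toZModPow_three_eq hK hσ hs' hj (e := j (r * ε)) (hj _).symm ?_ hx hxy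
      (PadicInt.zmod_cast_isUnit hc)
    have h1 : r * (ε : 𝓞 k) = u * r + l * v := by
      rw [hε, ← hr]
      ring
    have h2 : PadicInt.toZModPow 3 (j r) ^ 2 = 1 := by
      rw [← map_pow, ← map_pow, hr, map_natCast, map_natCast, hlz]
    rw [h1, map_add, map_mul, map_mul, map_intCast, map_intCast, map_natCast, map_add, map_mul,
      map_mul, map_intCast, map_intCast, map_natCast, hlz]
    have key : ∀ U V T : ZMod (2 ^ 3), (U = 0 ∨ U = 4) → (V = 1 ∨ V = 5) → T ^ 2 = 1 →
        U * T + 1 * V = 1 ∨ U * T + 1 * V = 5 := by decide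
    exact key _ _ _ (huz.imp And.left And.left) hvz h2
  obtain ⟨t, ht⟩ := PadicInt.exists_sq_eq_natCast hl
  obtain ⟨f, j, -, hj⟩ := hk.exists_ringHom_padicInt (t := t) (by
    rw [← PadicInt.coe_pow, ht]
    simp)
  refine ⟨(PadicInt.toZModPow 3).comp j, hgood f j hj, ?_, ?_⟩
  · exact hgood (f.comp τ.toAlgHom) (j.comp s) fun x => by
      change ((j (s x) : ℤ_[2]) : ℚ_[2]) = f (τ (algebraMap (𝓞 k) k x))
      rw [← hτ]
      exact hj _
  · have h1 : PadicInt.toZModPow 3 ((v : ℤ_[2]) * j r) = 1 ∨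
        PadicInt.toZModPow 3 ((v : ℤ_[2]) * j r) = -1 := by
      apply PadicInt.toZModPow_three_of_sq_eq
      have h2 : ((v : ℤ_[2]) * j r) ^ 2 = ((u ^ 2 + 1 : ℤ) : ℤ_[2]) := by
        rw [mul_pow, ← map_pow, hr, map_natCast, huv]
        push_cast
        ring
      rw [h2, map_intCast, show (1 : ZMod (2 ^ 4)) = ((1 : ℤ) : ZMod (2 ^ 4)) by simp]
      obtain ⟨m, rfl⟩ := hu4
      exact (ZMod.intCast_eq_intCast_iff _ 1 (2 ^ 4)).2
        ((Int.modEq_iff_dvd.2 ⟨m ^ 2, by push_cast; ring⟩).symm)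
    have h3 : ((PadicInt.toZModPow 3).comp j) ε = u + PadicInt.toZModPow 3 ((v : ℤ_[2]) * j r) := by
      change PadicInt.toZModPow 3 (j ε) = _
      rw [hε, map_add, map_mul, map_intCast, map_intCast, map_add, map_intCast]
    rw [h3]
    have hdec : (1 : ZMod (2 ^ 3)) ≠ -1 ∧ (4 + 1 : ZMod (2 ^ 3)) ≠ 1 ∧ (4 + 1 : ZMod (2 ^ 3)) ≠ -1 ∧
      (4 + -1 : ZMod (2 ^ 3)) ≠ 1 ∧ (4 + -1 : ZMod (2 ^ 3)) ≠ -1 := by decide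
    obtain ⟨-, d1, d2, d3, d4⟩ := hdec
    rcases huz with ⟨h, h'⟩ | ⟨h, h'⟩
    · rw [h, zero_add]
      exact iff_of_true h1 h'
    · refine iff_of_false ?_ h'
      rw [h]
      rcases h1 with h1 | h1 <;> rw [h1] <;> rintro (h | h) <;> contradiction

end IsSqrtExt

namespace IsSqrtExt

variable {k : Type*} [Field k] [NumberField k] {l : ℕ} {r : 𝓞 k}

theorem natCast_mem_iff {S : Type*} [CommRing S] {q : ℕ} (hq : q.Prime) {P : Ideal S}
    (hP : P.IsPrime) (hqP : (q : S) ∈ P) (m : ℤ) : (m : S) ∈ P ↔ (q : ℤ) ∣ m := by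
  have hmax : (Ideal.span {(q : ℤ)}).IsMaximal :=
    PrincipalIdealRing.isMaximal_of_irreducible (Nat.prime_iff_prime_int.1 hq).irreducible
  have h1 : P.comap (algebraMap ℤ S) = Ideal.span {(q : ℤ)} := by
    refine (hmax.eq_of_le (hP.comap _).ne_top ?_).symm
    rw [Ideal.span_singleton_le_iff_mem, Ideal.mem_comap]
    simpa using hqP
  rw [← Ideal.mem_span_singleton, ← h1, Ideal.mem_comap, eq_intCast]

/-- Splitting of primes over a rational prime `q` that splits completely. -/
theorem mul_map_eq_of_mem (hr : r ^ 2 = l)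
    {s : 𝓞 k ≃ₐ[ℤ] 𝓞 k} (hs : IsQuadraticConj s) (hsr : s r = -r)
    {ε : (𝓞 k)ˣ} {u v : ℤ} (huv : u ^ 2 + 1 = l * v ^ 2) (hε : (ε : 𝓞 k) = u + v * r)
    {K : Type*} [Field K] [NumberField K] [Algebra k K] {δ : 𝓞 K}
    (hδ2 : δ ^ 2 = algebraMap (𝓞 k) (𝓞 K) (2 * (r * ε)))
    {s' : 𝓞 K ≃ₐ[𝓞 k] 𝓞 K} (hs' : IsQuadraticConj s') (hδ : s' δ = -δ)
    {q : ℕ} [Fact q.Prime] (hq2 : (2 : ZMod q) ≠ 0) (hql : (l : ZMod q) ≠ 0)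
    (hlq : IsSquare (l : ZMod q))
    (hq : ∀ ρ : ZMod q, ρ ^ 2 = l → IsSquare (2 * (u + v * ρ) * ρ))
    {Q : Ideal (𝓞 K)} (hQ : Q.IsPrime) (hqQ : (q : 𝓞 K) ∈ Q) :
    Q * Q.map s' = (Q.comap (algebraMap (𝓞 k) (𝓞 K))).map (algebraMap (𝓞 k) (𝓞 K)) ∧
      Q.comap (algebraMap (𝓞 k) (𝓞 K)) * (Q.comap (algebraMap (𝓞 k) (𝓞 K))).map s =
        Ideal.span {(q : 𝓞 k)} := by
  have hqp : q.Prime := Fact.out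
  set p := Q.comap (algebraMap (𝓞 k) (𝓞 K)) with hp_def
  have hp : p.IsPrime := hQ.comap _
  have hqp' : (q : 𝓞 k) ∈ p := by
    rw [hp_def, Ideal.mem_comap, map_natCast]
    exact hqQ
  have hmem := natCast_mem_iff hqp hp hqp'
  have hzero : ∀ m : ℤ, (m : 𝓞 k) ∈ p ↔ (m : ZMod q) = 0 := fun m => by
    rw [hmem, ZMod.intCast_zmod_eq_zero_iff_dvd]
  have hQ0 : Q ≠ ⊥ := by
    rintro rfl
    rw [Ideal.mem_bot, Nat.cast_eq_zero] at hqQ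
    exact hqp.ne_zero hqQ
  have hp0 : p ≠ ⊥ := by
    intro h
    rw [h, Ideal.mem_bot, Nat.cast_eq_zero] at hqp'
    exact hqp.ne_zero hqp'
  obtain ⟨R, hR, hrR⟩ : ∃ R : ℤ, (R : ZMod q) ^ 2 = l ∧ r - (R : 𝓞 k) ∈ p := by
    obtain ⟨ρ, hρ⟩ := hlq
    obtain ⟨R, rfl⟩ := ZMod.intCast_surjective ρ
    have h1 : (r - (R : 𝓞 k)) * (r - ((-R : ℤ) : 𝓞 k)) ∈ p := by
      have h2 : (r - (R : 𝓞 k)) * (r - ((-R : ℤ) : 𝓞 k)) = ((l - R * R : ℤ) : 𝓞 k) := by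
        push_cast
        linear_combination hr
      rw [h2, hzero]
      push_cast
      rw [hρ, sub_self]
    rcases hp.mem_or_mem h1 with h | h
    · exact ⟨R, by rw [hρ, pow_two], h⟩
    · exact ⟨-R, by push_cast; rw [hρ, neg_sq, pow_two], h⟩
  have hR0 : (R : ZMod q) ≠ 0 := by
    intro h
    rw [h] at hR
    exact hql (by rw [← hR, zero_pow two_ne_zero])
  have hRe : (u + v * R : ZMod q) ≠ 0 := by
    intro h
    have h1 := congrArg (Int.cast : ℤ → ZMod q) huv
    push_cast at h1
    have : (1 : ZMod q) = 0 := by linear_combination h1 - (u - v * R) * h - (v : ZMod q) ^ 2 * hR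
    exact one_ne_zero this
  constructor
  · obtain ⟨ρ, hρ⟩ := hq R hR
    obtain ⟨T, rfl⟩ := ZMod.intCast_surjective ρ
    have hT0 : (T : ZMod q) ≠ 0 := by
      intro h
      rw [h, mul_zero] at hρ
      exact mul_ne_zero (mul_ne_zero hq2 hRe) hR0 hρ
    have h1 : 2 * (r * (ε : 𝓞 k)) - (T : 𝓞 k) ^ 2 ∈ p := by
      have h2 : 2 * (r * (ε : 𝓞 k)) - (T : 𝓞 k) ^ 2 =
          (r - R) * (2 * (u + v * (r + R))) + ((2 * (u + v * R) * R - T * T : ℤ) : 𝓞 k) := by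
        rw [hε]
        push_cast
        ring
      rw [h2]
      refine p.add_mem (p.mul_mem_right _ hrR) ?_
      rw [hzero]
      push_cast
      rw [hρ, sub_self]
    have h3 : (δ - algebraMap (𝓞 k) (𝓞 K) (T : 𝓞 k)) *
        (δ - algebraMap (𝓞 k) (𝓞 K) ((-T : ℤ) : 𝓞 k)) ∈ Q := by
      have h4 : (δ - algebraMap (𝓞 k) (𝓞 K) (T : 𝓞 k)) *
          (δ - algebraMap (𝓞 k) (𝓞 K) ((-T : ℤ) : 𝓞 k)) =
          algebraMap (𝓞 k) (𝓞 K) (2 * (r * (ε : 𝓞 k)) - (T : 𝓞 k) ^ 2) := by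
        rw [map_sub, ← hδ2, Int.cast_neg, map_neg, map_pow]
        ring
      rw [h4]
      exact h1
    have h5 : ∀ T' : ℤ, (T' : ZMod q) ≠ 0 →
        algebraMap (𝓞 k) (𝓞 K) (2 * (T' : 𝓞 k)) ∉ Q := by
      intro T' hT' h
      have h6 : ((2 * T' : ℤ) : 𝓞 k) ∈ p := by
        push_cast
        exact h
      rw [hzero] at h6
      push_cast at h6
      exact mul_ne_zero hq2 hT' h6
    rcases hQ.mem_or_mem h3 with h | h
    · exact hs'.mul_map_eq_map_comap hQ hQ0 hδ h (h5 T hT0)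
    · exact hs'.mul_map_eq_map_comap hQ hQ0 hδ h (h5 (-T) (by
        push_cast
        exact neg_ne_zero.2 hT0))
  · have h1 := hs.mul_map_eq_map_comap hp hp0 hsr (t := R) (by simpa using hrR) (by
      rw [eq_intCast, hzero]
      push_cast
      exact mul_ne_zero hq2 hR0)
    have hmax : (Ideal.span {(q : ℤ)}).IsMaximal :=
      PrincipalIdealRing.isMaximal_of_irreducible (Nat.prime_iff_prime_int.1 hqp).irreducible
    have h2 : p.comap (algebraMap ℤ (𝓞 k)) = Ideal.span {(q : ℤ)} := by
      ext m
      rw [Ideal.mem_comap, eq_intCast, hmem, Ideal.mem_span_singleton]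
    rw [h1, h2, Ideal.map_span, Set.image_singleton]
    simp

open IsQuadraticConj in
theorem le_card_two_torsion (hk : IsSqrtExt (l : ℚ) (r : k)) (hlp : l.Prime)
    (hl : l % 8 = 1) {s : 𝓞 k ≃ₐ[ℤ] 𝓞 k} (hs : IsQuadraticConj s) (hsr : s r = -r)
    {ε : (𝓞 k)ˣ} {u v : ℤ} (huv : u ^ 2 + 1 = l * v ^ 2)
    (hε : (ε : 𝓞 k) = u + v * r)
    (hunits : ∀ η : (𝓞 k)ˣ, ∃ j : ℤ, η = ε ^ j ∨ η = -ε ^ j)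
    {K : Type*} [Field K] [NumberField K] [Algebra k K] {δ : 𝓞 K}
    (hδ2 : δ ^ 2 = algebraMap (𝓞 k) (𝓞 K) (2 * (r * ε)))
    {s' : 𝓞 K ≃ₐ[𝓞 k] 𝓞 K} (hs' : IsQuadraticConj s') (hδ : s' δ = -δ)
    {q : ℕ} [Fact q.Prime] (hq8 : q % 8 = 5) (hql : (l : ZMod q) ≠ 0)
    (hlq : IsSquare (l : ZMod q))
    (hq : ∀ ρ : ZMod q, ρ ^ 2 = l → IsSquare (2 * (u + v * ρ) * ρ))
    {j : 𝓞 k →+* ZMod (2 ^ 3)} (hj : hs'.NormsPlusMinusOne j)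
    (hjs : hs'.NormsPlusMinusOne (j.comp s)) :
    2 ≤ Nat.card {c : ClassGroup (𝓞 K) // c ^ 2 = 1} ∧
      ((j ε = 1 ∨ j ε = -1) → 4 ≤ Nat.card {c : ClassGroup (𝓞 K) // c ^ 2 = 1}) := by
  have hqp : q.Prime := Fact.out
  have hq2 : (2 : ZMod q) ≠ 0 := by
    intro h
    have h1 := (ZMod.natCast_eq_zero_iff 2 q).1 (by exact_mod_cast h)
    have := (Nat.prime_dvd_prime_iff_eq hqp Nat.prime_two).1 h1
    omega
  have hsplit := fun (Q : Ideal (𝓞 K)) (hQ : Q.IsPrime) (hqQ : (q : 𝓞 K) ∈ Q) =>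
    mul_map_eq_of_mem hk.sq_eq_natCast hs hsr huv hε hδ2 hs' hδ hq2 hql hlq hq hQ hqQ
  have hodd := hk.odd_card_classGroup hlp hl hs hsr
  set h := Nat.card (ClassGroup (𝓞 k)) with hh_def
  have hh : ∀ c : ClassGroup (𝓞 k), c ^ h = 1 := fun c => pow_card_eq_one'
  have hqj : (q : ZMod (2 ^ 3)) ^ h = 5 := by
    have h1 : (q : ZMod (2 ^ 3)) = 5 := by
      rw [show (5 : ZMod (2 ^ 3)) = ((5 : ℕ) : ZMod (2 ^ 3)) by simp]
      exact (ZMod.natCast_eq_natCast_iff q 5 (2 ^ 3)).2 (by change q % 8 = 5 % 8; omega)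
    obtain ⟨m, hm⟩ := hodd
    rw [h1, hm, pow_succ (5 : ZMod (2 ^ 3)), pow_mul (5 : ZMod (2 ^ 3)),
      show (5 : ZMod (2 ^ 3)) ^ 2 = 1 by decide, one_pow, one_mul]
  have hbot : ∀ Q : Ideal (𝓞 K), (q : 𝓞 K) ∈ Q → Q ≠ ⊥ := by
    rintro Q hqQ rfl
    rw [Ideal.mem_bot, Nat.cast_eq_zero] at hqQ
    exact hqp.ne_zero hqQ
  have hsingle : ∀ Q : Ideal (𝓞 K), Q.IsPrime → (q : 𝓞 K) ∈ Q →
      idealClass Q ∉ squares (ClassGroup (𝓞 K)) := by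
    intro Q hQ hqQ hsq
    obtain ⟨h1, h2⟩ := hsplit Q hQ hqQ
    have hp0 : Q.comap (algebraMap (𝓞 k) (𝓞 K)) ≠ ⊥ := by
      intro h0
      rw [h0, Ideal.bot_mul, eq_comm, Ideal.span_singleton_eq_bot, Nat.cast_eq_zero] at h2
      exact hqp.ne_zero h2
    obtain ⟨a, ha0, ha⟩ := exists_pow_eq_span hh hp0
    obtain ⟨η, x, y, hx, hy, hxy⟩ :=
      hs'.exists_norm_of_idealClass_mem_squares hh (hbot Q hqQ) hsq h1 ha
    have h3 : Ideal.span {algebraMap ℤ (𝓞 k) (hs.norm (η * a))} =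
        Ideal.span {algebraMap ℤ (𝓞 k) ((q : ℤ) ^ h)} := by
      rw [hs.algebraMap_norm, map_mul s, ← Ideal.span_singleton_mul_span_singleton,
        Ideal.span_singleton_mul_left_unit η.isUnit,
        Ideal.span_singleton_mul_left_unit (η.isUnit.map s), ← map_span, ← ha, Ideal.map_pow,
        ← mul_pow, h2, Ideal.span_singleton_pow]
      simp
    obtain ⟨e, he⟩ := hs.exists_unit_of_span_eq h3
    have h4 : j (η * a) * (j.comp s) (η * a) = 5 ∨ j (η * a) * (j.comp s) (η * a) = -5 := by
      have h5 : j (η * a) * (j.comp s) (η * a) = ((hs.norm (η * a) : ℤ) : ZMod (2 ^ 3)) := by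
        rw [← map_intCast j, ← eq_intCast (algebraMap ℤ (𝓞 k)), hs.algebraMap_norm]
        exact (map_mul j _ (s _)).symm
      rw [h5]
      rcases Int.units_eq_one_or e with rfl | rfl
      · left
        have h6 := congrArg (Int.cast : ℤ → ZMod (2 ^ 3)) he
        push_cast at h6
        rw [← hqj]
        simpa using h6.symm
      · right
        have h6 := congrArg (Int.cast : ℤ → ZMod (2 ^ 3)) he
        push_cast at h6
        rw [← hqj]
        simpa [neg_eq_iff_eq_neg] using h6.symm
    have key : ∀ w z : ZMod (2 ^ 3), (w * z = 5 ∨ w * z = -5) → IsUnit w ∧ IsUnit z ∧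
        ¬ ((w = 1 ∨ w = -1) ∧ (z = 1 ∨ z = -1)) := by decide
    obtain ⟨k1, k2, k3⟩ := key _ _ h4
    exact k3 ⟨hj _ x y hx hxy.symm k1, hjs _ x y hx hxy.symm k2⟩
  have hint : Algebra.IsIntegral (𝓞 k) (𝓞 K) := inferInstance
  obtain ⟨Q, hQ, hqQ⟩ : ∃ Q : Ideal (𝓞 K), Q.IsPrime ∧ (q : 𝓞 K) ∈ Q := by
    have hprime : (Ideal.span {(q : ℤ)}).IsPrime :=
      (Ideal.span_singleton_prime (by exact_mod_cast hqp.ne_zero)).2 (Nat.prime_iff_prime_int.1 hqp)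
    obtain ⟨Q, -, h1, h2⟩ :=
      Ideal.exists_ideal_over_prime_of_isIntegral (Ideal.span {(q : ℤ)}) (⊥ : Ideal (𝓞 K)) (by
        rw [← RingHom.ker_eq_comap_bot, (RingHom.injective_iff_ker_eq_bot _).1
          (FaithfulSMul.algebraMap_injective ℤ (𝓞 K))]
        exact bot_le)
    have h3 : (q : ℤ) ∈ Q.comap (algebraMap ℤ (𝓞 K)) := h2 ▸ Ideal.mem_span_singleton_self _
    rw [Ideal.mem_comap, map_natCast] at h3
    exact ⟨Q, h1, h3⟩
  rw [card_two_torsion_eq_index]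
  refine ⟨Subgroup.two_le_index_of_notMem (hsingle Q hQ hqQ), fun hjε => ?_⟩
  have hjη : ∀ η : (𝓞 k)ˣ, j η = 1 ∨ j η = -1 := by
    have h1 : Units.map (j : 𝓞 k →* ZMod (2 ^ 3)) ε = 1 ∨
        Units.map (j : 𝓞 k →* ZMod (2 ^ 3)) ε = -1 := by
      refine hjε.imp (fun h => Units.ext h) (fun h => Units.ext ?_)
      rw [Units.val_neg, Units.val_one]
      exact h
    have h2 : ∀ i : ℤ, j ((ε ^ i : (𝓞 k)ˣ) : 𝓞 k) = 1 ∨ j ((ε ^ i : (𝓞 k)ˣ) : 𝓞 k) = -1 := by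
      intro i
      have h3 : j ((ε ^ i : (𝓞 k)ˣ) : 𝓞 k) =
          ((Units.map (j : 𝓞 k →* ZMod (2 ^ 3)) ε ^ i : (ZMod (2 ^ 3))ˣ) : ZMod (2 ^ 3)) := by
        rw [← map_zpow]
        rfl
      rw [h3]
      rcases h1 with h1 | h1
      · left
        rw [h1, one_zpow, Units.val_one]
      · rw [h1]
        rcases Int.even_or_odd i with hi | hi
        · left
          rw [hi.neg_one_zpow, Units.val_one]
        · right
          rw [hi.neg_one_zpow, Units.val_neg, Units.val_one]
    intro η
    obtain ⟨i, rfl | rfl⟩ := hunits η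
    · exact h2 i
    · rw [Units.val_neg, map_neg, neg_inj, neg_eq_iff_eq_neg]
      exact (h2 i).symm
  set p := Q.comap (algebraMap (𝓞 k) (𝓞 K)) with hp_def
  have hp' : (p.map s).IsPrime := isPrime_map s (hQ.comap _)
  obtain ⟨Q', hQ', hQp⟩ : ∃ Q' : Ideal (𝓞 K), Q'.IsPrime ∧
      Q'.comap (algebraMap (𝓞 k) (𝓞 K)) = p.map s := by
    obtain ⟨Q', -, h1, h2⟩ := Ideal.exists_ideal_over_prime_of_isIntegral (p.map s)
      (⊥ : Ideal (𝓞 K)) (by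
      rw [← RingHom.ker_eq_comap_bot, (RingHom.injective_iff_ker_eq_bot _).1 hs'.inj]
      exact bot_le)
    exact ⟨Q', h1, h2⟩
  have hqQ' : (q : 𝓞 K) ∈ Q' := by
    have h1 : (q : 𝓞 k) ∈ Q'.comap (algebraMap (𝓞 k) (𝓞 K)) := by
      rw [hQp, hs.mem_map, map_natCast, hp_def, Ideal.mem_comap, map_natCast]
      exact hqQ
    rwa [Ideal.mem_comap, map_natCast] at h1
  refine Subgroup.four_le_index_of_notMem (hsingle Q hQ hqQ) (hsingle Q' hQ' hqQ') ?_ ⟨_, rfl⟩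
  rw [← idealClass_mul (hbot Q hqQ) (hbot Q' hqQ')]
  intro hsq
  obtain ⟨h1, h2⟩ := hsplit Q hQ hqQ
  have h3 : Q * Q' * (Q * Q').map s' =
      (Ideal.span {(q : 𝓞 k)}).map (algebraMap (𝓞 k) (𝓞 K)) := by
    rw [Ideal.map_mul, mul_mul_mul_comm, h1, (hsplit Q' hQ' hqQ').1, hQp, ← Ideal.map_mul, h2]
  obtain ⟨η, x, y, hx, hy, hxy⟩ := hs'.exists_norm_of_idealClass_mem_squares hh
    (mul_ne_zero (hbot Q hqQ) (hbot Q' hqQ')) hsq h3 (Ideal.span_singleton_pow _ h)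
  have key : ∀ w : ZMod (2 ^ 3), (w = 1 ∨ w = -1) → IsUnit (w * 5) ∧
      ¬ (w * 5 = 1 ∨ w * 5 = -1) := by decide
  have h4 : j (η * (q : 𝓞 k) ^ h) = j η * 5 := by
    rw [map_mul, map_pow, map_natCast, hqj]
  obtain ⟨k1, k2⟩ := key _ (hjη η)
  exact k2 (h4 ▸ hj _ x y hx hxy.symm (h4 ▸ k1))

end IsSqrtExt

theorem exists_prime_mod_eight_eq_five {l : ℕ} [Fact l.Prime] (hl : l % 8 = 1) (a : (ZMod l)ˣ) :
    ∃ q : ℕ, q.Prime ∧ l < q ∧ q % 8 = 5 ∧ (q : ZMod l) = a := by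
  have hcop : Nat.Coprime l 8 := by
    rw [show 8 = 2 ^ 3 by norm_num, Nat.coprime_pow_right_iff (by norm_num), Nat.coprime_two_right]
    exact Nat.odd_iff.2 (by omega)
  obtain ⟨c, hc1, hc2⟩ := Nat.chineseRemainder hcop (a : ZMod l).val 5
  have hc3 : (c : ZMod l) = a := by
    rw [(ZMod.natCast_eq_natCast_iff _ _ _).2 hc1, ZMod.natCast_zmod_val]
  have hc4 : c % 8 = 5 := hc2
  have hl0 : l ≠ 0 := (Fact.out : l.Prime).ne_zero
  have : NeZero (l * 8) := ⟨by omega⟩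
  have hc5 : IsUnit (c : ZMod (l * 8)) := by
    rw [ZMod.isUnit_iff_coprime, Nat.coprime_mul_iff_right]
    constructor
    · rw [← ZMod.isUnit_iff_coprime, hc3]
      exact a.isUnit
    · rw [show 8 = 2 ^ 3 by norm_num, Nat.coprime_pow_right_iff (by norm_num),
        Nat.coprime_two_right]
      exact Nat.odd_iff.2 (by omega)
  obtain ⟨q, hq, hqp, hqc⟩ := Nat.forall_exists_prime_gt_and_eq_mod hc5 l
  have h1 : q ≡ c [MOD l * 8] := (ZMod.natCast_eq_natCast_iff _ _ _).1 hqc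
  refine ⟨q, hqp, hq, ?_, ?_⟩
  · have h2 : q % 8 = c % 8 := h1.of_mul_left l
    rw [h2, hc4]
  · rw [(ZMod.natCast_eq_natCast_iff q c l).2 (h1.of_mul_right 8), hc3]

/-- The `2`-torsion of the class group of `ℚ(√(2 ε √l))`, where `ε = u + v √l` is a generator of
the units of `ℚ(√l)` modulo torsion. -/
theorem IsSqrtExt.card_two_torsion_eq {k : Type*} [Field k] [NumberField k] {l : ℕ} {r : 𝓞 k}
    (hk : IsSqrtExt (l : ℚ) (r : k)) (hlp : l.Prime) (hl : l % 8 = 1)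
    {ε : (𝓞 k)ˣ} {u v : ℤ} (hv0 : 0 < v) (huv : u ^ 2 + 1 = l * v ^ 2) (hε : (ε : 𝓞 k) = u + v * r)
    (hunits : ∀ η : (𝓞 k)ˣ, ∃ j : ℤ, η = ε ^ j ∨ η = -ε ^ j)
    {K : Type*} [Field K] [NumberField K] [Algebra k K] {δ : 𝓞 K}
    (hK : IsSqrtExt (2 * algebraMap (𝓞 k) k (r * ε)) (algebraMap (𝓞 K) K δ)) :
    Nat.card {c : ClassGroup (𝓞 K) // c ^ 2 = 1} = if 8 ∣ u then 4 else 2 := by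
  have : Fact l.Prime := ⟨hlp⟩
  have hl' : (l : ℤ) % 8 = 1 := by omega
  obtain ⟨hu4, hv⟩ := even_and_odd_of_sq_add_one hl' huv
  have hv4 : v % 4 = 1 := by
    obtain ⟨-, -, -, p, q, -, -, -, -, -, h⟩ :=
      GaussianInt.exists_quarticChar (l := l) (by omega) hv hv0 huv
    have h1 : ∀ x : ℤ, x ^ 2 % 4 = 0 ∨ x ^ 2 % 4 = 1 := by
      intro x
      rcases Int.even_or_odd' x with ⟨c, rfl | rfl⟩
      · left
        ring_nf
        omega
      · right
        ring_nf
        omega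
    have h2 := Int.odd_iff.1 hv
    have h3 := h1 p
    have h4 := h1 q
    omega
  obtain ⟨τ, hτ⟩ := hk.exists_conj
  have hs := hk.isQuadraticConj ℤ (𝓞 k) two_ne_zero hτ
  have hτ' := algebraMap_galRestrict_apply ℤ (K := ℚ) (L := k) (B := 𝓞 k) τ
  set s := galRestrict ℤ ℚ k (𝓞 k) τ with hs_def
  have hsr : s r = -r := by
    apply FaithfulSMul.algebraMap_injective (𝓞 k) k
    rw [hτ', map_neg]
    exact hτ
  obtain ⟨σ, hσ⟩ := hK.exists_conj
  have hs' := hK.isQuadraticConj (𝓞 k) (𝓞 K) two_ne_zero hσ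
  have hδ : galRestrict (𝓞 k) k K (𝓞 K) σ δ = -δ := by
    apply FaithfulSMul.algebraMap_injective (𝓞 K) K
    rw [algebraMap_galRestrict_apply, map_neg]
    exact hσ
  have hδ2 : δ ^ 2 = algebraMap (𝓞 k) (𝓞 K) (2 * (r * ε)) := by
    apply FaithfulSMul.algebraMap_injective (𝓞 K) K
    rw [map_pow, hK.sq, ← IsScalarTower.algebraMap_apply (𝓞 k) (𝓞 K) K,
      IsScalarTower.algebraMap_apply (𝓞 k) k K, map_mul (algebraMap (𝓞 k) k) 2,
      map_ofNat]
  obtain ⟨j, hj, hjs, hju⟩ := hk.exists_ringHom_zmod hl hτ' hv4 huv hu4 hε hK hσ hs'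
  obtain ⟨g, hg⟩ := IsCyclic.exists_generator (α := (ZMod l)ˣ)
  obtain ⟨q, hqp, hlq, hq8, hqg⟩ := exists_prime_mod_eight_eq_five hl (g ^ 2)
  rw [Units.val_pow_eq_pow_val] at hqg
  have : Fact q.Prime := ⟨hqp⟩
  have hql : (l : ZMod q) ≠ 0 := by
    rw [Ne, ZMod.natCast_eq_zero_iff]
    intro h
    exact hlq.ne' ((Nat.prime_dvd_prime_iff_eq hqp hlp).1 h)
  have hlsq : IsSquare (l : ZMod q) :=
    (ZMod.exists_sq_eq_prime_iff_of_mod_four_eq_one (p := l) (q := q) (by omega) (by omega)).1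
      ⟨g, by rw [hqg, pow_two]⟩
  obtain ⟨h2, h4⟩ := hk.le_card_two_torsion hlp hl hs hsr huv hε hunits hδ2 hs' hδ hq8 hql hlsq
    (fun ρ hρ => isSquare_two_mul_unit_mul hl hq8 hlq hv hv0 huv hg hqg hρ) hj hjs
  have hle := hk.card_two_torsion_mul_index_le hlp hl hs hsr hv0 huv hε hunits hK hs' hδ
  split_ifs with h8
  · have h5 := hle ⊤ fun _ _ _ _ _ _ => Subgroup.mem_top _
    rw [Subgroup.index_top, mul_one] at h5
    exact le_antisymm h5 (h4 (hju.2 h8))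
  · obtain ⟨U, hU, hmem⟩ := hs'.exists_subgroup_two_le_index hj (mt hju.1 h8)
    have h5 := hle U hmem
    refine le_antisymm ?_ h2
    by_contra! h6
    have := Nat.mul_le_mul h6 hU
    omega

theorem two_pow_eq_neg_one_pow_iff {l : ℕ} [Fact l.Prime] (hl : l % 8 = 1) (n : ℕ) :
    (2 : ZMod l) ^ ((l - 1) / 4) = (-1) ^ n ↔
      (if (2 : ZMod l) ^ ((l - 1) / 4) = 1 then 1 else -1 : ℤ) = (-1) ^ n := by
  have hl2 : 2 < l := by
    have := (Fact.out : l.Prime).two_le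
    omega
  have : Fact (2 < l) := ⟨hl2⟩
  have h20 : (2 : ZMod l) ≠ 0 := by
    intro h
    have h1 := (ZMod.natCast_eq_zero_iff 2 l).1 (by exact_mod_cast h)
    have := Nat.le_of_dvd two_pos h1
    omega
  have h1 : ((2 : ZMod l) ^ ((l - 1) / 4)) ^ 2 = 1 := by
    rw [← pow_mul, show (l - 1) / 4 * 2 = l / 2 by omega]
    exact (ZMod.euler_criterion l h20).1 ((ZMod.exists_sq_eq_two_iff (by omega)).2 (Or.inl hl))
  have h2 := ZMod.neg_one_ne_one (n := l)
  have h3 : (-1 : ZMod l) ^ n = (((-1 : ℤ) ^ n : ℤ) : ZMod l) := by push_cast; rfl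
  rw [h3]
  rcases sq_eq_one_iff.1 h1 with h | h <;>
    rcases neg_one_pow_eq_or ℤ n with h4 | h4 <;> simp [h, h4, h2, h2.symm]

theorem exists_int_eq_of_isIntegral {l : ℕ} (hlp : l.Prime) (hl : l % 8 = 1) {ε : ℝ} (hε : 1 < ε)
    (hint : IsIntegral ℤ ε) (hint' : IsIntegral ℤ ε⁻¹) {u v : ℚ} (huv : ε = u + v * √l)
    (hn : (u : ℝ) ^ 2 - v ^ 2 * l = -1) :
    ∃ u' v' : ℤ, 0 < u' ∧ 0 < v' ∧ u' ^ 2 + 1 = l * v' ^ 2 ∧ ε = u' + v' * √l := by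
  have hl0 : (0 : ℝ) < l := by exact_mod_cast hlp.pos
  have hs : √(l : ℝ) ^ 2 = l := Real.sq_sqrt hl0.le
  have hs0 : 0 < √(l : ℝ) := Real.sqrt_pos.2 hl0
  have hinv : ε⁻¹ = -u + v * √l := by
    apply inv_eq_of_mul_eq_one_right
    rw [huv]
    linear_combination (v : ℝ) ^ 2 * hs - hn
  have hinv0 : 0 < ε⁻¹ := inv_pos.2 (by linarith)
  have hinv1 : ε⁻¹ < 1 := inv_lt_one_of_one_lt₀ hε
  have hu0 : (0 : ℝ) < u := by linarith
  have hv0 : (0 : ℝ) < v := by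
    have : 0 < (v : ℝ) * √l := by linarith
    exact pos_of_mul_pos_left this hs0.le
  have hrat : ∀ x : ℚ, IsIntegral ℤ (x : ℝ) → ∃ a : ℤ, (a : ℝ) = x := by
    intro x hx
    obtain ⟨a, rfl⟩ := IsIntegrallyClosed.isIntegral_iff.1
      ((isIntegral_algebraMap_iff (B := ℝ) (algebraMap ℚ ℝ).injective).1 hx)
    exact ⟨a, by simp⟩
  have hsint : IsIntegral ℤ √(l : ℝ) := by
    apply IsIntegral.of_pow two_pos
    rw [hs]
    exact isIntegral_algebraMap (R := ℤ) (x := (l : ℤ))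
  obtain ⟨a, ha⟩ := hrat (2 * u) (by
    have : ((2 * u : ℚ) : ℝ) = ε - ε⁻¹ := by
      rw [hinv, huv]
      push_cast
      ring
    rw [this]
    exact hint.sub hint')
  obtain ⟨b, hb⟩ := hrat (2 * v * l) (by
    have : ((2 * v * l : ℚ) : ℝ) = (ε + ε⁻¹) * √l := by
      rw [hinv, huv]
      push_cast
      linear_combination -2 * (v : ℝ) * hs
    rw [this]
    exact (hint.add hint').mul hsint)
  push_cast at ha hb
  have hab : b ^ 2 = l * (a ^ 2 + 4) := by
    have : (b : ℝ) ^ 2 = l * (a ^ 2 + 4) := by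
      rw [ha, hb]
      linear_combination 4 * (-l : ℝ) * hn
    exact_mod_cast this
  obtain ⟨c, rfl⟩ : (l : ℤ) ∣ b :=
    (Nat.prime_iff_prime_int.1 hlp).dvd_of_dvd_pow ⟨_, hab⟩
  have hc : (c : ℝ) = 2 * v := by
    push_cast at hb
    have : (l : ℝ) * (c - 2 * v) = 0 := by linear_combination hb
    rcases mul_eq_zero.1 this with h | h
    · exact absurd h hl0.ne'
    · linarith
  have hac : l * c ^ 2 = a ^ 2 + 4 := by
    have h1 : (l : ℤ) ≠ 0 := by exact_mod_cast hlp.ne_zero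
    apply mul_left_cancel₀ h1
    linear_combination hab
  have hmod : ∀ x y z : ZMod 8, x = 1 → x * y ^ 2 = z ^ 2 + 4 → 4 * z = 0 ∧ 4 * y = 0 := by
    decide
  have hmod' := hmod (l : ZMod 8) (c : ZMod 8) (a : ZMod 8) (by
    exact_mod_cast (ZMod.natCast_eq_natCast_iff l 1 8).2 hl) (by exact_mod_cast congrArg _ hac)
  have heven : ∀ x : ℤ, 4 * (x : ZMod 8) = 0 → ∃ y, x = 2 * y := by
    intro x hx
    have h1 : ((4 * x : ℤ) : ZMod 8) = 0 := by exact_mod_cast hx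
    have h2 := (ZMod.intCast_zmod_eq_zero_iff_dvd _ 8).1 h1
    exact ⟨x / 2, by push_cast at h2; omega⟩
  obtain ⟨u', rfl⟩ := heven a hmod'.1
  obtain ⟨v', rfl⟩ := heven c hmod'.2
  push_cast at ha hc
  have hu' : (u' : ℝ) = u := by linarith
  have hv' : (v' : ℝ) = v := by linarith
  refine ⟨u', v', by exact_mod_cast hu' ▸ hu0, by exact_mod_cast hv' ▸ hv0, by linarith, ?_⟩
  rw [hu', hv', huv]

theorem IntermediateField.exists_eq_add_mul_of_mem_adjoin {F E : Type*} [Field F] [Field E]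
    [Algebra F E] (L : IntermediateField F E) {t : E} (ht : t ^ 2 ∈ L) (hint : IsIntegral F t)
    {x : E} (hx : x ∈ IntermediateField.adjoin F {t}) : ∃ c ∈ L, ∃ d ∈ L, x = c + d * t := by
  rw [← mem_toSubalgebra, adjoin_simple_toSubalgebra_of_isAlgebraic hint.isAlgebraic] at hx
  induction hx using Algebra.adjoin_induction with
  | mem x hx =>
    rw [Set.mem_singleton_iff] at hx
    exact ⟨0, zero_mem _, 1, one_mem _, by rw [hx]; ring⟩
  | algebraMap a => exact ⟨_, L.algebraMap_mem a, 0, zero_mem _, by ring⟩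
  | add x y _ _ hx hy =>
    obtain ⟨c, hc, d, hd, rfl⟩ := hx
    obtain ⟨c', hc', d', hd', rfl⟩ := hy
    exact ⟨_, add_mem hc hc', _, add_mem hd hd', by ring⟩
  | mul x y _ _ hx hy =>
    obtain ⟨c, hc, d, hd, rfl⟩ := hx
    obtain ⟨c', hc', d', hd', rfl⟩ := hy
    exact ⟨_, add_mem (mul_mem hc hc') (mul_mem (mul_mem hd hd') ht), _,
      add_mem (mul_mem hc hd') (mul_mem hd hc'), by ring⟩

/-- `2 ε √l` is not a square in `ℚ(√l)`, since its norm `4 l` is not a square. -/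
theorem IsSqrtExt.not_isSquare_two_mul {k : Type*} [Field k] [NumberField k] {l : ℕ} {r : 𝓞 k}
    (hk : IsSqrtExt (l : ℚ) (r : k)) {ε : 𝓞 k} {u v : ℤ} (huv : u ^ 2 + 1 = l * v ^ 2)
    (hε : ε = u + v * r) : ¬ IsSquare (2 * algebraMap (𝓞 k) k (r * ε)) := by
  rintro ⟨x, hx⟩
  obtain ⟨τ, hτ⟩ := hk.exists_conj
  obtain ⟨c, d, rfl⟩ := hk.exists_eq x
  have h1 : 2 * algebraMap (𝓞 k) k (r * ε) =
      algebraMap ℚ k (2 * l * v) + algebraMap ℚ k (2 * u) * algebraMap (𝓞 k) k r := by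
    rw [hε, mul_add, mul_left_comm, ← pow_two, hk.sq_eq_natCast]
    simp
    ring
  have h2 := hk.mul_conj hτ (2 * l * v) (2 * u)
  have h3 := hk.mul_conj hτ c d
  rw [← h1, hx, map_mul, mul_mul_mul_comm, h3, ← map_mul] at h2
  have h4 := (algebraMap ℚ k).injective h2
  apply hk.not_isSquare
  refine ⟨(c ^ 2 - l * d ^ 2) / 2, ?_⟩
  have h5 : (u : ℚ) ^ 2 + 1 = l * v ^ 2 := by exact_mod_cast huv
  linear_combination (-1 / 4 : ℚ) * h4 + l * h5

theorem Units.exists_eq_zpow_or_eq_neg_zpow {R : Type*} [CommRing R] {φ : R →+* ℝ}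
    (hφ : Function.Injective φ) {ε : Rˣ} (hε : 1 < φ ε)
    (hmin : ∀ η : Rˣ, 1 < φ η → φ ε ≤ φ η) (η : Rˣ) : ∃ j : ℤ, η = ε ^ j ∨ η = -ε ^ j := by
  have hpos : ∀ η : Rˣ, 0 < φ η → ∃ j : ℤ, η = ε ^ j := by
    intro η hη
    obtain ⟨j, hj1, hj2⟩ := exists_mem_Ico_zpow hη hε
    have hε0 : 0 < φ ε := one_pos.trans hε
    have hz : ∀ i : ℤ, φ ((ε ^ i : Rˣ) : R) = φ ε ^ i := by
      intro i
      have := congrArg Units.val (map_zpow (Units.map (φ : R →* ℝ)) ε i)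
      rwa [Units.val_zpow_eq_zpow_val] at this
    have h1 : φ ((η * ε ^ (-j) : Rˣ) : R) = φ η / φ ε ^ j := by
      rw [Units.val_mul, map_mul, hz, zpow_neg, div_eq_mul_inv]
    refine ⟨j, ?_⟩
    rcases hj1.eq_or_lt with h | h
    · exact Units.ext (hφ (by rw [hz, h]))
    · have h2 := hmin (η * ε ^ (-j)) (by rwa [h1, one_lt_div (zpow_pos hε0 j)])
      rw [h1, le_div_iff₀ (zpow_pos hε0 j), ← zpow_one_add₀ hε0.ne', add_comm] at h2
      exact absurd hj2 h2.not_gt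
  have h0 : φ η ≠ 0 := (η.isUnit.map φ).ne_zero
  rcases h0.lt_or_gt with h | h
  · obtain ⟨j, hj⟩ := hpos (-η) (by rwa [Units.val_neg, map_neg, neg_pos])
    exact ⟨j, Or.inr (by rw [← hj, neg_neg])⟩
  · obtain ⟨j, hj⟩ := hpos η h
    exact ⟨j, Or.inl hj⟩

theorem IntermediateField.exists_ringOfIntegers_eq (k : IntermediateField ℚ ℝ) {x : ℝ} (hx : x ∈ k)
    (hint : IsIntegral ℤ x) : ∃ y : 𝓞 k, ((algebraMap (𝓞 k) k y : k) : ℝ) = x := by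
  have h1 : IsIntegral ℤ (⟨x, hx⟩ : k) :=
    (isIntegral_algebraMap_iff (A := k) (B := ℝ) (algebraMap k ℝ).injective).1 hint
  exact ⟨⟨⟨x, hx⟩, h1⟩, rfl⟩

theorem twoTorsCard_eq {l : ℕ} (hlp : l.Prime) (hl : l % 8 = 1) {ε : ℝ}
    (hε : IsFundamentalUnit l ε) {u v : ℤ} (hu0 : 0 < u) (hv0 : 0 < v)
    (huv : u ^ 2 + 1 = l * v ^ 2) (hεuv : ε = u + v * √l) {K : IntermediateField ℚ ℝ}
    (hK : K = IntermediateField.adjoin ℚ {√(2 * ε * √l)}) [NumberField K] :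
    twoTorsCard K = if 8 ∣ u then 4 else 2 := by
  obtain ⟨h1, hεk, hεi, hεi', hmin⟩ := hε
  obtain ⟨k, hk⟩ : ∃ k, k = IntermediateField.adjoin ℚ {√(l : ℝ)} := ⟨_, rfl⟩
  rw [← hk] at hεk hmin
  have hl0 : (0 : ℝ) < l := by exact_mod_cast hlp.pos
  have hs : √(l : ℝ) ^ 2 = l := Real.sq_sqrt hl0.le
  have hsint : IsIntegral ℤ √(l : ℝ) := by
    apply IsIntegral.of_pow two_pos
    rw [hs]
    exact isIntegral_algebraMap (R := ℤ) (x := (l : ℤ))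
  have hsk : √(l : ℝ) ∈ k := hk ▸ IntermediateField.mem_adjoin_simple_self ℚ _
  obtain ⟨r, hr⟩ := k.exists_ringOfIntegers_eq hsk hsint
  have hkr : IsSqrtExt (l : ℚ) (algebraMap (𝓞 k) k r) := by
    refine ⟨Subtype.ext ?_, ?_, fun x => ?_⟩
    · push_cast
      rw [hr, hs]
    · rw [Rat.isSquare_natCast_iff]
      exact hlp.prime.irreducible.not_isSquare
    · obtain ⟨c, hc, d, hd, hx⟩ := IntermediateField.exists_eq_add_mul_of_mem_adjoin
        (⊥ : IntermediateField ℚ ℝ) (t := √(l : ℝ)) (by rw [hs]; exact natCast_mem _ l)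
        hsint.tower_top (x := (x : ℝ)) (by rw [← hk]; exact x.2)
      obtain ⟨c, rfl⟩ := IntermediateField.mem_bot.1 hc
      obtain ⟨d, rfl⟩ := IntermediateField.mem_bot.1 hd
      refine ⟨c, d, Subtype.ext ?_⟩
      rw [hx, ← hr]
      rfl
  have : FiniteDimensional ℚ k := Module.finite_of_finrank_pos (by
    rw [hkr.finrank_eq_two]
    exact two_pos)
  have : NumberField k := ⟨⟩
  let φ : 𝓞 k →+* ℝ := (algebraMap k ℝ).comp (algebraMap (𝓞 k) k)
  have hφ : Function.Injective φ :=
    (algebraMap k ℝ).injective.comp (FaithfulSMul.algebraMap_injective (𝓞 k) k)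
  have hφr : φ r = √l := hr
  let e : (𝓞 k)ˣ := ⟨u + v * r, -u + v * r, hφ (by
      simp only [map_mul, map_add, map_neg, map_intCast, hφr, map_one]
      have : (u : ℝ) ^ 2 + 1 = l * v ^ 2 := by exact_mod_cast huv
      linear_combination (v : ℝ) ^ 2 * hs - this), hφ (by
      simp only [map_mul, map_add, map_neg, map_intCast, hφr, map_one]
      have : (u : ℝ) ^ 2 + 1 = l * v ^ 2 := by exact_mod_cast huv
      linear_combination (v : ℝ) ^ 2 * hs - this)⟩
  have he : (e : 𝓞 k) = u + v * r := rfl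
  have hφe : φ e = ε := by
    rw [he, hεuv]
    simp [hφr]
  have hunits := Units.exists_eq_zpow_or_eq_neg_zpow hφ (ε := e) (hφe ▸ h1) (fun η hη => by
    rw [hφe]
    have hφint : ∀ x : 𝓞 k, IsIntegral ℤ (φ x) := fun x =>
      (RingOfIntegers.isIntegral_coe x).map ((algebraMap k ℝ).toIntAlgHom)
    refine hmin _ hη (algebraMap (𝓞 k) k η).2 (hφint _) ?_
    have h2 : (φ η)⁻¹ = φ ((η⁻¹ : (𝓞 k)ˣ) : 𝓞 k) := by
      apply inv_eq_of_mul_eq_one_right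
      rw [← map_mul, Units.mul_inv, map_one]
    rw [h2]
    exact hφint _)
  have hε0 : 0 < ε := one_pos.trans h1
  have hδ2 : √(2 * ε * √l) ^ 2 = 2 * ε * √l :=
    Real.sq_sqrt (by positivity)
  have hδK : √(2 * ε * √l) ∈ K := hK ▸ IntermediateField.mem_adjoin_simple_self ℚ _
  have hδint : IsIntegral ℤ √(2 * ε * √l) := by
    apply IsIntegral.of_pow two_pos
    rw [hδ2]
    exact ((isIntegral_algebraMap (R := ℤ) (x := 2)).mul hεi).mul hsint
  obtain ⟨δ, hδ⟩ := K.exists_ringOfIntegers_eq hδK hδint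
  have hle : k ≤ K := by
    rw [hk, IntermediateField.adjoin_simple_le_iff]
    have h2 : √(l : ℝ) = (√(2 * ε * √l) ^ 2 - (2 * l * v : ℚ)) * ((2 * u : ℚ) : ℝ)⁻¹ := by
      rw [hδ2, hεuv]
      have : (u : ℝ) ≠ 0 := by exact_mod_cast hu0.ne'
      push_cast
      field_simp
      linear_combination (-v : ℝ) * hs
    rw [h2]
    exact mul_mem (sub_mem (pow_mem hδK 2) (K.algebraMap_mem _)) (inv_mem (K.algebraMap_mem _))
  let _ : Algebra k K := (IntermediateField.inclusion hle).toRingHom.toAlgebra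
  have hKδ : IsSqrtExt (2 * algebraMap (𝓞 k) k (r * e)) (algebraMap (𝓞 K) K δ) := by
    refine ⟨Subtype.ext ?_, hkr.not_isSquare_two_mul huv he, fun x => ?_⟩
    · change ((algebraMap (𝓞 K) K δ : K) : ℝ) ^ 2 =
        algebraMap k ℝ (2 * algebraMap (𝓞 k) k (r * e))
      rw [hδ, hδ2, map_mul, map_ofNat]
      change _ = 2 * φ (r * e)
      rw [map_mul, hφr, hφe]
      ring
    · obtain ⟨c, hc, d, hd, hx⟩ := IntermediateField.exists_eq_add_mul_of_mem_adjoin k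
        (by rw [hδ2]; exact mul_mem (mul_mem (ofNat_mem k 2) hεk) hsk) hδint.tower_top
        (x := (x : ℝ)) (by rw [← hK]; exact x.2)
      refine ⟨⟨c, hc⟩, ⟨d, hd⟩, Subtype.ext ?_⟩
      rw [hx, ← hδ]
      rfl
  exact hkr.card_two_torsion_eq hlp hl hv0 huv he hunits hKδ

/-- for a prime `l ≡ 1 (mod 8)` and `n = 2`, so `𝕂 = ℚ(√(2ε₀√l))`:
if `(2/l)₄ = (-1)^((l-1)/8)` then `r₂(H) = 2`; otherwise `r₂(H) = 1`. -/
theorem stmt_1 (l : ℕ) (hl : l.Prime) (hl8 : l % 8 = 1)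
    (ε₀ : ℝ) (hε : IsFundamentalUnit l ε₀)
    (hεnorm : ∃ u v : ℚ, ε₀ = (u : ℝ) + (v : ℝ) * Real.sqrt (l : ℝ) ∧
      (u : ℝ) ^ 2 - (v : ℝ) ^ 2 * (l : ℝ) = -1)
    (K : IntermediateField ℚ ℝ)
    (hK : K = IntermediateField.adjoin ℚ
      ({Real.sqrt ((2 : ℝ) * ε₀ * Real.sqrt (l : ℝ))} : Set ℝ))
    [NumberField K] :
    (quartSym l 2 = (-1 : ℤ) ^ ((l - 1) / 8) → twoTorsCard K = 2 ^ 2) ∧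
      (quartSym l 2 ≠ (-1 : ℤ) ^ ((l - 1) / 8) → twoTorsCard K = 2 ^ 1) := by
  have : Fact l.Prime := ⟨hl⟩
  obtain ⟨a, b, hab, hn⟩ := hεnorm
  obtain ⟨u, v, hu0, hv0, huv, hεuv⟩ :=
    exists_int_eq_of_isIntegral hl hl8 hε.1 hε.2.2.1 hε.2.2.2.1 hab hn
  have h1 : quartSym l 2 = (-1 : ℤ) ^ ((l - 1) / 8) ↔ 8 ∣ u := by
    rw [← two_pow_eq_iff hl8 hu0 huv, two_pow_eq_neg_one_pow_iff hl8, quartSym, Int.cast_ofNat]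
  rw [twoTorsCard_eq hl hl8 hε hu0 hv0 huv hεuv hK, Ne, h1]
  exact ⟨fun h => by rw [if_pos h]; rfl, fun h => by rw [if_neg h]; rfl⟩
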